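/- arXiv:1402.0216 — 3 statements merged into one kernel-verified Lean document; each statement's English description precedes it below -/
import Mathlib

section
/- Each polynomial P_j in the normalized first-kind differential ω_j = P_j(z)/R(z) dz is real and has exactly one simple zero in the interior of each gap c_k for k ≠ j (k = 1,...,g), and no zeros in the gap c_j; in particular deg P_j ≤ g - 1 and the g-1 zeros separate the gaps. -/
open Complex Set Filter

theorem aux_rootfree_sign (s : Set ℝ) (hs : IsOpen s) (hne : s.Nonempty) (hp : IsPreconnected s)
    (h : ℝ → ℝ) (hc : ContinuousOn h s) (h0 : ∀ x ∈ s, h x ≠ 0)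
    (hi : MeasureTheory.IntegrableOn h s) :
    ((∀ x ∈ s, 0 < h x) ∧ 0 < ∫ x in s, h x) ∨ ((∀ x ∈ s, h x < 0) ∧ ∫ x in s, h x < 0) := by
  have pos : ∀ k : ℝ → ℝ, MeasureTheory.IntegrableOn k s → (∀ x ∈ s, 0 < k x) →
      0 < ∫ x in s, k x := by
    intro k hk hpos
    rw [MeasureTheory.setIntegral_pos_iff_support_of_nonneg_ae _ hk]
    · have : Function.support k ∩ s = s := by
        ext x; simp only [mem_inter_iff, Function.mem_support]
        exact ⟨fun h => h.2, fun h => ⟨(hpos x h).ne', h⟩⟩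
      rw [this]
      exact hs.measure_pos _ hne
    · filter_upwards [MeasureTheory.ae_restrict_mem hs.measurableSet] with x hx
      exact (hpos x hx).le
  obtain ⟨x0, hx0⟩ := hne
  have key : (∀ x ∈ s, 0 < h x) ∨ (∀ x ∈ s, h x < 0) := by
    by_contra hcon
    push Not at hcon
    obtain ⟨⟨x, hx, hx1⟩, ⟨y, hy, hy1⟩⟩ := hcon
    obtain ⟨z, hz, hz0⟩ := hp.intermediate_value hx hy hc (show (0:ℝ) ∈ Icc (h x) (h y) from ⟨hx1, hy1⟩)
    exact h0 z hz hz0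
  rcases key with k | k
  · exact Or.inl ⟨k, pos h hi k⟩
  · refine Or.inr ⟨k, ?_⟩
    have := pos (fun x => - h x) hi.neg (fun x hx => by have := k x hx; linarith)
    rw [MeasureTheory.integral_neg] at this
    linarith

theorem aux_inv_sqrt (c : ℝ) :
    MeasureTheory.LocallyIntegrable (fun x : ℝ => (Real.sqrt |x - c|)⁻¹) := by
  have h1 : ∀ T : ℝ, 0 ≤ T → IntervalIntegrable (fun x : ℝ => (Real.sqrt |x|)⁻¹) MeasureTheory.volume 0 T := by
    intro T hT
    have := intervalIntegral.intervalIntegrable_rpow' (a := 0) (b := T) (r := -(1/2)) (by norm_num)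
    refine this.congr ?_
    intro x hx
    rw [uIoc_of_le hT] at hx
    simp only
    rw [Real.rpow_neg hx.1.le, Real.sqrt_eq_rpow, abs_of_pos hx.1]
  have h2 : ∀ T : ℝ, 0 ≤ T → IntervalIntegrable (fun x : ℝ => (Real.sqrt |x|)⁻¹) MeasureTheory.volume (-T) T := by
    intro T hT
    have := (IntervalIntegrable.iff_comp_neg).1 (h1 T hT)
    simp only [neg_zero, abs_neg] at this
    exact this.symm.trans (h1 T hT)
  have h3 : MeasureTheory.LocallyIntegrable (fun x : ℝ => (Real.sqrt |x|)⁻¹) := by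
    rw [MeasureTheory.locallyIntegrable_iff]
    intro K hK
    obtain ⟨r, hr⟩ := hK.isBounded.subset_closedBall 0
    have hT : 0 ≤ |r| := abs_nonneg r
    have := h2 |r| hT
    rw [intervalIntegrable_iff_integrableOn_Icc_of_le (by linarith)] at this
    refine this.mono_set ?_
    intro x hx
    have := hr hx
    simp only [Metric.mem_closedBall, dist_zero_right, Real.norm_eq_abs] at this
    exact abs_le.1 (this.trans (le_abs_self r))
  rw [MeasureTheory.locallyIntegrable_iff]
  intro K hK
  have hK' : IsCompact ((fun x => x - c) '' K) := hK.image (by fun_prop)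
  have h4 := (MeasureTheory.locallyIntegrable_iff.1 h3) _ hK'
  have h5 := (MeasureTheory.measurePreserving_sub_right (MeasureTheory.volume : MeasureTheory.Measure ℝ) c).integrableOn_image
    (Homeomorph.subRight c).measurableEmbedding (f := fun x : ℝ => (Real.sqrt |x|)⁻¹) (s := K)
  exact h5.1 h4

theorem aux_w (n : ℕ) (a : ℕ → ℝ) (ha : ∀ i < n, ∀ j < n, i ≠ j → a i ≠ a j) :
    MeasureTheory.LocallyIntegrable
      (fun x : ℝ => (Real.sqrt (∏ j ∈ Finset.range n, |x - a j|))⁻¹) := by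
  intro x
  by_cases hx : ∃ i < n, x = a i
  · obtain ⟨i, hi, rfl⟩ := hx
    have hO : (fun x : ℝ => (Real.sqrt (∏ j ∈ Finset.range n, |x - a j|))⁻¹) =O[nhds (a i)]
        (fun x : ℝ => (Real.sqrt |x - a i|)⁻¹) := by
      have e : (fun x : ℝ => (Real.sqrt (∏ j ∈ Finset.range n, |x - a j|))⁻¹) =
          fun x => (Real.sqrt |x - a i|)⁻¹ *
            (Real.sqrt (∏ j ∈ (Finset.range n).erase i, |x - a j|))⁻¹ := by
        funext y
        rw [← Finset.mul_prod_erase _ _ (Finset.mem_range.2 hi), Real.sqrt_mul (abs_nonneg _), mul_inv]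
      rw [e]
      have hc : ContinuousAt (fun x : ℝ => (Real.sqrt (∏ j ∈ (Finset.range n).erase i, |x - a j|))⁻¹) (a i) := by
        apply ContinuousAt.inv₀
        · fun_prop
        · apply ne_of_gt
          apply Real.sqrt_pos.2
          apply Finset.prod_pos
          intro j hj
          simp only [Finset.mem_erase, Finset.mem_range] at hj
          exact abs_pos.2 (sub_ne_zero.2 (ha i hi j hj.2 (Ne.symm hj.1)))
      have := (Asymptotics.isBigO_refl (fun x : ℝ => (Real.sqrt |x - a i|)⁻¹) (nhds (a i))).mul
        (hc.tendsto.isBigO_one ℝ)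
      simpa using this
    refine hO.integrableAtFilter ?_ (aux_inv_sqrt (a i) (a i))
    refine (Measurable.aestronglyMeasurable ?_).stronglyMeasurableAtFilter
    fun_prop
  · push Not at hx
    have hc : ContinuousAt (fun x : ℝ => (Real.sqrt (∏ j ∈ Finset.range n, |x - a j|))⁻¹) x := by
      apply ContinuousAt.inv₀
      · fun_prop
      · apply ne_of_gt
        apply Real.sqrt_pos.2
        apply Finset.prod_pos
        intro j hj
        exact abs_pos.2 (sub_ne_zero.2 (hx j (Finset.mem_range.1 hj)))
    refine (hc.tendsto.isBigO_one ℝ).integrableAtFilter ?_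
      (MeasureTheory.locallyIntegrable_const (1 : ℝ) x)
    refine (Measurable.aestronglyMeasurable ?_).stronglyMeasurableAtFilter
    fun_prop

theorem aux_key (F : ℂ → ℂ) (hF : DifferentiableOn ℂ F {z : ℂ | 0 < z.im}) (M C : ℝ)
    (hM : 1 ≤ M) (hC : 0 ≤ C)
    (far : ∀ z : ℂ, 0 < z.im → M ≤ ‖z‖ → ‖F z‖ ≤ C / ‖z‖ ^ 2)
    (w : ℝ → ℝ) (hw : MeasureTheory.LocallyIntegrable w) (hw0 : ∀ x, 0 ≤ w x)
    (near : ∀ᵐ x : ℝ, ∀ z : ℂ, z.re = x → 0 < z.im → z.im ≤ 1 → |z.re| ≤ M → ‖F z‖ ≤ w z.re)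
    (f : ℝ → ℂ)
    (hlim : ∀ᵐ x : ℝ, Tendsto F (nhdsWithin (x : ℂ) {z : ℂ | 0 < z.im}) (nhds (f x))) :
    MeasureTheory.Integrable f ∧ ∫ x, f x = 0 := by
  set B : ℝ → ℝ := fun x => (Icc (-M) M).indicator w x + 2 * C * (1 + x ^ 2)⁻¹ with hB
  have hBi : MeasureTheory.Integrable B := by
    refine MeasureTheory.Integrable.add ?_ (integrable_inv_one_add_sq.const_mul _)
    exact ((MeasureTheory.locallyIntegrable_iff.1 hw) _ isCompact_Icc).integrable_indicator measurableSet_Icc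
  have hbd : ∀ ε : ℝ, 0 < ε → ε ≤ 1 → ∀ᵐ x : ℝ, ‖F (x + ε * I)‖ ≤ B x := by
    intro ε h0 h1
    filter_upwards [near] with x near
    have him : ((x : ℂ) + ε * I).im = ε := by simp
    have hre : ((x : ℂ) + ε * I).re = x := by simp
    have hp : 0 ≤ 2 * C * (1 + x ^ 2)⁻¹ := by positivity
    by_cases hx : |x| ≤ M
    · have := near (x + ε * I) hre (by rw [him]; exact h0) (by rw [him]; exact h1) (by rw [hre]; exact hx)
      rw [hre] at this
      simp only [hB]
      rw [indicator_of_mem (by exact abs_le.1 hx)]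
      linarith
    · push Not at hx
      have hn : |x| ≤ ‖(x : ℂ) + ε * I‖ := by
        have := Complex.abs_re_le_norm ((x : ℂ) + ε * I)
        rwa [hre] at this
      have := far (x + ε * I) (by rw [him]; exact h0) (hx.le.trans hn)
      have h2 : C / ‖(x : ℂ) + ε * I‖ ^ 2 ≤ C / |x| ^ 2 := by
        have : 0 < |x| := by linarith
        gcongr
      have h3 : C / |x| ^ 2 ≤ 2 * C * (1 + x ^ 2)⁻¹ := by
        rw [sq_abs]
        have hx2 : 1 ≤ x ^ 2 := by
          rw [← sq_abs]; nlinarith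
        rw [← div_eq_mul_inv, div_le_div_iff₀ (by linarith) (by linarith)]
        nlinarith
      have h4 : 0 ≤ (Icc (-M) M).indicator w x := indicator_nonneg (fun y _ => hw0 y) x
      simp only [hB]
      linarith
  have hcont : ∀ ε : ℝ, 0 < ε → Continuous (fun x : ℝ => F (x + ε * I)) := by
    intro ε h0
    rw [← continuousOn_univ]
    refine hF.continuousOn.comp (by fun_prop) ?_
    intro x _
    simpa using h0
  have hintg : ∀ ε : ℝ, 0 < ε → ε ≤ 1 → MeasureTheory.Integrable (fun x : ℝ => F (x + ε * I)) := by
    intro ε h0 h1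
    exact hBi.mono' (hcont ε h0).aestronglyMeasurable (hbd ε h0 h1)
  have hzero : ∀ ε : ℝ, 0 < ε → ε ≤ 1 → ∫ x : ℝ, F (x + ε * I) = 0 := by
    intro ε h0 h1
    have t1 := MeasureTheory.intervalIntegral_tendsto_integral (hintg ε h0 h1)
      (tendsto_neg_atTop_atBot (G := ℝ)) tendsto_id
    have t2 : Tendsto (fun T : ℝ => ∫ x : ℝ in (-T)..T, F (x + ε * I)) atTop (nhds 0) := by
      refine squeeze_zero_norm' (a := fun T : ℝ => 4 * C * T⁻¹) ?_ ?_
      · filter_upwards [eventually_ge_atTop M] with T hT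
        have hT1 : 1 ≤ T := hM.trans hT
        have hrect := Complex.integral_boundary_rect_eq_zero_of_differentiableOn F
          (⟨-T, ε⟩ : ℂ) (⟨T, T⟩ : ℂ) (hF.mono ?_)
        · simp only [smul_eq_mul] at hrect
          have eb : ∫ x : ℝ in (-T)..T, F (x + ε * I) = (∫ x : ℝ in (-T)..T, F (x + T * I))
              - I * (∫ y : ℝ in ε..T, F ((T : ℂ) + y * I)) + I * (∫ y : ℝ in ε..T, F (((-T : ℝ) : ℂ) + y * I)) := by
            linear_combination hrect
          have fb : ∀ z : ℂ, 0 < z.im → T ≤ ‖z‖ → ‖F z‖ ≤ C / T ^ 2 := by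
            intro z hz hz'
            refine (far z hz (hT.trans hz')).trans ?_
            gcongr
          have b1 : ‖∫ x : ℝ in (-T)..T, F (x + T * I)‖ ≤ C / T ^ 2 * |T - (-T)| := by
            apply intervalIntegral.norm_integral_le_of_norm_le_const
            intro x _
            apply fb
            · simp; linarith
            · have := Complex.abs_im_le_norm ((x : ℂ) + T * I)
              simp only [add_im, ofReal_im, mul_im, ofReal_re, I_im, mul_one, I_re, mul_zero, add_zero, zero_add] at this
              exact (le_abs_self T).trans this
          have b2 : ∀ S : ℝ, |S| = T → ‖∫ y : ℝ in ε..T, F ((S : ℂ) + y * I)‖ ≤ C / T ^ 2 * |T - ε| := by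
            intro S hS
            apply intervalIntegral.norm_integral_le_of_norm_le_const
            intro y hy
            rw [uIoc_of_le (by linarith)] at hy
            apply fb
            · simp; linarith [hy.1]
            · have := Complex.abs_re_le_norm ((S : ℂ) + y * I)
              simp only [add_re, ofReal_re, mul_re, ofReal_im, I_re, mul_zero, zero_mul, sub_zero, add_zero] at this
              rwa [hS] at this
          have b3 := b2 T (abs_of_pos (by linarith))
          have b4 := b2 (-T) (by rw [abs_neg]; exact abs_of_pos (by linarith))
          have h5 : |T - (-T)| = 2 * T := by rw [abs_of_pos] <;> linarith
          have h6 : |T - ε| ≤ T := by rw [abs_of_nonneg] <;> linarith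
          have h7 : C / T ^ 2 * |T - ε| ≤ C / T ^ 2 * T := by gcongr
          rw [h5] at b1
          rw [eb]
          refine (norm_add_le _ _).trans ?_
          refine (add_le_add_left (norm_sub_le _ _) _).trans ?_
          rw [norm_mul, norm_mul, norm_I, one_mul, one_mul]
          have h8 : C / T ^ 2 * T = C * T⁻¹ := by field_simp
          nlinarith
        · intro z hz
          rw [mem_reProdIm] at hz
          have := hz.2
          simp only [uIcc_of_le (show ε ≤ T by linarith)] at this
          exact h0.trans_le this.1
      · simpa using (tendsto_inv_atTop_zero (𝕜 := ℝ)).const_mul (4 * C)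
    exact tendsto_nhds_unique t1 t2
  set e : ℕ → ℝ := fun n => 1 / ((n : ℝ) + 1) with he
  have e0 : ∀ n, 0 < e n := fun n => Nat.one_div_pos_of_nat
  have e1 : ∀ n, e n ≤ 1 := by
    intro n
    rw [he]; simp only
    rw [div_le_one (by positivity)]
    have : (0:ℝ) ≤ n := n.cast_nonneg
    linarith
  have hl : ∀ᵐ x : ℝ, Tendsto (fun n => F (x + e n * I)) atTop (nhds (f x)) := by
    filter_upwards [hlim] with x hx
    refine hx.comp ?_
    rw [tendsto_nhdsWithin_iff]
    constructor
    · have h1 : Tendsto e atTop (nhds 0) := tendsto_one_div_add_atTop_nhds_zero_nat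
      have h2 : Tendsto (fun n => (x : ℂ) + e n * I) atTop (nhds ((x : ℂ) + ((0:ℝ) : ℂ) * I)) := by
        refine Tendsto.const_add _ (Tendsto.mul_const _ ?_)
        exact (Complex.continuous_ofReal.tendsto 0).comp h1
      simpa using h2
    · refine Eventually.of_forall fun n => ?_
      simpa using e0 n
  have hmeas : MeasureTheory.AEStronglyMeasurable f :=
    aestronglyMeasurable_of_tendsto_ae atTop (fun n => (hcont (e n) (e0 n)).aestronglyMeasurable) hl
  refine ⟨hBi.mono' hmeas ?_, ?_⟩
  · filter_upwards [hl, MeasureTheory.ae_all_iff.2 (fun n => hbd _ (e0 n) (e1 n))] with x hx hx2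
    exact le_of_tendsto hx.norm (Eventually.of_forall hx2)
  · have := MeasureTheory.tendsto_integral_of_dominated_convergence B
      (fun n => (hcont (e n) (e0 n)).aestronglyMeasurable) hBi
      (fun n => hbd _ (e0 n) (e1 n)) hl
    simp only [hzero _ (e0 _) (e1 _)] at this
    exact (tendsto_nhds_unique this tendsto_const_nhds)
theorem aux_reim (P : Polynomial ℂ) : ∃ U V : Polynomial ℝ,
    U.natDegree ≤ P.natDegree ∧ V.natDegree ≤ P.natDegree ∧
    P = U.map Complex.ofRealHom + Polynomial.C I * V.map Complex.ofRealHom ∧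
    (∀ m, V.coeff m = (P.coeff m).im) ∧
    (∀ x : ℝ, Polynomial.eval (x : ℂ) P
      = (Polynomial.eval x U : ℝ) + (Polynomial.eval x V : ℝ) * I) := by
  have ex : ∀ φ : ℂ → ℝ, φ 0 = 0 → ∃ U : Polynomial ℝ, ∀ m, U.coeff m = φ (P.coeff m) := by
    intro φ h0
    refine ⟨∑ i ∈ Finset.range (P.natDegree + 1), Polynomial.monomial i (φ (P.coeff i)), ?_⟩
    intro m
    simp only [Polynomial.finsetSum_coeff, Polynomial.coeff_monomial, Finset.sum_ite_eq',
      Finset.mem_range]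
    split_ifs with h
    · rfl
    · rw [Polynomial.coeff_eq_zero_of_natDegree_lt (by omega), h0]
  obtain ⟨U, hU⟩ := ex Complex.re rfl
  obtain ⟨V, hV⟩ := ex Complex.im rfl
  have e : P = U.map Complex.ofRealHom + Polynomial.C I * V.map Complex.ofRealHom := by
    ext m
    simp only [Polynomial.coeff_add, Polynomial.coeff_map, Polynomial.coeff_C_mul, hU, hV,
      Complex.ofRealHom_eq_coe]
    rw [mul_comm, Complex.re_add_im]
  refine ⟨U, V, ?_, ?_, e, hV, ?_⟩
  · rw [Polynomial.natDegree_le_iff_coeff_eq_zero]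
    intro N hN
    rw [hU, Polynomial.coeff_eq_zero_of_natDegree_lt hN]; rfl
  · rw [Polynomial.natDegree_le_iff_coeff_eq_zero]
    intro N hN
    rw [hV, Polynomial.coeff_eq_zero_of_natDegree_lt hN]; rfl
  · intro x
    have h1 : ∀ Q : Polynomial ℝ, Polynomial.eval (x : ℂ) (Q.map Complex.ofRealHom)
        = ((Polynomial.eval x Q : ℝ) : ℂ) := by
      intro Q
      have := Polynomial.eval_map_apply (f := Complex.ofRealHom) (p := Q) x
      simpa using this
    conv_lhs => rw [e]
    rw [Polynomial.eval_add, Polynomial.eval_mul, Polynomial.eval_C, h1, h1, mul_comm I]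

theorem aux_simple (Q : Polynomial ℝ) (hQ : Q ≠ 0) (S : Finset ℝ)
    (hS : ∀ x ∈ S, Polynomial.eval x Q = 0) :
    S.card ≤ Q.natDegree ∧ (Q.natDegree ≤ S.card →
    ∀ x, Polynomial.eval x Q = 0 → x ∈ S ∧ Polynomial.eval x (Polynomial.derivative Q) ≠ 0) := by
  have hle : S.val ≤ Q.roots := by
    rw [Multiset.le_iff_subset S.nodup]
    intro x hx
    rw [Polynomial.mem_roots hQ]
    exact hS x hx
  refine ⟨(Multiset.card_le_card hle).trans (Polynomial.card_roots' Q), ?_⟩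
  intro hc x hx
  have heq : S.val = Q.roots :=
    Multiset.eq_of_le_of_card_le hle ((Polynomial.card_roots' Q).trans hc)
  refine ⟨?_, ?_⟩
  · rw [← Finset.mem_val, heq, Polynomial.mem_roots hQ]
    exact hx
  · intro hd
    have h1 : 1 < Q.rootMultiplicity x :=
      (Polynomial.one_lt_rootMultiplicity_iff_isRoot hQ).2 ⟨hx, hd⟩
    have h2 : Q.roots.Nodup := heq ▸ S.nodup
    have h3 := Multiset.nodup_iff_count_le_one.1 h2 x
    rw [Polynomial.count_roots] at h3
    omega

theorem aux_lead (Q : Polynomial ℝ) :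
    Tendsto (fun x : ℝ => Polynomial.eval x Q / x ^ Q.natDegree) (Bornology.cobounded ℝ)
      (nhds Q.leadingCoeff) := by
  have h1 : Tendsto (fun x : ℝ => Polynomial.eval x⁻¹ Q.reverse) (Bornology.cobounded ℝ)
      (nhds (Polynomial.eval 0 Q.reverse)) :=
    (Q.reverse.continuous.tendsto 0).comp tendsto_inv₀_cobounded
  rw [← Polynomial.coeff_zero_eq_eval_zero, Polynomial.coeff_zero_reverse] at h1
  refine h1.congr' ?_
  have : ∀ᶠ x : ℝ in Bornology.cobounded ℝ, x ≠ 0 := by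
    filter_upwards [(Bornology.isBounded_def.1 (Bornology.isBounded_singleton (x := (0:ℝ))))] with x hx
    simpa using hx
  filter_upwards [this] with x hx
  let _ := invertibleOfNonzero hx
  have := Polynomial.eval₂_reverse_mul_pow (RingHom.id ℝ) x Q
  rw [invOf_eq_inv] at this
  rw [eq_div_iff (pow_ne_zero _ hx)]
  exact this

theorem aux_ext (g : ℕ) (Q : Polynomial ℝ) (hQ : Q ≠ 0) (hd : Q.natDegree ≤ g + 1)
    (hev : Even (g + 1 - Q.natDegree)) (α β : ℝ) (r : ℝ → ℝ)
    (hr1 : ContinuousOn r (Iio α)) (hr2 : ContinuousOn r (Ioi β))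
    (hr3 : ∀ x, x < α ∨ β < x → r x ≠ 0)
    (hr4 : Tendsto (fun x : ℝ => r x / x ^ (g + 1)) (Bornology.cobounded ℝ) (nhds 1))
    (h : ℝ → ℝ) (hi : MeasureTheory.Integrable h)
    (hh : ∀ x, x < α ∨ β < x → h x = Polynomial.eval x Q / r x)
    (h0 : (∫ x in Iio α, h x) + ∫ x in Ioi β, h x = 0) :
    ∃ x, (x < α ∨ β < x) ∧ Polynomial.eval x Q = 0 := by
  by_contra hcon
  push Not at hcon
  have hne : ∀ x, x < α ∨ β < x → h x ≠ 0 := fun x hx => by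
    rw [hh x hx]; exact div_ne_zero (hcon x hx) (hr3 x hx)
  have hc1 : ContinuousOn h (Iio α) :=
    (Q.continuous.continuousOn.div hr1 (fun x hx => hr3 x (Or.inl hx))).congr
      (fun x hx => hh x (Or.inl hx))
  have hc2 : ContinuousOn h (Ioi β) :=
    (Q.continuous.continuousOn.div hr2 (fun x hx => hr3 x (Or.inr hx))).congr
      (fun x hx => hh x (Or.inr hx))
  have s1 := aux_rootfree_sign (Iio α) isOpen_Iio nonempty_Iio isPreconnected_Iio h hc1
    (fun x hx => hne x (Or.inl hx)) hi.integrableOn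
  have s2 := aux_rootfree_sign (Ioi β) isOpen_Ioi nonempty_Ioi isPreconnected_Ioi h hc2
    (fun x hx => hne x (Or.inr hx)) hi.integrableOn
  have hl := (aux_lead Q).div hr4 one_ne_zero
  rw [div_one] at hl
  have hc : Q.leadingCoeff ≠ 0 := Polynomial.leadingCoeff_ne_zero.2 hQ
  have hprod : ∀ᶠ x : ℝ in Bornology.cobounded ℝ, (x < α ∨ β < x) → 0 < Q.leadingCoeff * h x := by
    have h1 := hl.const_mul Q.leadingCoeff
    have h2 := h1.eventually (lt_mem_nhds (show 0 < Q.leadingCoeff * Q.leadingCoeff from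
      mul_self_pos.2 hc))
    have hx0 : ∀ᶠ x : ℝ in Bornology.cobounded ℝ, x ≠ 0 := by
      filter_upwards [(Bornology.isBounded_def.1 (Bornology.isBounded_singleton (x := (0:ℝ))))] with x hx
      simpa using hx
    filter_upwards [h2, hx0] with x hx hx0 hxe
    rw [hh x hxe]
    have hpw : 0 < x ^ (g + 1 - Q.natDegree) := hev.pow_pos hx0
    have e1 : x ^ (g + 1) = x ^ Q.natDegree * x ^ (g + 1 - Q.natDegree) := by
      rw [← pow_add]; congr 1; omega
    have e2 : Q.leadingCoeff * (Polynomial.eval x Q / x ^ Q.natDegree / (r x / x ^ (g + 1)))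
        = (Q.leadingCoeff * (Polynomial.eval x Q / r x)) * x ^ (g + 1 - Q.natDegree) := by
      rw [e1]
      have := hr3 x hxe
      have := pow_ne_zero Q.natDegree hx0
      field_simp
    simp only [Pi.div_apply] at hx
    rw [e2] at hx
    exact (mul_pos_iff_of_pos_right hpw).1 hx
  rw [Metric.cobounded_eq_cocompact, cocompact_eq_atBot_atTop, eventually_sup] at hprod
  obtain ⟨x, hx1, hx2⟩ := (hprod.1.and (eventually_lt_atBot α)).exists
  obtain ⟨y, hy1, hy2⟩ := (hprod.2.and (eventually_gt_atTop β)).exists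
  have p1 := hx1 (Or.inl hx2)
  have p2 := hy1 (Or.inr hy2)
  rcases s1 with ⟨s1, i1⟩ | ⟨s1, i1⟩ <;> rcases s2 with ⟨s2, i2⟩ | ⟨s2, i2⟩
  · linarith
  · have := s1 x hx2
    have := s2 y hy2
    nlinarith [(pos_iff_pos_of_mul_pos p1).2 (s1 x hx2), (pos_iff_pos_of_mul_pos p2).1 ((pos_iff_pos_of_mul_pos p1).2 (s1 x hx2))]
  · have := s1 x hx2
    have := s2 y hy2
    nlinarith [(pos_iff_pos_of_mul_pos p2).2 (s2 y hy2), (pos_iff_pos_of_mul_pos p1).1 ((pos_iff_pos_of_mul_pos p2).2 (s2 y hy2))]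
  · linarith

theorem aux_polybound (P : Polynomial ℂ) (n : ℕ) (hn : P.natDegree ≤ n) :
    ∃ K : ℝ, 0 ≤ K ∧ ∀ z : ℂ, ‖Polynomial.eval z P‖ ≤ K * (1 + ‖z‖) ^ n := by
  refine ⟨∑ i ∈ Finset.range (n + 1), ‖P.coeff i‖, by positivity, ?_⟩
  intro z
  rw [Polynomial.eval_eq_sum_range' (Nat.lt_succ_of_le hn), Finset.sum_mul]
  refine (norm_sum_le _ _).trans (Finset.sum_le_sum ?_)
  intro i hi
  rw [norm_mul, norm_pow]
  have h1 : ‖z‖ ^ i ≤ (1 + ‖z‖) ^ i := by gcongr; linarith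
  have h2 : (1 + ‖z‖) ^ i ≤ (1 + ‖z‖) ^ n :=
    pow_le_pow_right₀ (by linarith [norm_nonneg z]) (by rw [Finset.mem_range] at hi; omega)
  gcongr
  exact h1.trans h2

theorem aux_prodpair (f : ℕ → ℝ) (n : ℕ) :
    ∏ i ∈ Finset.range (2 * n), f i = ∏ t ∈ Finset.range n, (f (2 * t) * f (2 * t + 1)) := by
  induction n with
  | zero => simp
  | succ n ih =>
    rw [show 2 * (n + 1) = 2 * n + 1 + 1 by ring, Finset.prod_range_succ, Finset.prod_range_succ,
      Finset.prod_range_succ, ih, mul_assoc]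

/-- the main analytic facts for one differential -/
theorem aux_analytic
    (g : ℕ) (hg : 2 ≤ g)
    (a : ℕ → ℝ) (ha : ∀ i j, i < j → j ≤ 2 * g + 1 → a i < a j)
    (arcs : Set ℂ)
    (harcs : arcs = ⋃ t ∈ Finset.range (g + 1),
      Complex.ofReal '' Icc (a (2 * t)) (a (2 * t + 1)))
    (R : ℂ → ℂ)
    (hRan : DifferentiableOn ℂ R arcsᶜ)
    (hRsq : ∀ z ∉ arcs, R z ^ 2 = ∏ j ∈ Finset.range (2 * g + 2), (z - (a j : ℂ)))
    (hRinf : Tendsto (fun z : ℂ => R z / z ^ (g + 1)) (cocompact ℂ) (nhds 1)) :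
    (∀ x : ℝ, (x : ℂ) ∉ arcs → (R x).im = 0 ∧ (R x).re ≠ 0) ∧
    (ContinuousOn (fun x : ℝ => (R x).re) {x : ℝ | (x : ℂ) ∉ arcs}) ∧
    (Tendsto (fun x : ℝ => (R x).re / x ^ (g + 1)) (Bornology.cobounded ℝ) (nhds 1)) ∧
    (∀ k < g, ∀ x ∈ Ioo (a (2 * k + 1)) (a (2 * k + 2)), (x : ℂ) ∉ arcs) ∧
    (∀ x : ℝ, (x < a 0 ∨ a (2 * g + 1) < x) → (x : ℂ) ∉ arcs) ∧
    (∀ (P : Polynomial ℂ), P.natDegree ≤ g - 1 → ∀ (ω : ℂ → ℂ),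
      (∀ z ∉ arcs, ω z = Polynomial.eval z P / R z) → ∀ (f : ℝ → ℂ),
      (∀ x : ℝ, (∀ i ≤ 2 * g + 1, x ≠ a i) →
        Tendsto ω (nhdsWithin (x : ℂ) {z : ℂ | 0 < z.im}) (nhds (f x))) →
      (∀ x : ℝ, (x : ℂ) ∉ arcs → f x = Polynomial.eval (x : ℂ) P / R x) ∧
      MeasureTheory.Integrable f ∧ ∫ x, f x = 0) := by
  have ha' : ∀ i j, i ≤ j → j ≤ 2 * g + 1 → a i ≤ a j := by
    intro i j h h'
    rcases h.eq_or_lt with rfl | h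
    · exact le_rfl
    · exact (ha i j h h').le
  have hmem : ∀ x : ℝ, (x : ℂ) ∈ arcs ↔ ∃ t, t < g + 1 ∧ a (2 * t) ≤ x ∧ x ≤ a (2 * t + 1) := by
    intro x
    rw [harcs]
    simp only [mem_iUnion, Finset.mem_range, mem_image, mem_Icc, Complex.ofReal_inj,
      exists_eq_right, exists_prop]
  have him : ∀ z : ℂ, 0 < z.im → z ∉ arcs := by
    intro z hz hz'
    rw [harcs] at hz'
    simp only [mem_iUnion, mem_image] at hz'
    obtain ⟨t, _, y, _, rfl⟩ := hz'
    simp at hz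
  have hclosed : IsClosed arcs := by
    rw [harcs]
    refine isClosed_biUnion_finset fun t _ => ?_
    exact (isCompact_Icc.image Complex.continuous_ofReal).isClosed
  have hopen : IsOpen arcsᶜ := hclosed.isOpen_compl
  have haarc : ∀ i ≤ 2 * g + 1, (a i : ℂ) ∈ arcs := by
    intro i hi
    rw [hmem]
    refine ⟨i / 2, by omega, ha' _ _ (by omega) (by omega), ha' _ _ (by omega) (by omega)⟩
  have hDne : ∀ z ∉ arcs, ∏ j ∈ Finset.range (2 * g + 2), (z - (a j : ℂ)) ≠ 0 := by
    intro z hz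
    rw [Finset.prod_ne_zero_iff]
    intro j hj
    rw [Finset.mem_range] at hj
    intro h
    rw [sub_eq_zero] at h
    exact hz (h ▸ haarc j (by omega))
  have hRne : ∀ z ∉ arcs, R z ≠ 0 := by
    intro z hz h
    apply hDne z hz
    rw [← hRsq z hz, h]; simp
  have hRnorm : ∀ z ∉ arcs, ‖R z‖ = Real.sqrt (∏ j ∈ Finset.range (2 * g + 2), ‖z - (a j : ℂ)‖) := by
    intro z hz
    rw [← norm_prod, ← hRsq z hz, norm_pow, Real.sqrt_sq (norm_nonneg _)]
  have hreal : ∀ x : ℝ, (x : ℂ) ∉ arcs → (R x).im = 0 ∧ (R x).re ≠ 0 := by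
    intro x hx
    have hpos : 0 < ∏ j ∈ Finset.range (2 * g + 2), (x - a j) := by
      rw [show 2 * g + 2 = 2 * (g + 1) by ring, aux_prodpair]
      apply Finset.prod_pos
      intro t ht
      rw [Finset.mem_range] at ht
      rw [hmem] at hx
      push Not at hx
      have h1 := hx t ht
      have h2 := ha (2 * t) (2 * t + 1) (by omega) (by omega)
      rcases lt_or_ge x (a (2 * t)) with h | h
      · nlinarith
      · have := h1 h
        apply mul_pos <;> linarith
    have hsq := hRsq x hx
    have e : ∏ j ∈ Finset.range (2 * g + 2), ((x : ℂ) - (a j : ℂ)) =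
        ((∏ j ∈ Finset.range (2 * g + 2), (x - a j) : ℝ) : ℂ) := by push_cast; rfl
    rw [e] at hsq
    have h1 := congrArg Complex.re hsq
    have h2 := congrArg Complex.im hsq
    simp only [pow_two, mul_re, mul_im, ofReal_re, ofReal_im] at h1 h2
    have h3 : (R x).re * (R x).im = 0 := by linarith
    rcases mul_eq_zero.1 h3 with h | h
    · rw [h] at h1; nlinarith [mul_self_nonneg (R x).im]
    · refine ⟨h, ?_⟩
      intro h'
      rw [h, h'] at h1
      linarith
  refine ⟨hreal, ?_, ?_, ?_, ?_, ?_⟩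
  · refine Complex.continuous_re.comp_continuousOn ?_
    exact hRan.continuousOn.comp Complex.continuous_ofReal.continuousOn (fun x hx => hx)
  · have h1 : Tendsto (fun x : ℝ => (x : ℂ)) (Bornology.cobounded ℝ) (cocompact ℂ) := by
      rw [← Metric.cobounded_eq_cocompact, ← tendsto_norm_atTop_iff_cobounded]
      simp only [Complex.norm_real]
      exact tendsto_norm_cobounded_atTop
    have h2 := (Complex.continuous_re.tendsto 1).comp (hRinf.comp h1)
    simp only [one_re] at h2
    refine h2.congr ?_
    intro x
    simp only [Function.comp]
    rw [← Complex.ofReal_pow, Complex.div_ofReal_re]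
  · intro k hk x hx
    rw [hmem]
    rintro ⟨t, ht, h1, h2⟩
    rcases le_or_gt t k with h | h
    · have := ha' (2 * t + 1) (2 * k + 1) (by omega) (by omega)
      linarith [hx.1]
    · have := ha' (2 * k + 2) (2 * t) (by omega) (by omega)
      linarith [hx.2]
  · intro x hx
    rw [hmem]
    rintro ⟨t, ht, h1, h2⟩
    have h3 := ha' 0 (2 * t) (by omega) (by omega)
    have h4 := ha' (2 * t + 1) (2 * g + 1) (by omega) (by omega)
    rcases hx with h | h <;> linarith
  · intro P hP ω hω f hf
    refine ⟨?_, ?_⟩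
    · intro x hx
      have h1 := hf x (fun i hi h => hx (h ▸ haarc i hi))
      have hcR : ContinuousAt R x := (hRan.differentiableAt (hopen.mem_nhds hx)).continuousAt
      have h2 : Tendsto (fun z => Polynomial.eval z P / R z) (nhds (x : ℂ))
          (nhds (Polynomial.eval (x : ℂ) P / R x)) :=
        (P.continuous.continuousAt.div hcR (hRne x hx))
      have h3 := (h2.mono_left (nhdsWithin_le_nhds (s := {z : ℂ | 0 < z.im}))).congr' (f₂ := ω) (by
        filter_upwards [self_mem_nhdsWithin] with z hz
        exact (hω z (him z hz)).symm)
      have hnb : (nhdsWithin (x : ℂ) {z : ℂ | 0 < z.im}).NeBot := by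
        rw [← mem_closure_iff_nhdsWithin_neBot]
        rw [Complex.closure_setOfPred_lt_im]
        simp
      exact tendsto_nhds_unique h1 h3
    · obtain ⟨K, hK, hKb⟩ := aux_polybound P (g - 1) hP
      have hev : ∀ᶠ z : ℂ in cocompact ℂ, 1 / 2 < ‖R z / z ^ (g + 1)‖ := by
        have := hRinf.norm
        rw [norm_one] at this
        exact this.eventually (lt_mem_nhds (by norm_num))
      rw [← Metric.cobounded_eq_cocompact, ← comap_norm_atTop, eventually_comap] at hev
      obtain ⟨M0, hM0⟩ := eventually_atTop.1 hev
      set M := max M0 1 with hMdef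
      have hM1 : 1 ≤ M := le_max_right _ _
      have hae : ∀ᵐ x : ℝ, ∀ i ≤ 2 * g + 1, x ≠ a i := by
        rw [MeasureTheory.ae_all_iff]
        intro i
        filter_upwards [MeasureTheory.Measure.ae_ne MeasureTheory.volume (a i)] with x hx _
        exact hx
      refine aux_key ω ?_ M (2 * (K * 2 ^ (g - 1))) hM1 (by positivity) ?_
        (fun x => K * (M + 2) ^ (g - 1) * (Real.sqrt (∏ j ∈ Finset.range (2 * g + 2), |x - a j|))⁻¹)
        ?_ ?_ ?_ f ?_
      · have : DifferentiableOn ℂ (fun z => Polynomial.eval z P / R z) {z : ℂ | 0 < z.im} :=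
          P.differentiable.differentiableOn.div (hRan.mono (fun z hz => him z hz))
            (fun z hz => hRne z (him z hz))
        exact this.congr (fun z hz => hω z (him z hz))
      · intro z hz hzM
        have hz1 : 1 ≤ ‖z‖ := hM1.trans hzM
        have hzp : 0 < ‖z‖ := by linarith
        have h1 := hM0 ‖z‖ ((le_max_left _ _).trans hzM) z rfl
        rw [norm_div, norm_pow, lt_div_iff₀ (by positivity)] at h1
        rw [hω z (him z hz), norm_div]
        have h2 : ‖Polynomial.eval z P‖ ≤ K * (2 ^ (g - 1) * ‖z‖ ^ (g - 1)) := by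
          refine (hKb z).trans ?_
          rw [← mul_pow]
          gcongr
          linarith
        have h3 : ‖z‖ ^ (g + 1) = ‖z‖ ^ (g - 1) * ‖z‖ ^ 2 := by
          rw [← pow_add]; congr 1; omega
        have hRp : 0 < ‖R z‖ := norm_pos_iff.2 (hRne z (him z hz))
        rw [div_le_div_iff₀ hRp (by positivity)]
        calc ‖Polynomial.eval z P‖ * ‖z‖ ^ 2 ≤ K * (2 ^ (g - 1) * ‖z‖ ^ (g - 1)) * ‖z‖ ^ 2 := by
              gcongr
          _ = 2 * (K * 2 ^ (g - 1)) * (1 / 2 * ‖z‖ ^ (g + 1)) := by rw [h3]; ring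
          _ ≤ 2 * (K * 2 ^ (g - 1)) * ‖R z‖ := by gcongr
      · refine MeasureTheory.LocallyIntegrable.smul (aux_w (2 * g + 2) a ?_)
          (K * (M + 2) ^ (g - 1))
        intro i hi j hj hij
        rcases lt_or_gt_of_ne hij with h | h
        · exact (ha i j h (by omega)).ne
        · exact (ha j i h (by omega)).ne'
      · intro x
        positivity
      · filter_upwards [hae] with x hx z hzx hz hz1 hzM
        subst hzx
        rw [hω z (him z hz), norm_div, div_eq_mul_inv]
        have hpos : 0 < ∏ j ∈ Finset.range (2 * g + 2), |z.re - a j| := by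
          apply Finset.prod_pos
          intro j hj
          rw [Finset.mem_range] at hj
          exact abs_pos.2 (sub_ne_zero.2 (hx j (by omega)))
        have h1 : Real.sqrt (∏ j ∈ Finset.range (2 * g + 2), |z.re - a j|) ≤ ‖R z‖ := by
          rw [hRnorm z (him z hz)]
          apply Real.sqrt_le_sqrt
          apply Finset.prod_le_prod
          · intro j _; positivity
          · intro j _
            have := Complex.abs_re_le_norm (z - (a j : ℂ))
            simpa using this
        have h2 : ‖Polynomial.eval z P‖ ≤ K * (M + 2) ^ (g - 1) := by
          refine (hKb z).trans ?_
          have := Complex.norm_le_abs_re_add_abs_im z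
          rw [abs_of_pos hz] at this
          have h : 1 + ‖z‖ ≤ M + 2 := by linarith
          exact mul_le_mul_of_nonneg_left (pow_le_pow_left₀ (by positivity) h _) hK
        have h3 : 0 < Real.sqrt (∏ j ∈ Finset.range (2 * g + 2), |z.re - a j|) := Real.sqrt_pos.2 hpos
        gcongr
      · filter_upwards [hae] with x hx
        exact hf x hx

/-- A full version of the counting argument for real polynomials. -/
theorem aux_count (g : ℕ) (hg : 2 ≤ g) (a : ℕ → ℝ)
    (ha : ∀ i j, i < j → j ≤ 2 * g + 1 → a i < a j) (r : ℝ → ℝ) (s : Set ℝ)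
    (hr0 : ∀ x ∈ s, r x ≠ 0) (hrc : ContinuousOn r s)
    (hrinf : Tendsto (fun x : ℝ => r x / x ^ (g + 1)) (Bornology.cobounded ℝ) (nhds 1))
    (hfin : ∀ k < g, ∀ x ∈ Ioo (a (2 * k + 1)) (a (2 * k + 2)), x ∈ s)
    (hext : ∀ x : ℝ, (x < a 0 ∨ a (2 * g + 1) < x) → x ∈ s)
    (Q : Polynomial ℝ)
    (h : ℝ → ℝ) (hi : MeasureTheory.Integrable h)
    (hh : ∀ x ∈ s, h x = Polynomial.eval x Q / r x) :
    (∀ k < g, ∫ x in Ioo (a (2 * k + 1)) (a (2 * k + 2)), h x = 0 →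
      ∃ x ∈ Ioo (a (2 * k + 1)) (a (2 * k + 2)), Polynomial.eval x Q = 0) ∧
    ((∫ x in Iio (a 0), h x) + ∫ x in Ioi (a (2 * g + 1)), h x = 0 → Q ≠ 0 →
      Q.natDegree = g - 1 → ∃ x, (x < a 0 ∨ a (2 * g + 1) < x) ∧ Polynomial.eval x Q = 0) := by
  constructor
  · intro k hk h0
    by_contra hcon
    push Not at hcon
    have hlt := ha (2 * k + 1) (2 * k + 2) (by omega) (by omega)
    have hc : ContinuousOn h (Ioo (a (2 * k + 1)) (a (2 * k + 2))) :=
      (Q.continuous.continuousOn.div (hrc.mono (hfin k hk))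
        (fun x hx => hr0 x (hfin k hk x hx))).congr (fun x hx => hh x (hfin k hk x hx))
    rcases aux_rootfree_sign _ isOpen_Ioo (nonempty_Ioo.2 hlt) isPreconnected_Ioo h hc
      (fun x hx => by
        rw [hh x (hfin k hk x hx)]
        exact div_ne_zero (hcon x hx) (hr0 x (hfin k hk x hx))) hi.integrableOn with ⟨_, h1⟩ | ⟨_, h1⟩
    · linarith
    · linarith
  · intro h0 hQ hd
    refine aux_ext g Q hQ (by omega) ?_ (a 0) (a (2 * g + 1)) r
      (hrc.mono fun x hx => hext x (Or.inl hx)) (hrc.mono fun x hx => hext x (Or.inr hx))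
      (fun x hx => hr0 x (hext x hx)) hrinf h hi (fun x hx => hh x (hext x hx)) h0
    rw [hd, show g + 1 - (g - 1) = 2 by omega]
    exact even_two

/-- Each polynomial `P_j` in the normalized first-kind differential `ω_j = P_j/R` is
real, of degree at most `g-1`, has exactly one simple zero in the interior of each
gap `c_k` with `k ≠ j` (for the exterior gap `c_g`, through infinity, the zero may be
at infinity, in which case `deg P_j = g - 2`), and no zeros in the gap `c_j`. -/
theorem zeros_of_normalized_differentials
    (g : ℕ) (hg : 2 ≤ g)
    (a : ℕ → ℝ) (ha : ∀ i, i < 2 * g + 1 → a i < a (i + 1))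
    (arcs : Set ℂ)
    (harcs : arcs = ⋃ t ∈ Finset.range (g + 1),
      Complex.ofReal '' Icc (a (2 * t)) (a (2 * t + 1)))
    (R : ℂ → ℂ)
    (hRan : DifferentiableOn ℂ R arcsᶜ)
    (hRsq : ∀ z ∉ arcs, R z ^ 2 = ∏ j ∈ Finset.range (2 * g + 2), (z - (a j : ℂ)))
    (hRinf : Tendsto (fun z : ℂ => R z / z ^ (g + 1)) (cocompact ℂ) (nhds 1))
    (P : Fin g → Polynomial ℂ)
    (hPdeg : ∀ j, (P j).natDegree ≤ g - 1)
    (ω : Fin g → ℂ → ℂ)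
    (hω : ∀ j, ∀ z ∉ arcs, ω j z = Polynomial.eval z (P j) / R z)
    (ωp : Fin g → ℝ → ℂ)
    (hωp : ∀ j, ∀ x : ℝ, (∀ i ≤ 2 * g + 1, x ≠ a i) →
        Tendsto (ω j) (nhdsWithin (x : ℂ) {z : ℂ | 0 < z.im}) (nhds (ωp j x)))
    (hnorm : ∀ j k : Fin g,
        (if (k : ℕ) + 1 ≤ g - 1 then
            2 * ∫ x in (a (2 * (k : ℕ) + 1))..(a (2 * (k : ℕ) + 2)), ωp j x
          else
            2 * ∫ x in (a 0)..(a (2 * g + 1)), ωp j x)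
          = if j = k then 1 else 0) :
    ∀ j : Fin g,
      -- `P_j` is real
      (∀ m : ℕ, ((P j).coeff m).im = 0) ∧
      -- degree at most `g - 1`
      (P j).natDegree ≤ g - 1 ∧
      -- exactly one simple zero in the interior of each finite gap `c_k`, `k ≠ j`
      (∀ k : Fin g, k ≠ j → (k : ℕ) + 1 ≤ g - 1 →
        (∃! x : ℝ, x ∈ Ioo (a (2 * (k : ℕ) + 1)) (a (2 * (k : ℕ) + 2)) ∧
          Polynomial.eval (x : ℂ) (P j) = 0) ∧
        (∀ x : ℝ, x ∈ Ioo (a (2 * (k : ℕ) + 1)) (a (2 * (k : ℕ) + 2)) →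
          Polynomial.eval (x : ℂ) (P j) = 0 →
          Polynomial.eval (x : ℂ) (Polynomial.derivative (P j)) ≠ 0)) ∧
      -- no zeros in the interior of the finite gap `c_j` itself
      ((j : ℕ) + 1 ≤ g - 1 →
        ∀ x : ℝ, x ∈ Ioo (a (2 * (j : ℕ) + 1)) (a (2 * (j : ℕ) + 2)) →
          Polynomial.eval (x : ℂ) (P j) ≠ 0) ∧
      -- exterior gap `c_g` (through infinity), when `j ≠ g`:
      ((j : ℕ) + 1 ≤ g - 1 →
        ((∃! x : ℝ, (x < a 0 ∨ a (2 * g + 1) < x) ∧ Polynomial.eval (x : ℂ) (P j) = 0) ∧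
          (∀ x : ℝ, (x < a 0 ∨ a (2 * g + 1) < x) → Polynomial.eval (x : ℂ) (P j) = 0 →
            Polynomial.eval (x : ℂ) (Polynomial.derivative (P j)) ≠ 0)) ∨
        ((P j).natDegree = g - 2 ∧
          ∀ x : ℝ, (x < a 0 ∨ a (2 * g + 1) < x) → Polynomial.eval (x : ℂ) (P j) ≠ 0)) ∧
      -- no zeros in the exterior gap `c_g` when `j = g` (and then `deg P_g = g - 1`)
      ((j : ℕ) = g - 1 →
        ∀ x : ℝ, (x < a 0 ∨ a (2 * g + 1) < x) → Polynomial.eval (x : ℂ) (P j) ≠ 0) := by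
  have ham : ∀ i j, i < j → j ≤ 2 * g + 1 → a i < a j := by
    intro i j hij
    induction j, hij using Nat.le_induction with
    | base => intro h; exact ha i (by omega)
    | succ n hn ih => intro h; exact (ih (by omega)).trans (ha n (by omega))
  have ham' : ∀ i j, i ≤ j → j ≤ 2 * g + 1 → a i ≤ a j := by
    intro i j h h'
    rcases h.eq_or_lt with rfl | h
    · exact le_rfl
    · exact (ham i j h h').le
  obtain ⟨hreal, hrc, hrinf, hfin, hext, hP⟩ :=
    aux_analytic g hg a ham arcs harcs R hRan hRsq hRinf
  have hdisj : ∀ k k', k < g → k' < g → ∀ x : ℝ, x ∈ Ioo (a (2 * k + 1)) (a (2 * k + 2)) →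
      x ∈ Ioo (a (2 * k' + 1)) (a (2 * k' + 2)) → k = k' := by
    intro k k' hk hk' x hx hx'
    rcases lt_trichotomy k k' with h | h | h
    · have := ham' (2 * k + 2) (2 * k' + 1) (by omega) (by omega)
      linarith [hx.2, hx'.1]
    · exact h
    · have := ham' (2 * k' + 2) (2 * k + 1) (by omega) (by omega)
      linarith [hx.1, hx'.2]
  have hdisje : ∀ k < g, ∀ x : ℝ, x ∈ Ioo (a (2 * k + 1)) (a (2 * k + 2)) →
      ¬ (x < a 0 ∨ a (2 * g + 1) < x) := by
    intro k hk x hx hx'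
    have h1 := ham' 0 (2 * k + 1) (by omega) (by omega)
    have h2 := ham' (2 * k + 2) (2 * g + 1) (by omega) (by omega)
    rcases hx' with h | h <;> linarith [hx.1, hx.2]
  intro j
  obtain ⟨hfx, hfi, hf0⟩ := hP (P j) (hPdeg j) (ω j) (hω j) (ωp j) (hωp j)
  set f := ωp j with hfdef
  obtain ⟨U, V, hUd, hVd, hPe, hVc, hev⟩ := aux_reim (P j)
  -- real and imaginary part functions
  have hre : ∀ x ∈ {x : ℝ | (x : ℂ) ∉ arcs}, (f x).re = Polynomial.eval x U / (R x).re := by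
    intro x hx
    have hRx : R x = ((R x).re : ℂ) := by
      apply Complex.ext <;> simp [(hreal x hx).1]
    rw [hfx x hx, hev, hRx, Complex.div_ofReal_re]
    simp
  have hrim : ∀ x ∈ {x : ℝ | (x : ℂ) ∉ arcs}, (f x).im = Polynomial.eval x V / (R x).re := by
    intro x hx
    have hRx : R x = ((R x).re : ℂ) := by
      apply Complex.ext <;> simp [(hreal x hx).1]
    rw [hfx x hx, hev, hRx, Complex.div_ofReal_im]
    simp
  have hire : MeasureTheory.Integrable (fun x => (f x).re) := hfi.re
  have hiim : MeasureTheory.Integrable (fun x => (f x).im) := hfi.im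
  have hsre : ∀ s : Set ℝ, ∫ x in s, (f x).re = (∫ x in s, f x).re := fun s =>
    Complex.reCLM.integral_comp_comm hfi.integrableOn
  have hsim : ∀ s : Set ℝ, ∫ x in s, (f x).im = (∫ x in s, f x).im := fun s =>
    Complex.imCLM.integral_comp_comm hfi.integrableOn
  -- periods
  have hperf : ∀ k : Fin g, (k : ℕ) + 1 ≤ g - 1 →
      ∫ x in Ioo (a (2 * (k : ℕ) + 1)) (a (2 * (k : ℕ) + 2)), f x
        = if j = k then ((1 / 2 : ℝ) : ℂ) else 0 := by
    intro k hk
    have h1 := hnorm j k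
    rw [if_pos hk, intervalIntegral.integral_of_le (ham' _ _ (by omega) (by omega)),
      MeasureTheory.integral_Ioc_eq_integral_Ioo] at h1
    split_ifs at h1 ⊢ with h
    · push_cast; linear_combination h1 / 2
    · linear_combination h1 / 2
  have hpere : (∫ x in Iio (a 0), f x) + ∫ x in Ioi (a (2 * g + 1)), f x
        = if (j : ℕ) = g - 1 then ((-1 / 2 : ℝ) : ℂ) else 0 := by
    have h1 := hnorm j ⟨g - 1, by omega⟩
    rw [if_neg (by simp)] at h1
    have h2 := intervalIntegral.integral_Iic_add_Ioi (b := a 0) hfi.integrableOn hfi.integrableOn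
    have h3 := intervalIntegral.integral_interval_add_Ioi (a := a 0) (b := a (2 * g + 1))
      hfi.integrableOn hfi.integrableOn
    rw [hf0, MeasureTheory.integral_Iic_eq_integral_Iio] at h2
    have hjj : j = (⟨g - 1, by omega⟩ : Fin g) ↔ (j : ℕ) = g - 1 := Fin.ext_iff
    simp only [hjj] at h1
    split_ifs at h1 ⊢ with h
    · push_cast; linear_combination h2 + h3 - h1 / 2
    · linear_combination h2 + h3 - h1 / 2
  obtain ⟨cV1, cV2⟩ := aux_count g hg a ham (fun x => (R x).re) {x : ℝ | (x : ℂ) ∉ arcs}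
    (fun x hx => (hreal x hx).2) hrc hrinf hfin hext V _ hiim hrim
  obtain ⟨cU1, cU2⟩ := aux_count g hg a ham (fun x => (R x).re) {x : ℝ | (x : ℂ) ∉ arcs}
    (fun x hx => (hreal x hx).2) hrc hrinf hfin hext U _ hire hre
  -- the imaginary part vanishes
  have hcardimg : ∀ (K : Finset ℕ) (y : ℕ → ℝ), (∀ k ∈ K, k < g ∧
      y k ∈ Ioo (a (2 * k + 1)) (a (2 * k + 2))) → (K.image y).card = K.card := by
    intro K y hy
    apply Finset.card_image_of_injOn
    intro k hk k' hk' hkk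
    exact hdisj k k' (hy k hk).1 (hy k' hk').1 (y k) (hy k hk).2
      (by rw [hkk]; exact (hy k' hk').2)
  have hV0 : V = 0 := by
    by_contra hV
    have hz : ∀ k, k < g - 1 → ∃ x ∈ Ioo (a (2 * k + 1)) (a (2 * k + 2)),
        Polynomial.eval x V = 0 := by
      intro k hk
      apply cV1 k (by omega)
      rw [hsim, hperf ⟨k, by omega⟩ (by simp only; omega)]
      split_ifs
      · exact Complex.ofReal_im _
      · rfl
    choose! y hy1 hy2 using hz
    have hcard := hcardimg (Finset.range (g - 1)) y (fun k hk => by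
      rw [Finset.mem_range] at hk
      exact ⟨by omega, hy1 k hk⟩)
    rw [Finset.card_range] at hcard
    have hroot : ∀ x ∈ (Finset.range (g - 1)).image y, Polynomial.eval x V = 0 := by
      intro x hx
      simp only [Finset.mem_image, Finset.mem_range] at hx
      obtain ⟨k, hk, rfl⟩ := hx
      exact hy2 k hk
    obtain ⟨s1, s2⟩ := aux_simple V hV _ hroot
    have hVd' := hVd.trans (hPdeg j)
    obtain ⟨x, hx, hx0⟩ := cV2 (by
      rw [hsim, hsim, ← Complex.add_im, hpere]
      split_ifs
      · exact Complex.ofReal_im _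
      · rfl) hV (by omega)
    obtain ⟨hmem, _⟩ := s2 (by omega) x hx0
    simp only [Finset.mem_image, Finset.mem_range] at hmem
    obtain ⟨k, hk, rfl⟩ := hmem
    exact hdisje k (by omega) _ (hy1 k hk) hx
  have hPU : P j = U.map Complex.ofRealHom := by
    rw [hPe, hV0]; simp
  have hevU : ∀ x : ℝ, Polynomial.eval (x : ℂ) (P j) = 0 ↔ Polynomial.eval x U = 0 := by
    intro x
    rw [hev, hV0]; simp
  have hdevU : ∀ x : ℝ, Polynomial.eval (x : ℂ) (Polynomial.derivative (P j)) = 0 ↔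
      Polynomial.eval x (Polynomial.derivative U) = 0 := by
    intro x
    rw [hPU, Polynomial.derivative_map]
    have := Polynomial.eval_map_apply (f := Complex.ofRealHom) (p := Polynomial.derivative U) x
    simp only [Complex.ofRealHom_eq_coe] at this
    rw [this, Complex.ofReal_eq_zero]
  have hdegU : (P j).natDegree = U.natDegree := by
    rw [hPU]; exact Polynomial.natDegree_map _
  have hU0 : U ≠ 0 := by
    intro hU
    have hfz : ∀ x : ℝ, (x : ℂ) ∉ arcs → f x = 0 := by
      intro x hx
      rw [hfx x hx, (hevU x).2 (by rw [hU]; simp), zero_div]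
    by_cases hj : (j : ℕ) = g - 1
    · rw [if_pos hj] at hpere
      rw [MeasureTheory.setIntegral_eq_zero_of_forall_eq_zero
          (fun x (hx : x ∈ Iio (a 0)) => hfz x (hext x (Or.inl hx))),
        MeasureTheory.setIntegral_eq_zero_of_forall_eq_zero
          (fun x (hx : x ∈ Ioi (a (2 * g + 1))) => hfz x (hext x (Or.inr hx)))] at hpere
      norm_num at hpere
    · have h1 := hperf j (by omega)
      rw [if_pos rfl, MeasureTheory.setIntegral_eq_zero_of_forall_eq_zero
          (fun x hx => hfz x (hfin j j.2 x hx))] at h1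
      norm_num at h1
  have hUd' := hUd.trans (hPdeg j)
  -- zeros in the finite gaps other than the `j`-th
  have hz : ∀ k, k < g - 1 ∧ k ≠ (j : ℕ) → ∃ x ∈ Ioo (a (2 * k + 1)) (a (2 * k + 2)),
      Polynomial.eval x U = 0 := by
    rintro k ⟨hk, hkj⟩
    apply cU1 k (by omega)
    rw [hsre, hperf ⟨k, by omega⟩ (by simp only; omega), if_neg]
    · rfl
    · intro h
      exact hkj (by rw [h])
  choose! y hy1 hy2 using hz
  set K : Finset ℕ := (Finset.range (g - 1)).erase (j : ℕ) with hK
  have hKmem : ∀ k, k ∈ K ↔ k < g - 1 ∧ k ≠ (j : ℕ) := by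
    intro k
    rw [hK, Finset.mem_erase, Finset.mem_range, and_comm]
  set S := K.image y with hS
  have hScard : S.card = K.card := hcardimg K y (fun k hk => by
    rw [hKmem] at hk
    exact ⟨by omega, hy1 k hk⟩)
  have hSroot : ∀ x ∈ S, Polynomial.eval x U = 0 := by
    intro x hx
    rw [hS, Finset.mem_image] at hx
    obtain ⟨k, hk, rfl⟩ := hx
    exact hy2 k ((hKmem k).1 hk)
  have hSgap : ∀ x ∈ S, ∃ k, k < g - 1 ∧ k ≠ (j : ℕ) ∧ x = y k := by
    intro x hx
    rw [hS, Finset.mem_image] at hx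
    obtain ⟨k, hk, rfl⟩ := hx
    exact ⟨k, ((hKmem k).1 hk).1, ((hKmem k).1 hk).2, rfl⟩
  -- a description of all the zeros is enough
  have hmain : ∀ E : Finset ℝ, (∀ x ∈ E, x < a 0 ∨ a (2 * g + 1) < x) →
      (∀ x : ℝ, Polynomial.eval x U = 0 → (x ∈ S ∨ x ∈ E) ∧
        Polynomial.eval x (Polynomial.derivative U) ≠ 0) →
      (∀ k : Fin g, k ≠ j → (k : ℕ) + 1 ≤ g - 1 →
        (∃! x : ℝ, x ∈ Ioo (a (2 * (k : ℕ) + 1)) (a (2 * (k : ℕ) + 2)) ∧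
          Polynomial.eval (x : ℂ) (P j) = 0) ∧
        (∀ x : ℝ, x ∈ Ioo (a (2 * (k : ℕ) + 1)) (a (2 * (k : ℕ) + 2)) →
          Polynomial.eval (x : ℂ) (P j) = 0 →
          Polynomial.eval (x : ℂ) (Polynomial.derivative (P j)) ≠ 0)) ∧
      ((j : ℕ) + 1 ≤ g - 1 →
        ∀ x : ℝ, x ∈ Ioo (a (2 * (j : ℕ) + 1)) (a (2 * (j : ℕ) + 2)) →
          Polynomial.eval (x : ℂ) (P j) ≠ 0) := by
    intro E hE hall
    refine ⟨?_, ?_⟩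
    · intro k hkj hk
      have hkj' : (k : ℕ) ≠ (j : ℕ) := fun h => hkj (Fin.ext h)
      have hkp : (k : ℕ) < g - 1 ∧ (k : ℕ) ≠ (j : ℕ) := ⟨by omega, hkj'⟩
      refine ⟨⟨y k, ⟨hy1 k hkp, (hevU _).2 (hy2 k hkp)⟩, ?_⟩, ?_⟩
      · rintro x ⟨hx, hx0⟩
        rcases (hall x ((hevU x).1 hx0)).1 with h | h
        · obtain ⟨k', hk', hkj'', rfl⟩ := hSgap x h
          have := hdisj k k' k.2 (by omega) _ hx (hy1 k' ⟨hk', hkj''⟩)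
          rw [this]
        · exact absurd (hE x h) (hdisje k k.2 x hx)
      · intro x _ hx0
        rw [ne_eq, hdevU]
        exact (hall x ((hevU x).1 hx0)).2
    · intro hj x hx hx0
      rcases (hall x ((hevU x).1 hx0)).1 with h | h
      · obtain ⟨k', hk', hkj'', rfl⟩ := hSgap x h
        exact hkj'' (hdisj j k' j.2 (by omega) _ hx (hy1 k' ⟨hk', hkj''⟩)).symm
      · exact hdisje j j.2 x hx (hE x h)
  have hSext : ∀ x ∈ S, ¬ (x < a 0 ∨ a (2 * g + 1) < x) := by
    intro x hx
    obtain ⟨k, hk, hkj, rfl⟩ := hSgap x hx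
    exact hdisje k (by omega) _ (hy1 k ⟨hk, hkj⟩)
  refine ⟨fun m => by rw [← hVc, hV0, Polynomial.coeff_zero], hPdeg j, ?_⟩
  obtain ⟨s1, s2⟩ := aux_simple U hU0 S hSroot
  by_cases hj : (j : ℕ) = g - 1
  · have hKc : K.card = g - 1 := by
      rw [hK, Finset.erase_eq_of_notMem (by rw [Finset.mem_range]; omega), Finset.card_range]
    have hall := s2 (by omega)
    obtain ⟨m1, m2⟩ := hmain ∅ (by simp) (fun x hx => ⟨Or.inl (hall x hx).1, (hall x hx).2⟩)
    refine ⟨m1, m2, fun h => by omega, fun _ x hx hx0 => ?_⟩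
    exact hSext x (hall x ((hevU x).1 hx0)).1 hx
  · have hjlt : (j : ℕ) < g - 1 := by omega
    have hKc : K.card = g - 2 := by
      rw [hK, Finset.card_erase_of_mem (Finset.mem_range.2 hjlt), Finset.card_range]
      omega
    by_cases hd : U.natDegree = g - 1
    · obtain ⟨x, hx, hx0⟩ := cU2 (by
        rw [hsre, hsre, ← Complex.add_re, hpere, if_neg hj]
        rfl) hU0 hd
      have hxS : x ∉ S := fun h => hSext x h hx
      obtain ⟨t1, t2⟩ := aux_simple U hU0 (insert x S) (by
        intro z hz
        rw [Finset.mem_insert] at hz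
        rcases hz with rfl | hz
        · exact hx0
        · exact hSroot z hz)
      rw [Finset.card_insert_of_notMem hxS] at t2
      have hall := t2 (by omega)
      obtain ⟨m1, m2⟩ := hmain {x} (by
        intro z hz
        rw [Finset.mem_singleton] at hz
        rw [hz]; exact hx) (fun z hz => ⟨by
          have := (hall z hz).1
          rw [Finset.mem_insert] at this
          rw [Finset.mem_singleton]
          exact this.symm, (hall z hz).2⟩)
      refine ⟨m1, m2, fun _ => Or.inl ⟨⟨x, ⟨hx, (hevU x).2 hx0⟩, ?_⟩, ?_⟩, fun h => absurd h hj⟩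
      · rintro z ⟨hz, hz0⟩
        have := (hall z ((hevU z).1 hz0)).1
        rw [Finset.mem_insert] at this
        rcases this with h | h
        · exact h
        · exact absurd hz (hSext z h)
      · intro z _ hz0
        rw [ne_eq, hdevU]
        exact (hall z ((hevU z).1 hz0)).2
    · have hall := s2 (by omega)
      obtain ⟨m1, m2⟩ := hmain ∅ (by simp) (fun x hx => ⟨Or.inl (hall x hx).1, (hall x hx).2⟩)
      refine ⟨m1, m2, fun _ => Or.inr ⟨by omega, fun x hx hx0 => ?_⟩, fun h => absurd h hj⟩
      exact hSext x (hall x ((hevU x).1 hx0)).1 hx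
end

section
/- Jump relations of the g-function: the function g(z) = 1/2 - 2∫_{a_1}^z ω_1 dζ (path in ℂ \ [a_1, ∞)) satisfies g_+(z) + g_-(z) = -1 on I_i, g_+(z) + g_-(z) = 1 on I_e, and g_+(z) - g_-(z) = iΩ_j with real constants Ω_j on each gap c_j. -/
open Complex Set Filter

theorem rad_integrable (b x y : ℝ) :
    IntervalIntegrable (fun t : ℝ => 1 / √|t - b|) MeasureTheory.volume x y := by
  have h := (intervalIntegral.intervalIntegrable_cpow' (a := x - b) (b := y - b)
    (r := ((-1/2 : ℝ) : ℂ)) (by simp; norm_num)).norm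
  have h2 := h.comp_sub_right b
  simp only [sub_add_cancel] at h2
  have hae : ∀ᵐ t : ℝ, t ≠ b := by
    simp [MeasureTheory.ae_iff]
  refine h2.congr_ae (MeasureTheory.ae_restrict_of_ae ?_)
  filter_upwards [hae] with t ht
  have ht' : t - b ≠ 0 := sub_ne_zero.2 ht
  have h3 : ((t - b : ℝ) : ℂ) ≠ 0 := by exact_mod_cast ht'
  rw [Complex.norm_cpow_of_ne_zero h3]
  simp only [Complex.norm_real, Real.norm_eq_abs, Complex.ofReal_re, Complex.ofReal_im, mul_zero,
    Real.exp_zero, div_one]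
  rw [Real.sqrt_eq_rpow, neg_div, Real.rpow_neg (abs_nonneg _), one_div, one_div]

theorem rad_mul (b c : ℝ) (h : b ≠ c) : ∃ C : ℝ, 0 ≤ C ∧ ∀ t : ℝ,
    1 / √|t - b| * (1 / √|t - c|) ≤ C * (1 / √|t - b| + 1 / √|t - c|) := by
  have hd : 0 < |b - c| := abs_pos.2 (sub_ne_zero.2 h)
  refine ⟨1 / √(|b - c| / 2), by positivity, fun t => ?_⟩
  have hu : 0 ≤ 1 / √|t - b| := by positivity
  have hv : 0 ≤ 1 / √|t - c| := by positivity
  have hC : 0 ≤ 1 / √(|b - c| / 2) := by positivity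
  have htri : |b - c| ≤ |t - b| + |t - c| := by
    have := abs_sub_le b t c
    rwa [abs_sub_comm b t] at this
  rcases le_total (|b - c| / 2) (|t - b|) with h1 | h1
  · have : 1 / √|t - b| ≤ 1 / √(|b - c| / 2) :=
      one_div_le_one_div_of_le (by positivity) (Real.sqrt_le_sqrt h1)
    nlinarith
  · have h1' : |b - c| / 2 ≤ |t - c| := by linarith
    have : 1 / √|t - c| ≤ 1 / √(|b - c| / 2) :=
      one_div_le_one_div_of_le (by positivity) (Real.sqrt_le_sqrt h1')
    nlinarith

theorem prod_rad_bound (S : Finset ℝ) (hS : S.Nonempty) : ∃ C : ℝ, 0 ≤ C ∧ ∀ t : ℝ,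
    1 / √(∏ b ∈ S, |t - b|) ≤ C * ∑ b ∈ S, 1 / √|t - b| := by
  induction hS using Finset.Nonempty.cons_induction with
  | singleton b => exact ⟨1, by norm_num, fun t => by simp⟩
  | cons b S hb hS ih =>
    obtain ⟨C, hC, hb1⟩ := ih
    have : ∀ c ∈ S, b ≠ c := fun c hc h => hb (h ▸ hc)
    have key : ∀ c : ℝ, ∃ D : ℝ, 0 ≤ D ∧ (c ∈ S → ∀ t : ℝ,
        1 / √|t - b| * (1 / √|t - c|) ≤ D * (1 / √|t - b| + 1 / √|t - c|)) := by
      intro c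
      by_cases hc : c ∈ S
      · obtain ⟨D, h1, h2⟩ := rad_mul b c (this c hc)
        exact ⟨D, h1, fun _ => h2⟩
      · exact ⟨0, le_refl _, fun h => absurd h hc⟩
    choose D hD hD2 using key
    refine ⟨C * ∑ c ∈ S, D c, mul_nonneg hC (Finset.sum_nonneg fun c _ => hD c), fun t => ?_⟩
    rw [Finset.prod_cons, Finset.sum_cons, Real.sqrt_mul (abs_nonneg _)]
    have hu : 0 ≤ 1 / √|t - b| := by positivity
    have hsum : ∀ c ∈ S, 1 / √|t - c| ≤ ∑ c ∈ S, 1 / √|t - c| := fun c hc =>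
      Finset.single_le_sum (f := fun c => 1 / √|t - c|) (fun i _ => by positivity) hc
    calc 1 / (√|t - b| * √(∏ x ∈ S, |t - x|))
        = 1 / √|t - b| * (1 / √(∏ x ∈ S, |t - x|)) := by rw [one_div_mul_one_div]
      _ ≤ 1 / √|t - b| * (C * ∑ c ∈ S, 1 / √|t - c|) := by gcongr; exact hb1 t
      _ = C * ∑ c ∈ S, 1 / √|t - b| * (1 / √|t - c|) := by rw [← Finset.mul_sum]; ring
      _ ≤ C * ∑ c ∈ S, D c * (1 / √|t - b| + ∑ c ∈ S, 1 / √|t - c|) := by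
          refine mul_le_mul_of_nonneg_left (Finset.sum_le_sum fun c hc => ?_) hC
          refine (hD2 c hc t).trans ?_
          have := hD c
          have := hsum c hc
          gcongr
      _ = _ := by rw [← Finset.sum_mul]; ring

/-- Boundary version of the fundamental theorem of calculus by dominated convergence. -/
theorem boundary_ftc (W G : ℂ → ℂ) (w : ℝ → ℂ) (σ : ℝ) (x y : ℝ) (gx gy : ℂ) (B : ℝ → ℝ)
    (hder : ∀ ε : ℝ, 0 < ε → ∀ t : ℝ,
      HasDerivAt G (-2 * W (t + (σ * ε : ℝ) * I)) (t + (σ * ε : ℝ) * I))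
    (hcont : ∀ ε : ℝ, 0 < ε → Continuous (fun t : ℝ => W (t + (σ * ε : ℝ) * I)))
    (hB : IntervalIntegrable B MeasureTheory.volume x y)
    (hle : ∀ ε : ℝ, 0 < ε → ε < 1 → ∀ᵐ t : ℝ, t ∈ uIoc x y → ‖W (t + (σ * ε : ℝ) * I)‖ ≤ B t)
    (hlim : ∀ᵐ t : ℝ, Tendsto (fun ε : ℝ => W (t + (σ * ε : ℝ) * I)) (nhdsWithin 0 (Ioi 0))
      (nhds (w t)))
    (hgx : Tendsto (fun ε : ℝ => G (x + (σ * ε : ℝ) * I)) (nhdsWithin 0 (Ioi 0)) (nhds gx))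
    (hgy : Tendsto (fun ε : ℝ => G (y + (σ * ε : ℝ) * I)) (nhdsWithin 0 (Ioi 0)) (nhds gy)) :
    gy - gx = -2 * ∫ t in x..y, w t := by
  have hev : ∀ᶠ ε : ℝ in nhdsWithin 0 (Ioi 0), 0 < ε ∧ ε < 1 := by
    filter_upwards [Ioo_mem_nhdsGT (show (0:ℝ) < 1 by norm_num)] with ε hε using hε
  have h1 := intervalIntegral.tendsto_integral_filter_of_dominated_convergence (a := x) (b := y)
    (μ := MeasureTheory.volume) (l := nhdsWithin (0:ℝ) (Ioi 0))
    (F := fun (ε : ℝ) (t : ℝ) => W (t + (σ * ε : ℝ) * I)) (f := w) B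
    (hev.mono fun ε hε => (hcont ε hε.1).aestronglyMeasurable)
    (hev.mono fun ε hε => hle ε hε.1 hε.2) hB (hlim.mono fun t ht _ => ht)
  have h2 := h1.const_mul (-2)
  refine tendsto_nhds_unique (hgy.sub hgx) (h2.congr' ?_)
  filter_upwards [hev] with ε hε
  rw [← intervalIntegral.integral_const_mul]
  refine intervalIntegral.integral_eq_sub_of_hasDerivAt
    (f := fun t : ℝ => G (t + (σ * ε : ℝ) * I)) (fun t _ => ?_)
    ((continuous_const.mul (hcont ε hε.1)).intervalIntegrable _ _)
  have h3 : HasDerivAt (fun t : ℝ => (t : ℂ) + (σ * ε : ℝ) * I) 1 t :=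
    (Complex.ofRealCLM.hasDerivAt (x := t)).add_const _
  have := (hder ε hε.1 t).comp_of_eq t h3 rfl
  simpa [Function.comp_def] using this

theorem boundary_integrable (W : ℂ → ℂ) (w : ℝ → ℂ) (σ : ℝ) (x y : ℝ) (B : ℝ → ℝ)
    (hcont : ∀ ε : ℝ, 0 < ε → Continuous (fun t : ℝ => W (t + (σ * ε : ℝ) * I)))
    (hB : IntervalIntegrable B MeasureTheory.volume x y)
    (hle : ∀ ε : ℝ, 0 < ε → ε < 1 → ∀ᵐ t : ℝ, t ∈ uIoc x y → ‖W (t + (σ * ε : ℝ) * I)‖ ≤ B t)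
    (hlim : ∀ᵐ t : ℝ, Tendsto (fun ε : ℝ => W (t + (σ * ε : ℝ) * I)) (nhdsWithin 0 (Ioi 0))
      (nhds (w t))) :
    IntervalIntegrable w MeasureTheory.volume x y := by
  have hseq : Tendsto (fun n : ℕ => (1 : ℝ) / (n + 2)) atTop (nhdsWithin 0 (Ioi 0)) := by
    refine tendsto_nhdsWithin_iff.2 ⟨?_, Eventually.of_forall fun n => by simp; positivity⟩
    have := (tendsto_one_div_add_atTop_nhds_zero_nat (𝕜 := ℝ)).comp (tendsto_add_atTop_nat 1)
    refine this.congr fun n => ?_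
    simp; ring
  have hlt : ∀ n : ℕ, (1 : ℝ) / (n + 2) < 1 := fun n => by
    rw [div_lt_one (by positivity)]; have : (0:ℝ) ≤ n := by positivity
    linarith
  have hm : MeasureTheory.AEStronglyMeasurable w (MeasureTheory.volume.restrict (uIoc x y)) :=
    aestronglyMeasurable_of_tendsto_ae (u := atTop)
      (f := fun (n : ℕ) (t : ℝ) => W (t + (σ * (1 / (n + 2)) : ℝ) * I))
      (fun n => (hcont _ (by positivity)).aestronglyMeasurable)
      (MeasureTheory.ae_restrict_of_ae (hlim.mono fun t ht => ht.comp hseq))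
  refine hB.mono_fun' hm ?_
  have hall : ∀ᵐ t : ℝ, ∀ n : ℕ, t ∈ uIoc x y → ‖W (t + (σ * (1 / (n + 2)) : ℝ) * I)‖ ≤ B t :=
    MeasureTheory.ae_all_iff.2 fun n => hle _ (by positivity) (hlt n)
  rw [EventuallyLE, MeasureTheory.ae_restrict_iff' measurableSet_uIoc]
  filter_upwards [hall, hlim] with t h1 h2 ht
  exact le_of_tendsto ((h2.comp hseq).norm) (Eventually.of_forall fun n => h1 n ht)

theorem prod_pairs (f : ℕ → ℝ) (n : ℕ) : ∏ j ∈ Finset.range (2 * n + 2), f j =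
    ∏ t ∈ Finset.range (n + 1), f (2 * t) * f (2 * t + 1) := by
  induction n with
  | zero => simp [Finset.prod_range_succ]
  | succ n ih =>
    rw [Finset.prod_range_succ _ (n + 1), ← ih, show 2 * (n + 1) + 2 = 2 * n + 2 + 1 + 1 by ring,
      Finset.prod_range_succ, Finset.prod_range_succ, mul_assoc,
      show 2 * (n + 1) = 2 * n + 2 by ring]

theorem branch_mono (g : ℕ) (a : ℕ → ℝ) (ha : ∀ i, i < 2 * g + 1 → a i < a (i + 1)) :
    ∀ i j : ℕ, i < j → j ≤ 2 * g + 1 → a i < a j := by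
  intro i j hij
  induction j, hij using Nat.le_induction with
  | base => intro h; exact ha i (by omega)
  | succ j hj ih => intro h; exact (ih (by omega)).trans (ha j (by omega))

theorem branch_mono_le (g : ℕ) (a : ℕ → ℝ) (ha : ∀ i, i < 2 * g + 1 → a i < a (i + 1)) :
    ∀ i j : ℕ, i ≤ j → j ≤ 2 * g + 1 → a i ≤ a j := by
  intro i j hij hj
  rcases hij.lt_or_eq with h | h
  · exact (branch_mono g a ha i j h hj).le
  · rw [h]

theorem prod_pos_gap (g : ℕ) (a : ℕ → ℝ) (ha : ∀ i, i < 2 * g + 1 → a i < a (i + 1))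
    (k : ℕ) (hk : k + 1 ≤ g) (x : ℝ) (hx : x ∈ Ioo (a (2 * k + 1)) (a (2 * k + 2))) :
    0 < ∏ j ∈ Finset.range (2 * g + 2), (x - a j) := by
  rw [prod_pairs (fun j => x - a j)]
  refine Finset.prod_pos fun t ht => ?_
  rw [Finset.mem_range] at ht
  have m := branch_mono_le g a ha
  rcases le_or_gt t k with h | h
  · have h1 := m (2 * t) (2 * k + 1) (by omega) (by omega)
    have h2 := m (2 * t + 1) (2 * k + 1) (by omega) (by omega)
    exact mul_pos (by linarith [hx.1]) (by linarith [hx.1])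
  · have h1 := m (2 * k + 2) (2 * t) (by omega) (by omega)
    have h2 := m (2 * k + 2) (2 * t + 1) (by omega) (by omega)
    exact mul_pos_of_neg_of_neg (by linarith [hx.2]) (by linarith [hx.2])

theorem prod_neg_arc (g : ℕ) (a : ℕ → ℝ) (ha : ∀ i, i < 2 * g + 1 → a i < a (i + 1))
    (k : ℕ) (hk : k ≤ g) (x : ℝ) (hx : x ∈ Ioo (a (2 * k)) (a (2 * k + 1))) :
    ∏ j ∈ Finset.range (2 * g + 2), (x - a j) < 0 := by
  rw [prod_pairs (fun j => x - a j),
    ← Finset.mul_prod_erase _ _ (Finset.mem_range.2 (show k < g + 1 by omega))]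
  refine mul_neg_of_neg_of_pos (mul_neg_of_pos_of_neg (by linarith [hx.1]) (by linarith [hx.2])) ?_
  refine Finset.prod_pos fun t ht => ?_
  rw [Finset.mem_erase, Finset.mem_range] at ht
  have m := branch_mono_le g a ha
  rcases lt_or_gt_of_ne ht.1 with h | h
  · have h1 := m (2 * t) (2 * k) (by omega) (by omega)
    have h2 := m (2 * t + 1) (2 * k) (by omega) (by omega)
    exact mul_pos (by linarith [hx.1]) (by linarith [hx.1])
  · have h1 := m (2 * k + 1) (2 * t) (by omega) (by omega)
    have h2 := m (2 * k + 1) (2 * t + 1) (by omega) (by omega)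
    exact mul_pos_of_neg_of_neg (by linarith [hx.2]) (by linarith [hx.2])

theorem sqrt_symm (n m : ℕ) (a : ℕ → ℝ) (R : ℂ → ℂ)
    (hc : ContinuousOn R {z : ℂ | z.im ≠ 0})
    (hRsq : ∀ z : ℂ, z.im ≠ 0 → R z ^ 2 = ∏ j ∈ Finset.range n, (z - (a j : ℂ)))
    (hRinf : Tendsto (fun z : ℂ => R z / z ^ m) (cocompact ℂ) (nhds 1)) :
    ∀ z : ℂ, 0 < z.im → R (starRingEnd ℂ z) = starRingEnd ℂ (R z) := by
  have hconn : IsPreconnected {z : ℂ | 0 < z.im} := (convex_halfSpace_im_gt 0).isPreconnected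
  have hne : ∀ z : ℂ, z.im ≠ 0 → R z ≠ 0 := by
    intro z hz h0
    have := hRsq z hz
    rw [h0, eq_comm] at this
    simp only [ne_eq, OfNat.ofNat_ne_zero, not_false_eq_true, zero_pow] at this
    rw [Finset.prod_eq_zero_iff] at this
    obtain ⟨j, _, hj⟩ := this
    rw [sub_eq_zero] at hj
    rw [hj] at hz
    simp at hz
  have hcf : ContinuousOn (fun z => starRingEnd ℂ (R (starRingEnd ℂ z))) {z : ℂ | 0 < z.im} := by
    refine Complex.continuous_conj.comp_continuousOn (hc.comp Complex.continuous_conj.continuousOn ?_)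
    intro z hz
    have : 0 < z.im := hz
    simp only [mem_ofPred_eq, conj_im, ne_eq, neg_eq_zero]
    exact this.ne'
  have hcg : ContinuousOn R {z : ℂ | 0 < z.im} := hc.mono fun z hz => ne_of_gt hz
  have hsq : EqOn ((fun z => starRingEnd ℂ (R (starRingEnd ℂ z))) ^ 2) (R ^ 2) {z : ℂ | 0 < z.im} := by
    intro z hz
    have hz' : z.im ≠ 0 := ne_of_gt hz
    simp only [Pi.pow_apply]
    rw [← map_pow, hRsq z hz', hRsq _ (by simpa using hz'), map_prod]
    simp
  rcases hconn.eq_or_eq_neg_of_sq_eq hcf hcg hsq (fun {z} hz => hne z (ne_of_gt hz)) with h | h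
  · intro z hz
    have := h hz
    simp only at this
    rw [← this]; simp
  · exfalso
    have hnorm : Tendsto (fun y : ℝ => ‖(y : ℂ) * I‖) atTop atTop := by
      simpa using tendsto_abs_atTop_atTop
    have h1 : Tendsto (fun y : ℝ => (y : ℂ) * I) atTop (cocompact ℂ) := by
      rw [← Metric.cobounded_eq_cocompact, ← tendsto_norm_atTop_iff_cobounded]; exact hnorm
    have h2 : Tendsto (fun y : ℝ => starRingEnd ℂ ((y : ℂ) * I)) atTop (cocompact ℂ) := by
      rw [← Metric.cobounded_eq_cocompact, ← tendsto_norm_atTop_iff_cobounded]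
      simpa using tendsto_abs_atTop_atTop
    have t1 := hRinf.comp h1
    have t2 := (Complex.continuous_conj.tendsto 1).comp (hRinf.comp h2)
    have t3 := t1.neg
    have : (starRingEnd ℂ 1 : ℂ) = -1 := by
      refine tendsto_nhds_unique t2 (t3.congr' ?_)
      filter_upwards [eventually_gt_atTop 0] with y hy
      have := h (show ((y : ℂ) * I) ∈ {z : ℂ | 0 < z.im} by simpa using hy)
      simp only [Pi.neg_apply] at this
      simp only [Function.comp_apply]
      rw [map_div₀, this, map_pow, Complex.conj_conj, neg_div]
    rw [map_one] at this
    norm_num at this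

theorem lower_limit (n : ℕ) (a : ℕ → ℝ) (R ω : ℂ → ℂ) (P : Polynomial ℂ)
    (hRsq : ∀ z : ℂ, z.im ≠ 0 → R z ^ 2 = ∏ j ∈ Finset.range n, (z - (a j : ℂ)))
    (hsymm : ∀ z : ℂ, 0 < z.im → R (starRingEnd ℂ z) = starRingEnd ℂ (R z))
    (hω : ∀ z : ℂ, z.im ≠ 0 → ω z = Polynomial.eval z P / R z)
    (x : ℝ) (hx : ∏ j ∈ Finset.range n, (x - a j) ≠ 0) (w : ℂ)
    (hw : Tendsto ω (nhdsWithin (x : ℂ) {z : ℂ | 0 < z.im}) (nhds w)) :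
    Tendsto (fun z => ω (starRingEnd ℂ z)) (nhdsWithin (x : ℂ) {z : ℂ | 0 < z.im})
      (nhds (((SignType.sign (∏ j ∈ Finset.range n, (x - a j)) : ℝ) : ℂ) * w)) := by
  set l := nhdsWithin (x : ℂ) {z : ℂ | 0 < z.im}
  set q : ℂ → ℂ := fun z => ∏ j ∈ Finset.range n, (z - (a j : ℂ)) with hq
  have hqc : Continuous q := by fun_prop
  have hqx : q x = ((∏ j ∈ Finset.range n, (x - a j) : ℝ) : ℂ) := by simp [hq]
  have hqx0 : q x ≠ 0 := by rw [hqx]; exact_mod_cast hx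
  have hql : Tendsto q l (nhds (q x)) := (hqc.tendsto _).mono_left nhdsWithin_le_nhds
  have hu : Tendsto (fun z => q z / (‖q z‖ : ℂ)) l
      (nhds ((SignType.sign (∏ j ∈ Finset.range n, (x - a j)) : ℝ) : ℂ)) := by
    have h1 : Tendsto (fun z => q z / (‖q z‖ : ℂ)) l (nhds (q x / (‖q x‖ : ℂ))) :=
      hql.div ((Complex.continuous_ofReal.tendsto _).comp hql.norm) (by simpa using hqx0)
    convert h1 using 2
    rw [hqx, Complex.norm_real, Real.norm_eq_abs, ← Complex.ofReal_div]
    congr 1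
    rw [eq_div_iff (abs_ne_zero.2 hx), sign_mul_abs]
  have hd : Tendsto (fun z => (Polynomial.eval (starRingEnd ℂ z) P - Polynomial.eval z P) / R z) l
      (nhds 0) := by
    rw [tendsto_zero_iff_norm_tendsto_zero]
    have h1 : Tendsto (fun z => ‖Polynomial.eval (starRingEnd ℂ z) P - Polynomial.eval z P‖
        / √‖q z‖) l (nhds (‖Polynomial.eval (starRingEnd ℂ (x : ℂ)) P - Polynomial.eval (x : ℂ) P‖
        / √‖q x‖)) := by
      refine Tendsto.div ?_ ((Real.continuous_sqrt.tendsto _).comp hql.norm) ?_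
      · refine Tendsto.mono_left (Continuous.tendsto ?_ _) nhdsWithin_le_nhds
        exact ((P.continuous.comp Complex.continuous_conj).sub P.continuous).norm
      · exact (Real.sqrt_pos.2 (norm_pos_iff.2 hqx0)).ne'
    simp only [Complex.conj_ofReal, sub_self, norm_zero, zero_div] at h1
    refine h1.congr' ?_
    filter_upwards [self_mem_nhdsWithin] with z hz
    have hz' : z.im ≠ 0 := ne_of_gt hz
    rw [norm_div]
    congr 1
    rw [Real.sqrt_eq_iff_mul_self_eq (norm_nonneg _) (norm_nonneg _), ← norm_mul, ← sq, hRsq z hz']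
  have h3 := (hu.mul hw).add (hu.mul hd)
  rw [mul_zero, add_zero] at h3
  refine h3.congr' ?_
  have hne : ∀ᶠ z in l, q z ≠ 0 := hql.eventually_ne hqx0
  filter_upwards [self_mem_nhdsWithin, hne] with z hz hqz
  have hz' : z.im ≠ 0 := ne_of_gt hz
  have hs : R z ^ 2 = q z := hRsq z hz'
  have hR0 : R z ≠ 0 := by
    intro h; rw [h] at hs; apply hqz; rw [← hs]; simp
  rw [hω z hz', hω _ (by simpa using hz'), hsymm z hz, ← mul_add, ← add_div, add_sub_cancel, ← hs]
  have hn : ((‖R z ^ 2‖ : ℝ) : ℂ) = R z * starRingEnd ℂ (R z) := by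
    rw [Complex.mul_conj, Complex.normSq_eq_norm_sq, norm_pow]
  have hcR : starRingEnd ℂ (R z) ≠ 0 := by simpa using hR0
  rw [hn]
  field_simp

theorem poly_real (P : Polynomial ℂ) (g : ℕ) (hg : 1 ≤ g) (hdeg : P.natDegree ≤ g - 1)
    (l u : ℕ → ℝ) (hlu : ∀ k < g, l k < u k) (hord : ∀ i j, i < j → j < g → u i ≤ l j)
    (r : ℝ → ℝ) (w : ℝ → ℂ)
    (hrc : ∀ k < g, ContinuousOn r (Ioo (l k) (u k)))
    (hr0 : ∀ k < g, ∀ x ∈ Ioo (l k) (u k), r x ≠ 0)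
    (hw : ∀ k < g, ∀ x ∈ Ioo (l k) (u k), w x = Polynomial.eval (x : ℂ) P / r x)
    (hint : ∀ k < g, IntervalIntegrable w MeasureTheory.volume (l k) (u k))
    (him : ∀ k < g, (∫ x in (l k)..(u k), w x).im = 0) :
    ∀ x : ℝ, (Polynomial.eval (x : ℂ) P).im = 0 := by
  set Q : Polynomial ℝ := ∑ i ∈ Finset.range (P.natDegree + 1),
    Polynomial.monomial i (P.coeff i).im with hQ
  have hQe : ∀ x : ℝ, Q.eval x = (Polynomial.eval (x : ℂ) P).im := by
    intro x
    rw [hQ, Polynomial.eval_finsetSum, Polynomial.eval_eq_sum_range, Complex.im_sum]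
    refine Finset.sum_congr rfl fun i _ => ?_
    rw [Polynomial.eval_monomial, ← Complex.ofReal_pow, Complex.im_mul_ofReal]
  have hQd : Q.natDegree ≤ g - 1 := by
    refine Polynomial.natDegree_sum_le_of_forall_le _ _ fun i hi => ?_
    rw [Finset.mem_range] at hi
    exact (Polynomial.natDegree_monomial_le _).trans (by omega)
  have hroot : ∀ k : Fin g, ∃ x ∈ Ioo (l k) (u k), Q.eval x = 0 := by
    rintro ⟨k, hk⟩
    by_contra! hno
    simp only at hno
    set f : ℝ → ℝ := fun x => Q.eval x / r x with hf
    have hfc : ContinuousOn f (Ioo (l k) (u k)) :=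
      (Q.continuous.continuousOn).div (hrc k hk) (hr0 k hk)
    have hf0 : ∀ x ∈ Ioo (l k) (u k), f x ≠ 0 := fun x hx => div_ne_zero (hno x hx) (hr0 k hk x hx)
    have hfw : ∀ x ∈ Ioo (l k) (u k), (w x).im = f x := by
      intro x hx
      simp only [hf]
      rw [hw k hk x hx, hQe, Complex.div_ofReal_im]
    have hfi : IntervalIntegrable (fun x => (w x).im) MeasureTheory.volume (l k) (u k) :=
      ⟨(hint k hk).1.im, (hint k hk).2.im⟩
    have hI : ∫ x in (l k)..(u k), (w x).im = 0 := by
      have := Complex.imCLM.intervalIntegral_comp_comm (hint k hk)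
      simp only [Complex.imCLM_apply] at this
      rw [this, him k hk]
    have hcase : (∀ x ∈ Ioo (l k) (u k), 0 < f x) ∨ (∀ x ∈ Ioo (l k) (u k), 0 < - f x) := by
      by_contra! hcon
      obtain ⟨⟨x, hx, hx1⟩, ⟨y, hy, hy1⟩⟩ := hcon
      obtain ⟨z, hz, hz0⟩ := isPreconnected_Ioo.intermediate_value hx hy hfc ⟨hx1, by linarith⟩
      exact hf0 z hz hz0
    rcases hcase with h | h
    · have := intervalIntegral.intervalIntegral_pos_of_pos_on hfi
        (fun x hx => by rw [hfw x hx]; exact h x hx) (hlu k hk)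
      linarith
    · have := intervalIntegral.intervalIntegral_pos_of_pos_on hfi.neg
        (fun x hx => by simp only [Pi.neg_apply]; rw [hfw x hx]; exact h x hx) (hlu k hk)
      simp only [Pi.neg_apply, intervalIntegral.integral_neg] at this
      linarith
  choose ρ hρ hρ0 using hroot
  have hmono : StrictMono ρ := by
    intro i j hij
    have := hord i j hij j.2
    linarith [(hρ i).2, (hρ j).1]
  have hQ0 := Polynomial.eq_zero_of_natDegree_lt_card_of_eval_eq_zero Q hmono.injective hρ0
    (by simp; omega)
  intro x
  rw [← hQe, hQ0]; simp

theorem vert_up (x : ℝ) : Tendsto (fun ε : ℝ => (x : ℂ) + ((1 * ε : ℝ) : ℂ) * I)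
    (nhdsWithin 0 (Ioi 0)) (nhdsWithin (x : ℂ) {z : ℂ | 0 < z.im}) := by
  refine tendsto_nhdsWithin_iff.2 ⟨?_, ?_⟩
  · have : Continuous (fun ε : ℝ => (x : ℂ) + ((1 * ε : ℝ) : ℂ) * I) := by fun_prop
    have := this.tendsto 0
    simp only [mul_zero, Complex.ofReal_zero, zero_mul, add_zero] at this
    exact this.mono_left nhdsWithin_le_nhds
  · filter_upwards [self_mem_nhdsWithin] with ε hε
    simpa using hε

theorem vert_down (x : ℝ) : Tendsto (fun ε : ℝ => (x : ℂ) + ((-1 * ε : ℝ) : ℂ) * I)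
    (nhdsWithin 0 (Ioi 0)) (nhdsWithin (x : ℂ) {z : ℂ | z.im < 0}) := by
  refine tendsto_nhdsWithin_iff.2 ⟨?_, ?_⟩
  · have : Continuous (fun ε : ℝ => (x : ℂ) + ((-1 * ε : ℝ) : ℂ) * I) := by fun_prop
    have := this.tendsto 0
    simp only [mul_zero, Complex.ofReal_zero, zero_mul, add_zero] at this
    exact this.mono_left nhdsWithin_le_nhds
  · filter_upwards [self_mem_nhdsWithin] with ε hε
    simpa using hε

theorem vert_conj (x ε : ℝ) : (x : ℂ) + ((-1 * ε : ℝ) : ℂ) * I =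
    starRingEnd ℂ ((x : ℂ) + ((1 * ε : ℝ) : ℂ) * I) := by
  apply Complex.ext <;> simp

theorem interior_arc (g : ℕ) (a : ℕ → ℝ) (ha : ∀ i, i < 2 * g + 1 → a i < a (i + 1))
    (U : Set ℝ) (hU : ∀ y ∈ U, ∃ t ≤ g, y ∈ Icc (a (2 * t)) (a (2 * t + 1)))
    (x : ℝ) (hx : x ∈ interior U) (k : ℕ) (hk : k ≤ g)
    (hxk : x ∈ Icc (a (2 * k)) (a (2 * k + 1))) : x ∈ Ioo (a (2 * k)) (a (2 * k + 1)) := by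
  have m := branch_mono g a ha
  have ml := branch_mono_le g a ha
  have hn : U ∈ nhds x := mem_interior_iff_mem_nhds.1 hx
  refine ⟨lt_of_le_of_ne hxk.1 ?_, lt_of_le_of_ne hxk.2 ?_⟩
  · rintro rfl
    obtain ⟨b, hb, hb2⟩ : ∃ b < a (2 * k), ∀ t < k, a (2 * t + 1) ≤ b := by
      rcases Nat.eq_zero_or_pos k with h | h
      · exact ⟨a (2 * k) - 1, by linarith, fun t ht => by omega⟩
      · exact ⟨a (2 * k - 1), m _ _ (by omega) (by omega), fun t ht => ml _ _ (by omega) (by omega)⟩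
    have : ∀ᶠ y in nhdsWithin (a (2 * k)) (Iio (a (2 * k))), y ∈ U ∧ y ∈ Ioo b (a (2 * k)) :=
      Filter.inter_mem (mem_nhdsWithin_of_mem_nhds hn) (Ioo_mem_nhdsLT hb)
    obtain ⟨y, hy, hy2⟩ := this.exists
    obtain ⟨t, ht, hyt⟩ := hU y hy
    rcases lt_or_ge t k with h | h
    · linarith [hb2 t h, hy2.1, hyt.2]
    · linarith [ml (2 * k) (2 * t) (by omega) (by omega), hy2.2, hyt.1]
  · rintro rfl
    obtain ⟨b, hb, hb2⟩ : ∃ b > a (2 * k + 1), ∀ t > k, t ≤ g → b ≤ a (2 * t) := by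
      rcases Nat.lt_or_ge k g with h | h
      · exact ⟨a (2 * k + 2), m _ _ (by omega) (by omega),
          fun t ht _ => ml _ _ (by omega) (by omega)⟩
      · exact ⟨a (2 * k + 1) + 1, by linarith, fun t ht _ => by omega⟩
    have : ∀ᶠ y in nhdsWithin (a (2 * k + 1)) (Ioi (a (2 * k + 1))),
        y ∈ U ∧ y ∈ Ioo (a (2 * k + 1)) b :=
      Filter.inter_mem (mem_nhdsWithin_of_mem_nhds hn) (Ioo_mem_nhdsGT hb)
    obtain ⟨y, hy, hy2⟩ := this.exists
    obtain ⟨t, ht, hyt⟩ := hU y hy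
    rcases lt_or_ge k t with h | h
    · linarith [hb2 t h ht, hy2.2, hyt.1]
    · linarith [ml (2 * t + 1) (2 * k + 1) (by omega) (by omega), hy2.1, hyt.2]

theorem omega_bound (n : ℕ) (hn : 0 < n) (a : ℕ → ℝ)
    (hinj : ∀ i < n, ∀ j < n, a i = a j → i = j)
    (R ω : ℂ → ℂ) (P : Polynomial ℂ)
    (hRsq : ∀ z : ℂ, z.im ≠ 0 → R z ^ 2 = ∏ j ∈ Finset.range n, (z - (a j : ℂ)))
    (hω : ∀ z : ℂ, z.im ≠ 0 → ω z = Polynomial.eval z P / R z) (x y : ℝ) :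
    ∃ B : ℝ → ℝ, IntervalIntegrable B MeasureTheory.volume x y ∧ ∀ η : ℝ, η ≠ 0 → |η| ≤ 1 →
      ∀ᵐ t : ℝ, t ∈ uIoc x y → ‖ω (t + (η : ℂ) * I)‖ ≤ B t := by
  obtain ⟨C, hC, hCb⟩ := prod_rad_bound ((Finset.range n).image a)
    ((Finset.nonempty_range_iff.2 hn.ne').image a)
  have hcomp : IsCompact (uIcc x y ×ˢ Icc (-1 : ℝ) 1) := isCompact_uIcc.prod isCompact_Icc
  have hPc : Continuous (fun p : ℝ × ℝ => Polynomial.eval ((p.1 : ℂ) + (p.2 : ℂ) * I) P) :=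
    P.continuous.comp (by fun_prop)
  obtain ⟨M, hM⟩ := hcomp.exists_bound_of_continuousOn hPc.continuousOn
  have hM0 : 0 ≤ M := (norm_nonneg _).trans
    (hM (x, 0) ⟨left_mem_uIcc, by constructor <;> norm_num⟩)
  refine ⟨fun t => M * (C * ∑ b ∈ (Finset.range n).image a, 1 / √|t - b|), ?_, ?_⟩
  · refine IntervalIntegrable.const_mul (IntervalIntegrable.const_mul ?_ C) M
    have := IntervalIntegrable.sum ((Finset.range n).image a)
      (f := fun b (t : ℝ) => 1 / √|t - b|) (fun b _ => rad_integrable b x y)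
    have e : (fun t : ℝ => ∑ b ∈ (Finset.range n).image a, 1 / √|t - b|) =
        ∑ b ∈ (Finset.range n).image a, fun t : ℝ => 1 / √|t - b| := by
      ext t; rw [Finset.sum_apply]
    rw [e]
    exact this
  · intro η hη hη1
    have hae : ∀ᵐ t : ℝ, ∀ i : ℕ, t ≠ a i :=
      MeasureTheory.ae_all_iff.2 fun i => by simp [MeasureTheory.ae_iff]
    filter_upwards [hae] with t ht htm
    have hz : ((t : ℂ) + (η : ℂ) * I).im ≠ 0 := by simpa using hη
    rw [hω _ hz, norm_div]
    have hR : ‖R (t + (η : ℂ) * I)‖ = √(∏ j ∈ Finset.range n, ‖(t : ℂ) + (η : ℂ) * I - a j‖) := by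
      rw [eq_comm, Real.sqrt_eq_iff_mul_self_eq (Finset.prod_nonneg fun _ _ => norm_nonneg _)
        (norm_nonneg _), ← norm_mul, ← sq, hRsq _ hz, norm_prod]
    have hle : √(∏ j ∈ Finset.range n, |t - a j|) ≤ ‖R (t + (η : ℂ) * I)‖ := by
      rw [hR]
      refine Real.sqrt_le_sqrt (Finset.prod_le_prod (fun _ _ => abs_nonneg _) fun j _ => ?_)
      have := Complex.abs_re_le_norm ((t : ℂ) + (η : ℂ) * I - a j)
      simpa using this
    have hpos : 0 < √(∏ j ∈ Finset.range n, |t - a j|) :=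
      Real.sqrt_pos.2 (Finset.prod_pos fun j _ => abs_pos.2 (sub_ne_zero.2 (ht j)))
    have hP := hM (t, η) ⟨uIoc_subset_uIcc htm, abs_le.1 hη1⟩
    simp only at hP
    have h4 := hCb t
    rw [Finset.prod_image (fun i hi j hj h => hinj i (by simpa using hi) j (by simpa using hj) h)]
      at h4
    calc ‖Polynomial.eval ((t : ℂ) + (η : ℂ) * I) P‖ / ‖R (t + (η : ℂ) * I)‖
        ≤ M / √(∏ j ∈ Finset.range n, |t - a j|) := by gcongr
      _ = M * (1 / √(∏ j ∈ Finset.range n, |t - a j|)) := by ring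
      _ ≤ _ := by gcongr

/-- Jump relations of the `g`-function `𝔤(z) = 1/2 - 2∫_{a₁}^z ω₁`:
`𝔤₊ + 𝔤₋ = -1` on `I_i`, `𝔤₊ + 𝔤₋ = 1` on `I_e`, and `𝔤₊ - 𝔤₋ = iΩ_j` with a real
constant `Ω_j` on each gap `c_j`. -/
theorem g_function_jump_relations
    (g : ℕ) (hg : 2 ≤ g)
    (a : ℕ → ℝ) (ha : ∀ i, i < 2 * g + 1 → a i < a (i + 1))
    (arcs : Set ℂ)
    (harcs : arcs = ⋃ t ∈ Finset.range (g + 1),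
      Complex.ofReal '' Icc (a (2 * t)) (a (2 * t + 1)))
    (Ie Ii : Set ℝ)
    (hIe : Ie = Icc (a 0) (a 1) ∪ Icc (a (2 * g)) (a (2 * g + 1)))
    (hIi : Ii = ⋃ k ∈ Finset.Icc 1 (g - 1), Icc (a (2 * k)) (a (2 * k + 1)))
    (R : ℂ → ℂ)
    (hRan : DifferentiableOn ℂ R arcsᶜ)
    (hRsq : ∀ z ∉ arcs, R z ^ 2 = ∏ j ∈ Finset.range (2 * g + 2), (z - (a j : ℂ)))
    (hRinf : Tendsto (fun z : ℂ => R z / z ^ (g + 1)) (cocompact ℂ) (nhds 1))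
    (P : Polynomial ℂ) (hPdeg : P.natDegree ≤ g - 1)
    (ω : ℂ → ℂ)
    (hω : ∀ z ∉ arcs, ω z = Polynomial.eval z P / R z)
    (ωp : ℝ → ℂ)
    (hωp : ∀ x : ℝ, (∀ i ≤ 2 * g + 1, x ≠ a i) →
        Tendsto ω (nhdsWithin (x : ℂ) {z : ℂ | 0 < z.im}) (nhds (ωp x)))
    -- normalization `∮_{A_k} ω₁ = δ_{1k}`
    (hnorm : ∀ k : ℕ, k ≤ g - 1 →
        (if k + 1 ≤ g - 1 then
            2 * ∫ x in (a (2 * k + 1))..(a (2 * k + 2)), ωp x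
          else
            2 * ∫ x in (a 0)..(a (2 * g + 1)), ωp x)
          = if k = 0 then 1 else 0)
    -- the g-function: `𝔤' = -2 ω₁` off the cut, with `𝔤 → 1/2` at `a₁` from the left
    (𝔤 : ℂ → ℂ)
    (cut : Set ℂ) (hcut : cut = Complex.ofReal '' Icc (a 0) (a (2 * g + 1)))
    (h𝔤an : DifferentiableOn ℂ 𝔤 cutᶜ)
    (h𝔤deriv : ∀ z ∉ cut, HasDerivAt 𝔤 (-2 * ω z) z)
    (h𝔤a1 : Tendsto (fun t : ℝ => 𝔤 ((a 0 - t : ℝ) : ℂ)) (nhdsWithin 0 (Ioi 0))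
      (nhds (1 / 2)))
    (𝔤p 𝔤m : ℝ → ℂ)
    (h𝔤p : ∀ x : ℝ, (∀ i ≤ 2 * g + 1, x ≠ a i) →
        Tendsto 𝔤 (nhdsWithin (x : ℂ) {z : ℂ | 0 < z.im}) (nhds (𝔤p x)))
    (h𝔤m : ∀ x : ℝ, (∀ i ≤ 2 * g + 1, x ≠ a i) →
        Tendsto 𝔤 (nhdsWithin (x : ℂ) {z : ℂ | z.im < 0}) (nhds (𝔤m x))) :
    (∀ x ∈ interior Ii, 𝔤p x + 𝔤m x = -1) ∧
    (∀ x ∈ interior Ie, 𝔤p x + 𝔤m x = 1) ∧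
    (∀ k : ℕ, k ≤ g - 1 → ∃ Ω : ℝ,
      ∀ x ∈ Ioo (a (2 * k + 1)) (a (2 * k + 2)), 𝔤p x - 𝔤m x = Complex.I * (Ω : ℂ)) := by
  have m := branch_mono g a ha
  have ml := branch_mono_le g a ha
  -- non-real points are off the cuts
  have hoff : ∀ z : ℂ, z.im ≠ 0 → z ∉ arcs := by
    intro z hz hmem
    rw [harcs] at hmem
    simp only [mem_iUnion, mem_image] at hmem
    obtain ⟨t, _, x, _, rfl⟩ := hmem
    simp at hz
  have hoffc : ∀ z : ℂ, z.im ≠ 0 → z ∉ cut := by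
    intro z hz hmem
    rw [hcut] at hmem
    obtain ⟨x, _, rfl⟩ := hmem
    simp at hz
  have harcs_closed : IsClosed arcs := by
    rw [harcs]
    exact isClosed_biUnion_finset fun t _ =>
      (isCompact_Icc.image Complex.continuous_ofReal).isClosed
  have hRsq' : ∀ z : ℂ, z.im ≠ 0 → R z ^ 2 = ∏ j ∈ Finset.range (2 * g + 2), (z - (a j : ℂ)) :=
    fun z hz => hRsq z (hoff z hz)
  have hω' : ∀ z : ℂ, z.im ≠ 0 → ω z = Polynomial.eval z P / R z := fun z hz => hω z (hoff z hz)
  have hsymm := sqrt_symm (2 * g + 2) (g + 1) a R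
    (hRan.continuousOn.mono fun z hz => hoff z hz) hRsq' hRinf
  set p : ℝ → ℝ := fun x => ∏ j ∈ Finset.range (2 * g + 2), (x - a j) with hp
  have hp0 : ∀ x : ℝ, (∀ i ≤ 2 * g + 1, x ≠ a i) → p x ≠ 0 := by
    intro x hx
    refine Finset.prod_ne_zero_iff.2 fun j hj => sub_ne_zero.2 (hx j ?_)
    rw [Finset.mem_range] at hj; omega
  have hae : ∀ᵐ t : ℝ, ∀ i ≤ 2 * g + 1, t ≠ a i := by
    have : ∀ᵐ t : ℝ, ∀ i : ℕ, t ≠ a i :=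
      MeasureTheory.ae_all_iff.2 fun i => by simp [MeasureTheory.ae_iff]
    exact this.mono fun t ht i _ => ht i
  set wm : ℝ → ℂ := fun x => ((SignType.sign (p x) : ℝ) : ℂ) * ωp x with hwm
  have hRne : ∀ z : ℂ, z ∉ arcs → (∀ j < 2 * g + 2, z ≠ a j) → R z ≠ 0 := by
    intro z hz hj h0
    have := hRsq z hz
    rw [h0, zero_pow (by norm_num), eq_comm, Finset.prod_eq_zero_iff] at this
    obtain ⟨j, hj1, hj2⟩ := this
    exact hj j (Finset.mem_range.1 hj1) (sub_eq_zero.1 hj2)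
  have hbranch : ∀ z : ℂ, z.im ≠ 0 → ∀ j < 2 * g + 2, z ≠ a j := by
    intro z hz j _ h
    rw [h] at hz; simp at hz
  have hωc : ∀ z : ℂ, z ∉ arcs → (∀ j < 2 * g + 2, z ≠ a j) → ContinuousAt ω z := by
    intro z hz hj
    have hn : arcsᶜ ∈ nhds z := harcs_closed.isOpen_compl.mem_nhds hz
    have h1 : ContinuousAt (fun z => Polynomial.eval z P / R z) z :=
      P.continuous.continuousAt.div (hRan.continuousOn.continuousAt hn) (hRne z hz hj)
    refine h1.congr ?_
    filter_upwards [hn] with y hy using (hω y hy).symm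
  have hup : ∀ x : ℝ, (∀ i ≤ 2 * g + 1, x ≠ a i) →
      Tendsto (fun ε : ℝ => ω (x + ((1 * ε : ℝ) : ℂ) * I)) (nhdsWithin 0 (Ioi 0)) (nhds (ωp x)) :=
    fun x hx => (hωp x hx).comp (vert_up x)
  have hdown : ∀ x : ℝ, (∀ i ≤ 2 * g + 1, x ≠ a i) →
      Tendsto (fun ε : ℝ => ω (x + ((-1 * ε : ℝ) : ℂ) * I)) (nhdsWithin 0 (Ioi 0))
        (nhds (wm x)) := by
    intro x hx
    have := (lower_limit (2 * g + 2) a R ω P hRsq' hsymm hω' x (hp0 x hx) (ωp x) (hωp x hx)).comp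
      (vert_up x)
    refine this.congr fun ε => ?_
    rw [vert_conj]; rfl
  have hlinecont : ∀ σ : ℝ, σ ≠ 0 → ∀ ε : ℝ, 0 < ε →
      Continuous (fun t : ℝ => ω (t + ((σ * ε : ℝ) : ℂ) * I)) := by
    intro σ hσ ε hε
    rw [continuous_iff_continuousAt]
    intro t
    have him : ((t : ℂ) + ((σ * ε : ℝ) : ℂ) * I).im ≠ 0 := by
      have : σ * ε ≠ 0 := mul_ne_zero hσ hε.ne'
      simpa using this
    exact ContinuousAt.comp (f := fun t : ℝ => (t : ℂ) + ((σ * ε : ℝ) : ℂ) * I)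
      (hωc _ (hoff _ him) (hbranch _ him)) (by fun_prop)
  have hlineder : ∀ σ : ℝ, σ ≠ 0 → ∀ ε : ℝ, 0 < ε → ∀ t : ℝ,
      HasDerivAt 𝔤 (-2 * ω (t + ((σ * ε : ℝ) : ℂ) * I)) (t + ((σ * ε : ℝ) : ℂ) * I) := by
    intro σ hσ ε hε t
    refine h𝔤deriv _ (hoffc _ ?_)
    have : σ * ε ≠ 0 := mul_ne_zero hσ hε.ne'
    simpa using this
  have hinj : ∀ i < 2 * g + 2, ∀ j < 2 * g + 2, a i = a j → i = j := by
    intro i hi j hj hij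
    rcases lt_trichotomy i j with h | h | h
    · exact absurd hij (m i j h (by omega)).ne
    · exact h
    · exact absurd hij (m j i h (by omega)).ne'
  have hbound : ∀ x y : ℝ, ∃ B : ℝ → ℝ, IntervalIntegrable B MeasureTheory.volume x y ∧
      ∀ σ : ℝ, |σ| = 1 → ∀ ε : ℝ, 0 < ε → ε < 1 →
      ∀ᵐ t : ℝ, t ∈ uIoc x y → ‖ω (t + ((σ * ε : ℝ) : ℂ) * I)‖ ≤ B t := by
    intro x y
    obtain ⟨B, hB, hB2⟩ := omega_bound (2 * g + 2) (by omega) a hinj R ω P hRsq' hω' x y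
    refine ⟨B, hB, fun σ hσ ε hε hε1 => hB2 (σ * ε) (mul_ne_zero ?_ hε.ne') ?_⟩
    · rintro rfl; simp at hσ
    · rw [abs_mul, hσ, one_mul, abs_of_pos hε]; exact hε1.le
  have hintp : ∀ x y : ℝ, IntervalIntegrable ωp MeasureTheory.volume x y := by
    intro x y
    obtain ⟨B, hB, hB2⟩ := hbound x y
    exact boundary_integrable ω ωp 1 x y B (hlinecont 1 (by norm_num)) hB (hB2 1 (by norm_num))
      (hae.mono hup)
  have hintm : ∀ x y : ℝ, IntervalIntegrable wm MeasureTheory.volume x y := by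
    intro x y
    obtain ⟨B, hB, hB2⟩ := hbound x y
    exact boundary_integrable ω wm (-1) x y B (hlinecont (-1) (by norm_num)) hB
      (hB2 (-1) (by norm_num)) (hae.mono hdown)
  have hftcp : ∀ x y : ℝ, (∀ i ≤ 2 * g + 1, x ≠ a i) → (∀ i ≤ 2 * g + 1, y ≠ a i) →
      𝔤p y - 𝔤p x = -2 * ∫ t in x..y, ωp t := by
    intro x y hx hy
    obtain ⟨B, hB, hB2⟩ := hbound x y
    exact boundary_ftc ω 𝔤 ωp 1 x y _ _ B (hlineder 1 (by norm_num)) (hlinecont 1 (by norm_num)) hB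
      (hB2 1 (by norm_num)) (hae.mono hup) ((h𝔤p x hx).comp (vert_up x))
      ((h𝔤p y hy).comp (vert_up y))
  have hftcm : ∀ x y : ℝ, (∀ i ≤ 2 * g + 1, x ≠ a i) → (∀ i ≤ 2 * g + 1, y ≠ a i) →
      𝔤m y - 𝔤m x = -2 * ∫ t in x..y, wm t := by
    intro x y hx hy
    obtain ⟨B, hB, hB2⟩ := hbound x y
    exact boundary_ftc ω 𝔤 wm (-1) x y _ _ B (hlineder (-1) (by norm_num))
      (hlinecont (-1) (by norm_num)) hB
      (hB2 (-1) (by norm_num)) (hae.mono hdown) ((h𝔤m x hx).comp (vert_down x))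
      ((h𝔤m y hy).comp (vert_down y))
  -- off the cut both boundary values agree with the function
  have hout : ∀ x : ℝ, (x < a 0 ∨ a (2 * g + 1) < x) →
      (∀ i ≤ 2 * g + 1, x ≠ a i) ∧ 𝔤p x = 𝔤 x ∧ 𝔤m x = 𝔤 x := by
    intro x hx
    have hgen : ∀ i ≤ 2 * g + 1, x ≠ a i := by
      rintro i hi rfl
      rcases hx with h | h
      · linarith [ml 0 i (by omega) hi]
      · linarith [ml i (2 * g + 1) hi le_rfl]
    have hxc : (x : ℂ) ∉ cut := by
      rw [hcut]
      rintro ⟨y, hy, hyx⟩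
      have : y = x := by exact_mod_cast hyx
      rw [this] at hy
      rcases hx with h | h
      · linarith [hy.1]
      · linarith [hy.2]
    have hc : Tendsto 𝔤 (nhds (x : ℂ)) (nhds (𝔤 x)) := (h𝔤deriv x hxc).continuousAt
    refine ⟨hgen, ?_, ?_⟩
    · exact tendsto_nhds_unique ((h𝔤p x hgen).comp (vert_up x))
        ((hc.mono_left nhdsWithin_le_nhds).comp (vert_up x))
    · exact tendsto_nhds_unique ((h𝔤m x hgen).comp (vert_down x))
        ((hc.mono_left nhdsWithin_le_nhds).comp (vert_down x))
  have hleft : ∀ f : ℝ → ℂ, (∀ x y : ℝ, IntervalIntegrable f MeasureTheory.volume x y) → ∀ x : ℝ,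
      Tendsto (fun t : ℝ => ∫ s in (a 0 - t)..x, f s) (nhdsWithin 0 (Ioi 0))
        (nhds (∫ s in (a 0)..x, f s)) := by
    intro f hf x
    have h1 := intervalIntegral.continuous_primitive hf x
    have h2 : Continuous (fun t : ℝ => ∫ s in (a 0 - t)..x, f s) := by
      have : Continuous (fun t : ℝ => - ∫ s in x..(a 0 - t), f s) :=
        (h1.comp (continuous_const.sub continuous_id)).neg
      refine this.congr fun t => ?_
      rw [intervalIntegral.integral_symm, neg_neg]
    have h3 := h2.tendsto 0
    simp only [sub_zero] at h3
    exact h3.mono_left nhdsWithin_le_nhds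
  have hvalp : ∀ x : ℝ, (∀ i ≤ 2 * g + 1, x ≠ a i) → 𝔤p x = 1 / 2 - 2 * ∫ t in (a 0)..x, ωp t := by
    intro x hx
    have h1 := h𝔤a1.add ((hleft ωp hintp x).const_mul (-2))
    rw [sub_eq_add_neg, ← neg_mul]
    refine tendsto_nhds_unique (tendsto_const_nhds.congr' ?_) h1
    filter_upwards [self_mem_nhdsWithin] with t ht
    have ht' : 0 < t := ht
    obtain ⟨o1, o2, o3⟩ := hout (a 0 - t) (Or.inl (by linarith))
    rw [← hftcp _ _ o1 hx, ← o2]; ring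
  have hvalm : ∀ x : ℝ, (∀ i ≤ 2 * g + 1, x ≠ a i) → 𝔤m x = 1 / 2 - 2 * ∫ t in (a 0)..x, wm t := by
    intro x hx
    have h1 := h𝔤a1.add ((hleft wm hintm x).const_mul (-2))
    rw [sub_eq_add_neg, ← neg_mul]
    refine tendsto_nhds_unique (tendsto_const_nhds.congr' ?_) h1
    filter_upwards [self_mem_nhdsWithin] with t ht
    have ht' : 0 < t := ht
    obtain ⟨o1, o2, o3⟩ := hout (a 0 - t) (Or.inl (by linarith))
    rw [← hftcm _ _ o1 hx, ← o3]; ring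
  -- the total integrals of the two boundary values agree
  have htot : ∫ t in (a 0)..(a (2 * g + 1)), ωp t = ∫ t in (a 0)..(a (2 * g + 1)), wm t := by
    have h1 := (intervalIntegral.continuous_primitive hintp (a 0)).tendsto (a (2 * g + 1))
    have h2 := (intervalIntegral.continuous_primitive hintm (a 0)).tendsto (a (2 * g + 1))
    have h1' := h1.mono_left (nhdsWithin_le_nhds (s := Ioi (a (2 * g + 1))))
    have h2' := h2.mono_left (nhdsWithin_le_nhds (s := Ioi (a (2 * g + 1))))
    refine tendsto_nhds_unique (h1'.congr' ?_) h2'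
    filter_upwards [self_mem_nhdsWithin] with x hx
    obtain ⟨o1, o2, o3⟩ := hout x (Or.inr hx)
    have e1 := hvalp x o1
    have e2 := hvalm x o1
    rw [o2] at e1
    rw [o3, e1] at e2
    linear_combination (-1 / 2 : ℂ) * e2
  -- behaviour on arcs and gaps
  have hwm_gap : ∀ k, k + 1 ≤ g → ∀ x ∈ Ioo (a (2 * k + 1)) (a (2 * k + 2)), wm x = ωp x := by
    intro k hk x hx
    have : 0 < p x := prod_pos_gap g a ha k hk x hx
    simp only [hwm]
    rw [sign_pos this]; simp
  have hwm_arc : ∀ k, k ≤ g → ∀ x ∈ Ioo (a (2 * k)) (a (2 * k + 1)), wm x = - ωp x := by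
    intro k hk x hx
    have : p x < 0 := prod_neg_arc g a ha k hk x hx
    simp only [hwm]
    rw [sign_neg this]; simp
  have hgen_gap : ∀ k, k + 1 ≤ g → ∀ x ∈ Ioo (a (2 * k + 1)) (a (2 * k + 2)),
      ∀ i ≤ 2 * g + 1, x ≠ a i := by
    rintro k hk x hx i hi rfl
    rcases le_or_gt i (2 * k + 1) with h | h
    · linarith [ml i (2 * k + 1) h (by omega), hx.1]
    · linarith [ml (2 * k + 2) i (by omega) (by omega), hx.2]
  have hgen_arc : ∀ k, k ≤ g → ∀ x ∈ Ioo (a (2 * k)) (a (2 * k + 1)),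
      ∀ i ≤ 2 * g + 1, x ≠ a i := by
    rintro k hk x hx i hi rfl
    rcases le_or_gt i (2 * k) with h | h
    · linarith [ml i (2 * k) h (by omega), hx.1]
    · linarith [ml (2 * k + 1) i (by omega) (by omega), hx.2]
  set h : ℝ → ℂ := fun x => ωp x + wm x with hh
  have hinth : ∀ x y : ℝ, IntervalIntegrable h MeasureTheory.volume x y :=
    fun x y => (hintp x y).add (hintm x y)
  have hsum : ∀ x : ℝ, (∀ i ≤ 2 * g + 1, x ≠ a i) → 𝔤p x + 𝔤m x = 1 - 2 * ∫ t in (a 0)..x, h t := by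
    intro x hx
    rw [hvalp x hx, hvalm x hx, hh, intervalIntegral.integral_add (hintp _ _) (hintm _ _)]
    ring
  have harc0 : ∀ k, k ≤ g → ∀ y ∈ Icc (a (2 * k)) (a (2 * k + 1)),
      ∫ t in (a (2 * k))..y, h t = 0 := by
    intro k hk y hy
    have : ∫ t in (a (2 * k))..y, h t = ∫ t in (a (2 * k))..y, (0 : ℂ) := by
      refine intervalIntegral.integral_congr_Ioo_of_le hy.1 fun t ht => ?_
      simp only [hh]
      rw [hwm_arc k hk t ⟨ht.1, ht.2.trans_le hy.2⟩]; ring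
    rw [this]; simp
  have hgap : ∀ k, k + 1 ≤ g → ∫ t in (a (2 * k + 1))..(a (2 * k + 2)), h t =
      2 * ∫ t in (a (2 * k + 1))..(a (2 * k + 2)), ωp t := by
    intro k hk
    rw [← intervalIntegral.integral_const_mul]
    refine intervalIntegral.integral_congr_Ioo_of_le (ml _ _ (by omega) (by omega)) fun t ht => ?_
    simp only [hh]
    rw [hwm_gap k hk t ht]; ring
  have hJ : ∀ k, k + 1 ≤ g → ∫ t in (a 0)..(a (2 * (k + 1))), h t =
      (∫ t in (a 0)..(a (2 * k)), h t) + 2 * ∫ t in (a (2 * k + 1))..(a (2 * k + 2)), ωp t := by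
    intro k hk
    rw [← hgap k hk, show 2 * (k + 1) = 2 * k + 2 by ring,
      ← intervalIntegral.integral_add_adjacent_intervals (hinth (a 0) (a (2 * k))) (hinth _ _),
      ← intervalIntegral.integral_add_adjacent_intervals (hinth (a (2 * k)) (a (2 * k + 1)))
        (hinth _ _),
      harc0 k (by omega) _ ⟨ml _ _ (by omega) (by omega), le_rfl⟩, zero_add]
  have hJ1 : ∀ k, 1 ≤ k → k ≤ g - 1 → ∫ t in (a 0)..(a (2 * k)), h t = 1 := by
    intro k hk
    induction k, hk using Nat.le_induction with
    | base =>
      intro hk1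
      have e := hJ 0 (by omega)
      have e2 := hnorm 0 (by omega)
      rw [if_pos (by omega), if_pos rfl] at e2
      rw [e2] at e
      simpa using e
    | succ k hk ih =>
      intro hk1
      have e2 := hnorm k (by omega)
      rw [if_pos (by omega), if_neg (by omega)] at e2
      rw [hJ k (by omega), e2, ih (by omega), add_zero]
  have hJg : ∫ t in (a 0)..(a (2 * g)), h t = 0 := by
    have e1 := intervalIntegral.integral_add_adjacent_intervals (hinth (a 0) (a (2 * g)))
      (hinth (a (2 * g)) (a (2 * g + 1)))
    rw [harc0 g le_rfl _ ⟨ml _ _ (by omega) (by omega), le_rfl⟩, add_zero] at e1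
    have e2 := hnorm (g - 1) le_rfl
    rw [if_neg (by omega), if_neg (by omega)] at e2
    rw [e1, hh, intervalIntegral.integral_add (hintp _ _) (hintm _ _), ← htot, ← two_mul, e2]
  have hval_arc : ∀ k, k ≤ g → ∀ x ∈ Ioo (a (2 * k)) (a (2 * k + 1)),
      𝔤p x + 𝔤m x = 1 - 2 * ∫ t in (a 0)..(a (2 * k)), h t := by
    intro k hk x hx
    rw [hsum x (hgen_arc k hk x hx),
      ← intervalIntegral.integral_add_adjacent_intervals (hinth (a 0) (a (2 * k))) (hinth _ x),
      harc0 k hk x ⟨hx.1.le, hx.2.le⟩, add_zero]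
  refine ⟨?_, ?_, ?_⟩
  · intro x hx
    have hU : ∀ y ∈ Ii, ∃ t ≤ g, y ∈ Icc (a (2 * t)) (a (2 * t + 1)) := by
      intro y hy
      rw [hIi] at hy
      simp only [mem_iUnion, Finset.mem_Icc] at hy
      obtain ⟨t, ht, hy⟩ := hy
      exact ⟨t, by omega, hy⟩
    have hx' := interior_subset hx
    rw [hIi] at hx'
    simp only [mem_iUnion, Finset.mem_Icc] at hx'
    obtain ⟨k, hk, hxk⟩ := hx'
    have hxo := interior_arc g a ha Ii hU x hx k (by omega) hxk
    rw [hval_arc k (by omega) x hxo, hJ1 k hk.1 hk.2]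
    norm_num
  · intro x hx
    have hU : ∀ y ∈ Ie, ∃ t ≤ g, y ∈ Icc (a (2 * t)) (a (2 * t + 1)) := by
      intro y hy
      rw [hIe] at hy
      rcases hy with hy | hy
      · exact ⟨0, by omega, by simpa using hy⟩
      · exact ⟨g, le_rfl, hy⟩
    have hx' := interior_subset hx
    rw [hIe] at hx'
    rcases hx' with hx' | hx'
    · have hxo := interior_arc g a ha Ie hU x hx 0 (by omega) (by simpa using hx')
      rw [hval_arc 0 (by omega) x hxo]
      simp
    · have hxo := interior_arc g a ha Ie hU x hx g le_rfl hx'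
      rw [hval_arc g le_rfl x hxo, hJg]
      simp
  · -- reality of the polynomial
    have hGim : ∀ k < g, (∫ x in (a (2 * k + 1))..(a (2 * k + 2)), ωp x).im = 0 := by
      intro k hk
      rcases Nat.lt_or_ge (k + 1) g with hk1 | hk1
      · have e2 := hnorm k (by omega)
        rw [if_pos (by omega)] at e2
        have e3 := congrArg Complex.im e2
        split_ifs at e3 <;> simpa using e3
      · have hkg : k = g - 1 := by omega
        have e := hJ k (by omega)
        rw [show k + 1 = g by omega, hJg, hJ1 k (by omega) (by omega)] at e
        have e3 := congrArg Complex.im e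
        simpa using e3
    have hgap_off : ∀ k < g, ∀ x ∈ Ioo (a (2 * k + 1)) (a (2 * k + 2)), (x : ℂ) ∉ arcs := by
      intro k hk x hx hmem
      rw [harcs] at hmem
      simp only [mem_iUnion, mem_image, Finset.mem_range] at hmem
      obtain ⟨t, ht, y, hy, hyx⟩ := hmem
      have : y = x := by exact_mod_cast hyx
      rw [this] at hy
      rcases le_or_gt t k with h1 | h1
      · linarith [ml (2 * t + 1) (2 * k + 1) (by omega) (by omega), hx.1, hy.2]
      · linarith [ml (2 * k + 2) (2 * t) (by omega) (by omega), hx.2, hy.1]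
    have hRcont : ∀ k < g, ∀ x ∈ Ioo (a (2 * k + 1)) (a (2 * k + 2)), ContinuousAt R (x : ℂ) :=
      fun k hk x hx => hRan.continuousOn.continuousAt
        (harcs_closed.isOpen_compl.mem_nhds (hgap_off k hk x hx))
    have hRreal : ∀ k < g, ∀ x ∈ Ioo (a (2 * k + 1)) (a (2 * k + 2)),
        R (x : ℂ) = ((R (x : ℂ)).re : ℂ) := by
      intro k hk x hx
      have hc : Tendsto R (nhds (x : ℂ)) (nhds (R x)) := hRcont k hk x hx
      have h1 := (hc.mono_left nhdsWithin_le_nhds).comp (vert_up x)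
      have h2 := (hc.mono_left nhdsWithin_le_nhds).comp (vert_down x)
      have h3 := (Complex.continuous_conj.tendsto _).comp h1
      have h4 : R x = starRingEnd ℂ (R x) := by
        refine tendsto_nhds_unique (h2.congr' ?_) h3
        filter_upwards [self_mem_nhdsWithin] with ε hε
        simp only [Function.comp_apply]
        rw [vert_conj, hsymm]
        simpa using hε
      exact (Complex.conj_eq_iff_re.1 h4.symm).symm
    have hRne_gap : ∀ k < g, ∀ x ∈ Ioo (a (2 * k + 1)) (a (2 * k + 2)), R (x : ℂ) ≠ 0 := by
      intro k hk x hx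
      refine hRne _ (hgap_off k hk x hx) fun j hj hxj => ?_
      exact hgen_gap k (by omega) x hx j (by omega) (by exact_mod_cast hxj)
    have hωp_gap : ∀ k < g, ∀ x ∈ Ioo (a (2 * k + 1)) (a (2 * k + 2)),
        ωp x = Polynomial.eval (x : ℂ) P / ((R (x : ℂ)).re : ℂ) := by
      intro k hk x hx
      have hgx := hgen_gap k (by omega) x hx
      rw [← hRreal k hk x hx, ← hω _ (hgap_off k hk x hx)]
      have hc : Tendsto ω (nhds (x : ℂ)) (nhds (ω x)) := by
        refine hωc _ (hgap_off k hk x hx) fun j hj hxj => ?_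
        exact hgx j (by omega) (by exact_mod_cast hxj)
      exact tendsto_nhds_unique (hup x hgx) ((hc.mono_left nhdsWithin_le_nhds).comp (vert_up x))
    have hPreal := poly_real P g (by omega) hPdeg (fun k => a (2 * k + 1)) (fun k => a (2 * k + 2))
      (fun k hk => m _ _ (by omega) (by omega))
      (fun i j hij hj => ml _ _ (by omega) (by omega)) (fun x => (R (x : ℂ)).re) ωp
      (fun k hk x hx => (Complex.continuous_re.continuousAt.comp
        ((hRcont k hk x hx).comp Complex.continuous_ofReal.continuousAt)).continuousWithinAt)
      (fun k hk x hx h0 => hRne_gap k hk x hx (by rw [hRreal k hk x hx, h0]; simp))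
      hωp_gap (fun k hk => hintp _ _) hGim
    -- the difference of boundary values of the differential is purely imaginary
    have hdre : ∀ x : ℝ, (∀ i ≤ 2 * g + 1, x ≠ a i) → (ωp x - wm x).re = 0 := by
      intro x hx
      rcases lt_or_gt_of_ne (hp0 x hx) with hneg | hpos
      · have hw1 : wm x = - ωp x := by
          simp only [hwm]; rw [sign_neg hneg]; simp
        have hsq : ωp x ^ 2 * (p x : ℂ) = (Polynomial.eval (x : ℂ) P) ^ 2 := by
          have hq : Continuous (fun z : ℂ => ∏ j ∈ Finset.range (2 * g + 2), (z - (a j : ℂ))) := by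
            fun_prop
          have h1 := ((hωp x hx).pow 2).mul ((hq.tendsto (x : ℂ)).mono_left
            (nhdsWithin_le_nhds (s := {z : ℂ | 0 < z.im})))
          have h2 := ((P.continuous.tendsto (x : ℂ)).pow 2).mono_left
            (nhdsWithin_le_nhds (s := {z : ℂ | 0 < z.im}))
          have hpx : (p x : ℂ) = ∏ j ∈ Finset.range (2 * g + 2), ((x : ℂ) - (a j : ℂ)) := by
            simp [hp]
          rw [hpx]
          have hnb : (nhdsWithin (x : ℂ) {z : ℂ | 0 < z.im}).NeBot := (vert_up x).neBot
          refine tendsto_nhds_unique (h1.congr' ?_) h2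
          filter_upwards [self_mem_nhdsWithin] with z hz
          have hz' : z.im ≠ 0 := ne_of_gt hz
          rw [hω' z hz', ← hRsq' z hz']
          have := hRne z (hoff z hz') (hbranch z hz')
          field_simp
        have hPx : Polynomial.eval (x : ℂ) P = ((Polynomial.eval (x : ℂ) P).re : ℂ) :=
          Complex.ext (by simp) (by simp [hPreal x])
        rw [hPx] at hsq
        have er := congrArg Complex.re hsq
        have ei := congrArg Complex.im hsq
        rw [← Complex.ofReal_pow] at er ei
        rw [Complex.re_mul_ofReal, Complex.ofReal_re, sq, Complex.mul_re] at er
        rw [Complex.im_mul_ofReal, Complex.ofReal_im, sq, Complex.mul_im] at ei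
        have ei' := (mul_eq_zero.1 ei).resolve_right hneg.ne
        have hre : (ωp x).re = 0 := by
          by_contra hne
          have him : (ωp x).im = 0 := by
            have : (ωp x).re * (ωp x).im = 0 := by linarith
            exact (mul_eq_zero.1 this).resolve_left hne
          rw [him] at er
          have h5 : 0 < (ωp x).re * (ωp x).re := mul_self_pos.2 hne
          nlinarith [sq_nonneg (Polynomial.eval (x : ℂ) P).re, mul_neg_of_pos_of_neg h5 hneg]
        rw [hw1]; simp [hre]
      · have hw1 : wm x = ωp x := by
          simp only [hwm]; rw [sign_pos hpos]; simp
        rw [hw1]; simp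
    have hintd : ∀ x y : ℝ, IntervalIntegrable (fun t => ωp t - wm t) MeasureTheory.volume x y :=
      fun x y => (hintp x y).sub (hintm x y)
    have hdval : ∀ x : ℝ, (∀ i ≤ 2 * g + 1, x ≠ a i) →
        𝔤p x - 𝔤m x = -2 * ∫ t in (a 0)..x, (ωp t - wm t) := by
      intro x hx
      rw [hvalp x hx, hvalm x hx, intervalIntegral.integral_sub (hintp _ _) (hintm _ _)]
      ring
    have hdint : ∀ x : ℝ, (∫ t in (a 0)..x, (ωp t - wm t)).re = 0 := by
      intro x
      have e := Complex.reCLM.intervalIntegral_comp_comm (hintd (a 0) x)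
      simp only [Complex.reCLM_apply] at e
      rw [← e]
      refine intervalIntegral.integral_zero_ae ?_
      filter_upwards [hae] with t ht _ using hdre t ht
    intro k hk
    have hk' : k + 1 ≤ g := by omega
    have hlt : a (2 * k + 1) < a (2 * k + 2) := m _ _ (by omega) (by omega)
    refine ⟨(-2 * ∫ t in (a 0)..(a (2 * k + 1)), (ωp t - wm t)).im, fun x hx => ?_⟩
    have hz : ∫ t in (a (2 * k + 1))..x, (ωp t - wm t) = 0 := by
      have : ∫ t in (a (2 * k + 1))..x, (ωp t - wm t) = ∫ t in (a (2 * k + 1))..x, (0 : ℂ) := by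
        refine intervalIntegral.integral_congr_Ioo_of_le hx.1.le fun t ht => ?_
        rw [hwm_gap k hk' t ⟨ht.1, ht.2.trans hx.2⟩, sub_self]
      rw [this]; simp
    rw [hdval x (hgen_gap k hk' x hx),
      ← intervalIntegral.integral_add_adjacent_intervals (hintd (a 0) (a (2 * k + 1))) (hintd _ x),
      hz, add_zero]
    have hre := hdint (a (2 * k + 1))
    apply Complex.ext
    · simp [hre]
    · simp
end

section
/- Sign of Im ω_1 on the arcs: the normalized first holomorphic differential ω_1 = P_1(z)/R(z) satisfies Im ω_{1,+}(z) > 0 for z in the interior of I_i and Im ω_{1,+}(z) < 0 for z in the interior of I_e, where the subscript + denotes the boundary value from the upper half-plane. -/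
open Complex Set Filter

/-- principal square root -/
noncomputable def csq (z : ℂ) : ℂ := z ^ (((2 : ℕ) : ℂ)⁻¹)

lemma csq_pow (z : ℂ) : csq z ^ 2 = z := Complex.cpow_nat_inv_pow z two_ne_zero

lemma norm_sq' (z : ℂ) : ‖csq z‖ = Real.sqrt ‖z‖ := by
  rw [eq_comm, Real.sqrt_eq_iff_mul_self_eq (norm_nonneg _) (norm_nonneg _)]
  rw [← pow_two, ← norm_pow, csq_pow]

lemma csq_ne {z : ℂ} (hz : z ≠ 0) : csq z ≠ 0 := by
  intro h
  apply hz
  rw [← csq_pow z, h]; simp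

lemma csq_eq_exp {z : ℂ} (hz : z ≠ 0) : csq z = exp (log z / 2) := by
  unfold csq
  rw [cpow_def_of_ne_zero hz]
  norm_num [div_eq_mul_inv]

lemma csq_mul {y : ℝ} (hy : 0 < y) {w : ℂ} (hw : w ≠ 0) :
    csq (y * w) = (Real.sqrt y : ℂ) * csq w := by
  rw [csq_eq_exp (by simp [hy.ne', hw]), csq_eq_exp hw, Complex.log_ofReal_mul hy hw,
    Real.sqrt_eq_rpow, Real.rpow_def_of_pos hy]
  push_cast
  rw [← Complex.exp_add]
  congr 1
  ring

lemma csq_one : csq 1 = 1 := by unfold csq; simp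

lemma csq_pos {x : ℝ} (hx : 0 < x) : csq (x : ℂ) = (Real.sqrt |x| : ℂ) := by
  have := csq_mul hx (w := 1) one_ne_zero
  rw [abs_of_pos hx]
  simpa [csq_one] using this

lemma csq_neg_one : csq (-1) = I := by
  rw [csq_eq_exp (by simp), Complex.log_neg_one, mul_div_right_comm, Complex.exp_mul_I]
  simp

lemma csq_neg {x : ℝ} (hx : x < 0) : csq (x : ℂ) = I * (Real.sqrt |x| : ℂ) := by
  have := csq_mul (neg_pos.2 hx) (w := -1) (by simp)
  rw [abs_of_neg hx, mul_comm, ← csq_neg_one, ← this]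
  simp

lemma csq_contWithin {x : ℝ} (hx : x ≠ 0) : ContinuousWithinAt csq {z : ℂ | 0 ≤ z.im} (x : ℂ) := by
  have hx' : (x : ℂ) ≠ 0 := by exact_mod_cast hx
  have h1 : ContinuousWithinAt log {z : ℂ | 0 ≤ z.im} (x : ℂ) := by
    rcases lt_or_gt_of_ne hx with h | h
    · exact continuousWithinAt_log_of_re_neg_of_im_zero (by simpa using h) (by simp)
    · exact (continuousAt_clog (by simp [h])).continuousWithinAt
  have h2 : ContinuousWithinAt (fun z => exp (log z / 2)) {z : ℂ | 0 ≤ z.im} (x : ℂ) :=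
    (h1.div_const 2).cexp
  refine h2.congr_of_eventuallyEq ?_ (csq_eq_exp hx')
  filter_upwards [mem_nhdsWithin_of_mem_nhds (isOpen_ne.mem_nhds hx')] with z hz
  exact csq_eq_exp hz

lemma csq_diff {z : ℂ} (hz : 0 < z.im) : DifferentiableAt ℂ csq z := by
  unfold csq
  exact (differentiableAt_id).cpow_const (Or.inr hz.ne')

lemma uhp_preconn : IsPreconnected {z : ℂ | 0 < z.im} :=
  (convex_halfSpace_im_gt 0).isPreconnected

/-- identification of `R` in the upper half plane -/
lemma R_eq (g : ℕ) (a : ℕ → ℝ) (R : ℂ → ℂ)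
    (hRan : ContinuousOn R {z : ℂ | 0 < z.im})
    (hRsq : ∀ z : ℂ, 0 < z.im → R z ^ 2 = ∏ j ∈ Finset.range (2 * g + 2), (z - (a j : ℂ)))
    (hRinf : Tendsto (fun z : ℂ => R z / z ^ (g + 1)) (cocompact ℂ) (nhds 1))
    {z : ℂ} (hz : 0 < z.im) : R z = ∏ j ∈ Finset.range (2 * g + 2), csq (z - (a j : ℂ)) := by
  set S : ℂ → ℂ := fun z => ∏ j ∈ Finset.range (2 * g + 2), csq (z - (a j : ℂ)) with hS
  have hSc : ContinuousOn S {z : ℂ | 0 < z.im} := by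
    apply continuousOn_finsetProd
    intro j _ w hw
    have h1 : ContinuousAt csq (w - (a j : ℂ)) := (csq_diff (by simpa using hw)).continuousAt
    exact (ContinuousAt.comp (f := fun z : ℂ => z - (a j : ℂ)) h1
      (by fun_prop)).continuousWithinAt
  have hSsq : ∀ w, S w ^ 2 = ∏ j ∈ Finset.range (2 * g + 2), (w - (a j : ℂ)) := by
    intro w
    simp only [hS]
    rw [← Finset.prod_pow]
    exact Finset.prod_congr rfl (fun j _ => csq_pow _)
  have hSne : ∀ w : ℂ, 0 < w.im → S w ≠ 0 := by
    intro w hw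
    refine Finset.prod_ne_zero_iff.2 fun j _ => csq_ne ?_
    intro h
    have := congrArg Complex.im h
    simp at this
    exact hw.ne' this
  have key := uhp_preconn.eq_or_eq_neg_of_sq_eq hRan hSc
    (fun w hw => by simp [hRsq w hw, hSsq w]) (fun {w} hw => hSne w hw)
  -- limit along the imaginary axis
  have hline : Tendsto (fun y : ℝ => (y : ℂ) * I) atTop (cocompact ℂ) := by
    rw [← Metric.cobounded_eq_cocompact, ← tendsto_norm_atTop_iff_cobounded]
    refine tendsto_id.congr' ?_
    filter_upwards [eventually_gt_atTop 0] with y hy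
    simp [abs_of_pos hy]
  have hSlim : Tendsto (fun y : ℝ => S ((y : ℂ) * I) / ((y : ℂ) * I) ^ (g + 1)) atTop (nhds 1) := by
    have h1 : Tendsto (fun y : ℝ => (∏ j ∈ Finset.range (2 * g + 2), csq (I - ((a j / y : ℝ) : ℂ)))
        / I ^ (g + 1)) atTop
        (nhds ((∏ j ∈ Finset.range (2 * g + 2), csq (I - ((0 : ℝ) : ℂ))) / I ^ (g + 1))) := by
      refine Tendsto.div_const (tendsto_finsetProd _ fun j _ => ?_) _
      have hc : ContinuousAt csq (I - ((0 : ℝ) : ℂ)) := (csq_diff (by simp)).continuousAt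
      refine hc.tendsto.comp (tendsto_const_nhds.sub ?_)
      exact (continuous_ofReal.tendsto 0).comp (tendsto_const_nhds.div_atTop tendsto_id)
    have h2 : (∏ j ∈ Finset.range (2 * g + 2), csq (I - ((0 : ℝ) : ℂ))) / I ^ (g + 1) = 1 := by
      rw [Finset.prod_const, Finset.card_range, show 2 * g + 2 = 2 * (g + 1) by ring, pow_mul,
        csq_pow]
      simp
    rw [h2] at h1
    refine h1.congr' ?_
    filter_upwards [eventually_gt_atTop 0] with y hy
    have hyc : (y : ℂ) ≠ 0 := by exact_mod_cast hy.ne'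
    have h3 : ∀ j, csq ((y : ℂ) * I - (a j : ℂ)) =
        (Real.sqrt y : ℂ) * csq (I - ((a j / y : ℝ) : ℂ)) := by
      intro j
      rw [← csq_mul hy]
      · congr 1
        push_cast
        field_simp
      · intro h
        have := congrArg Complex.im h
        simp at this
    simp only [hS, h3]
    rw [Finset.prod_mul_distrib, Finset.prod_const, Finset.card_range,
      show 2 * g + 2 = 2 * (g + 1) by ring, pow_mul, mul_pow]
    have h4 : ((Real.sqrt y : ℂ)) ^ 2 = y := by
      exact_mod_cast Real.sq_sqrt hy.le
    rw [h4]
    field_simp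
  rcases key with h | h
  · exact h hz
  · exfalso
    have h5 := (hRinf.comp hline).add hSlim
    have h6 : Tendsto (fun _ : ℝ => (0 : ℂ)) atTop (nhds (1 + 1)) := by
      refine h5.congr' ?_
      filter_upwards [eventually_gt_atTop 0] with y hy
      have : R ((y : ℂ) * I) = - S ((y : ℂ) * I) := h (by simp [hy])
      simp only [Function.comp, this]
      ring
    have := tendsto_nhds_unique h6 tendsto_const_nhds
    norm_num at this

lemma intble_sqrt_inv (A B : ℝ) :
    IntervalIntegrable (fun x : ℝ => (Real.sqrt |x|)⁻¹) MeasureTheory.volume A B := by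
  have h0 : ∀ c : ℝ, 0 ≤ c →
      IntervalIntegrable (fun x : ℝ => (Real.sqrt |x|)⁻¹) MeasureTheory.volume 0 c := by
    intro c hc
    have h := intervalIntegral.intervalIntegrable_rpow' (a := 0) (b := c) (r := -(1/2)) (by norm_num)
    refine h.congr ?_
    intro x hx
    rw [uIoc_of_le hc] at hx
    simp only
    rw [abs_of_pos hx.1, Real.rpow_neg hx.1.le, Real.sqrt_eq_rpow]
  have h1 : ∀ c : ℝ, IntervalIntegrable (fun x : ℝ => (Real.sqrt |x|)⁻¹) MeasureTheory.volume 0 c := by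
    intro c
    rcases le_total 0 c with h | h
    · exact h0 c h
    · have := (IntervalIntegrable.iff_comp_neg (by simp)).1 (h0 (-c) (by linarith))
      simpa using this
  exact (h1 A).symm.trans (h1 B)

lemma locInt_H (s : Finset ℕ) (a : ℕ → ℝ) (ha : Set.InjOn a s) :
    MeasureTheory.LocallyIntegrable (fun x : ℝ => (∏ j ∈ s, Real.sqrt |x - a j|)⁻¹)
      MeasureTheory.volume := by
  have hmeas : ∀ t : Finset ℕ, Measurable (fun x : ℝ => (∏ j ∈ t, Real.sqrt |x - a j|)⁻¹) := by
    intro t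
    apply Measurable.inv
    apply Continuous.measurable
    fun_prop
  have hK : ∀ (t : Finset ℕ) (x : ℝ), (∀ j ∈ t, x ≠ a j) → 
      ContinuousAt (fun x : ℝ => (∏ j ∈ t, Real.sqrt |x - a j|)⁻¹) x := by
    intro t x hx
    apply ContinuousAt.inv₀
    · fun_prop
    · refine Finset.prod_ne_zero_iff.2 fun j hj => ?_
      have : 0 < |x - a j| := abs_pos.2 (sub_ne_zero.2 (hx j hj))
      exact (Real.sqrt_pos.2 this).ne'
  intro x
  by_cases hx : ∀ j ∈ s, x ≠ a j
  · exact (MeasureTheory.Measure.finiteAt_nhds _ x).integrableAtFilter_of_tendsto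
      ⟨univ, univ_mem, (hmeas s).aestronglyMeasurable⟩ (hK s x hx).tendsto
  · push Not at hx
    obtain ⟨j, hj, rfl⟩ := hx
    have hc := hK (s.erase j) (a j) (fun i hi h => (Finset.mem_erase.1 hi).1
      (ha (Finset.mem_erase.1 hi).2 hj h.symm))
    obtain ⟨C, hC⟩ : ∃ C, ∀ᶠ x in nhds (a j),
        ‖(∏ j ∈ s.erase j, Real.sqrt |x - a j|)⁻¹‖ ≤ C :=
      ⟨_, hc.norm.eventually_le_const (lt_add_one _) |>.mono fun _ h => h⟩
    obtain ⟨e, he, hball⟩ := Metric.eventually_nhds_iff_ball.1 hC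
    refine ⟨Ioo (a j - e) (a j + e), Ioo_mem_nhds (by linarith) (by linarith), ?_⟩
    have h1 : MeasureTheory.IntegrableOn (fun x : ℝ => C * (Real.sqrt |x - a j|)⁻¹) 
        (Ioo (a j - e) (a j + e)) MeasureTheory.volume := by
      have h2 := ((intble_sqrt_inv (- e) e).comp_sub_right (a j)).const_mul C
      have h3 := (intervalIntegrable_iff_integrableOn_Ioo_of_le (by linarith)).1 h2
      rw [show a j - e = -e + a j by ring, show a j + e = e + a j by ring]
      exact h3
    refine MeasureTheory.Integrable.mono' h1 (hmeas s).aestronglyMeasurable ?_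
    refine (MeasureTheory.ae_restrict_iff' measurableSet_Ioo).2 (Eventually.of_forall ?_)
    intro y hy
    have h4 := hball y (by rw [Real.ball_eq_Ioo]; exact hy)
    rw [← Finset.mul_prod_erase s _ hj, mul_inv, norm_mul, mul_comm]
    have : ‖(Real.sqrt |y - a j|)⁻¹‖ = (Real.sqrt |y - a j|)⁻¹ := by
      rw [Real.norm_of_nonneg]; positivity
    rw [this]
    gcongr

lemma contour (f : ℂ → ℂ) (fp : ℝ → ℂ) (h : ℝ → ℝ)
    (hf : DifferentiableOn ℂ f {z : ℂ | 0 < z.im})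
    (hh : MeasureTheory.LocallyIntegrable h MeasureTheory.volume)
    (T : Set ℝ) (hT : T.Countable)
    (hb : ∀ M : ℝ, ∃ K : ℝ, ∀ x ∈ Icc (-M) M, x ∉ T → (∀ ε ∈ Ioo (0 : ℝ) 1, ‖f (x + ε * I)‖ ≤ K * h x))
    (C M0 : ℝ) (hC : ∀ z : ℂ, 0 < z.im → M0 ≤ ‖z‖ → ‖f z‖ ≤ C / ‖z‖ ^ 2)
    (hlim : ∀ x : ℝ, x ∉ T → Tendsto f (nhdsWithin (x : ℂ) {z : ℂ | 0 < z.im}) (nhds (fp x))) :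
    Tendsto (fun M : ℝ => ∫ x in (-M)..M, fp x) atTop (nhds 0) := by
  have hshift : ∀ x : ℝ, Tendsto (fun ε : ℝ => (x : ℂ) + ε * I) (nhdsWithin 0 (Ioi 0))
      (nhdsWithin (x : ℂ) {z : ℂ | 0 < z.im}) := by
    intro x
    refine tendsto_nhdsWithin_iff.2 ⟨?_, ?_⟩
    · have : Continuous (fun ε : ℝ => (x : ℂ) + ε * I) := by fun_prop
      have h1 := this.tendsto 0
      simp only [ofReal_zero, zero_mul, add_zero] at h1
      exact h1.mono_left nhdsWithin_le_nhds
    · filter_upwards [self_mem_nhdsWithin] with ε hε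
      simpa using hε
  have hmain : ∀ M : ℝ, max M0 1 ≤ M → ‖∫ x in (-M)..M, fp x‖ ≤ 4 * |C| / M := by
    intro M hM
    have hM0 : M0 ≤ M := le_trans (le_max_left _ _) hM
    have hM1 : 1 ≤ M := le_trans (le_max_right _ _) hM
    have hMp : 0 < M := by linarith
    obtain ⟨K, hK⟩ := hb M
    have hconv : Tendsto (fun ε : ℝ => ∫ x in (-M)..M, f (x + ε * I)) (nhdsWithin 0 (Ioi 0))
        (nhds (∫ x in (-M)..M, fp x)) := by
      apply intervalIntegral.tendsto_integral_filter_of_dominated_convergence (fun x => K * h x)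
      · filter_upwards [self_mem_nhdsWithin] with ε hε
        apply Continuous.aestronglyMeasurable
        refine hf.continuousOn.comp_continuous (by fun_prop) ?_
        intro x
        simpa using hε
      · filter_upwards [Ioo_mem_nhdsGT (zero_lt_one' ℝ)] with ε hε
        filter_upwards [hT.ae_notMem MeasureTheory.volume] with x hxT hx
        rw [uIoc_of_le (by linarith)] at hx
        exact hK x (Ioc_subset_Icc_self hx) hxT ε hε
      · exact ((hh.integrableOn_isCompact isCompact_uIcc).intervalIntegrable (a := -M) (b := M)).const_mul K
      · filter_upwards [hT.ae_notMem MeasureTheory.volume] with x hx _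
        exact (hlim x hx).comp (hshift x)
    refine le_of_tendsto hconv.norm ?_
    filter_upwards [Ioo_mem_nhdsGT (zero_lt_one' ℝ)] with ε hε
    have hrect := Complex.integral_boundary_rect_eq_zero_of_differentiableOn f
      (-M + ε * I) (M + M * I) (hf.mono (by
        intro z hz
        have hz2 := hz.2
        simp at hz2
        rw [uIcc_of_le (by linarith [hε.2])] at hz2
        exact lt_of_lt_of_le hε.1 hz2.1))
    simp at hrect
    have hbd : ∀ z : ℂ, 0 < z.im → M ≤ ‖z‖ → ‖f z‖ ≤ |C| / M ^ 2 := by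
      intro z hz hz2
      calc ‖f z‖ ≤ C / ‖z‖ ^ 2 := hC z hz (hM0.trans hz2)
        _ ≤ |C| / ‖z‖ ^ 2 := by gcongr; exact le_abs_self C
        _ ≤ _ := by gcongr
    have h1 : ‖∫ x in (-M)..M, f (x + M * I)‖ ≤ |C| / M ^ 2 * |M - (-M)| := by
      apply intervalIntegral.norm_integral_le_of_norm_le_const
      intro x _
      apply hbd
      · simpa using hMp
      · have := Complex.abs_im_le_norm ((x : ℂ) + M * I)
        simp [abs_of_pos hMp] at this
        exact this
    have h2 : ‖∫ y in ε..M, f (M + y * I)‖ ≤ |C| / M ^ 2 * |M - ε| := by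
      apply intervalIntegral.norm_integral_le_of_norm_le_const
      intro y hy
      rw [uIoc_of_le (by linarith [hε.2])] at hy
      apply hbd
      · simpa using hε.1.trans hy.1
      · have := Complex.abs_re_le_norm ((M : ℂ) + y * I)
        simp [abs_of_pos hMp] at this
        exact this
    have h3 : ‖∫ y in ε..M, f (-M + y * I)‖ ≤ |C| / M ^ 2 * |M - ε| := by
      apply intervalIntegral.norm_integral_le_of_norm_le_const
      intro y hy
      rw [uIoc_of_le (by linarith [hε.2])] at hy
      apply hbd
      · simpa using hε.1.trans hy.1
      · have := Complex.abs_re_le_norm (-(M : ℂ) + y * I)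
        simp [abs_of_pos hMp] at this
        exact this
    have h4 : (∫ x in (-M)..M, f (x + ε * I)) = (∫ x in (-M)..M, f (x + M * I))
        - I * (∫ y in ε..M, f (M + y * I)) + I * (∫ y in ε..M, f (-M + y * I)) := by
      linear_combination hrect
    rw [h4]
    rw [abs_of_nonneg (show 0 ≤ M - -M by linarith)] at h1
    rw [abs_of_nonneg (show 0 ≤ M - ε by linarith [hε.2])] at h2 h3
    have hq : 0 ≤ |C| / M ^ 2 := by positivity
    have h5 := norm_add_le ((∫ x in (-M)..M, f (x + M * I)) - I * (∫ y in ε..M, f (M + y * I)))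
      (I * (∫ y in ε..M, f (-M + y * I)))
    have h6 := norm_sub_le (∫ x in (-M)..M, f (x + M * I)) (I * (∫ y in ε..M, f (M + y * I)))
    rw [norm_mul, norm_I, one_mul] at h5 h6
    have h7 : 4 * |C| / M = |C| / M ^ 2 * (4 * M) := by field_simp
    rw [h7]
    have h8 : |C| / M ^ 2 * (M - ε) ≤ |C| / M ^ 2 * M :=
      mul_le_mul_of_nonneg_left (by linarith [hε.1]) hq
    linarith
  refine squeeze_zero_norm' (a := fun M : ℝ => 4 * |C| / M) ?_ ?_
  · filter_upwards [eventually_ge_atTop (max M0 1)] with M hM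
    exact hmain M hM
  · exact tendsto_const_nhds.div_atTop tendsto_id

lemma prod_sign (z : ℕ → ℝ) (x : ℝ) (m n : ℕ) (hmn : m ≤ n) (h1 : ∀ k < m, z k < x)
    (h2 : ∀ k, m ≤ k → k < n → x < z k) :
    0 < (-1 : ℝ) ^ (n - m) * ∏ k ∈ Finset.range n, (x - z k) := by
  induction n, hmn using Nat.le_induction with
  | base =>
    simp only [Nat.sub_self, pow_zero, one_mul]
    exact Finset.prod_pos fun k hk => sub_pos.2 (h1 k (Finset.mem_range.1 hk))
  | succ n hmn ih =>
    have h3 := ih (fun k hk hk' => h2 k hk (by omega))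
    have h4 := h2 n hmn (by omega)
    rw [Finset.prod_range_succ, show n + 1 - m = (n - m) + 1 by omega, pow_succ]
    have : (-1 : ℝ) ^ (n - m) * -1 * ((∏ k ∈ Finset.range n, (x - z k)) * (x - z n)) =
      ((-1 : ℝ) ^ (n - m) * ∏ k ∈ Finset.range n, (x - z k)) * (z n - x) := by ring
    rw [this]
    exact mul_pos h3 (sub_pos.2 h4)

lemma const_sign {f : ℝ → ℝ} {s : Set ℝ} (hs : IsPreconnected s) (hf : Continuous f)
    (h0 : ∀ x ∈ s, f x ≠ 0) : (∀ x ∈ s, 0 < f x) ∨ (∀ x ∈ s, f x < 0) := by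
  by_contra hcon
  push Not at hcon
  obtain ⟨⟨x, hx, hx'⟩, ⟨y, hy, hy'⟩⟩ := hcon
  obtain ⟨t, ht, ht'⟩ := hs.intermediate_value hx hy hf.continuousOn ⟨hx', hy'⟩
  exact h0 t ht ht'

lemma exists_zero {f w : ℝ → ℝ} {c d : ℝ} (hcd : c < d) (hf : Continuous f)
    (hw : ∀ x ∈ Ioo c d, 0 < w x)
    (hi : IntervalIntegrable (fun x => f x * w x) MeasureTheory.volume c d)
    (h0 : ∫ x in c..d, f x * w x = 0) : ∃ z ∈ Ioo c d, f z = 0 := by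
  by_contra hcon
  push Not at hcon
  rcases const_sign isPreconnected_Ioo hf hcon with h | h
  · have := intervalIntegral.intervalIntegral_pos_of_pos_on hi
      (fun x hx => mul_pos (h x hx) (hw x hx)) hcd
    linarith
  · have := intervalIntegral.intervalIntegral_pos_of_pos_on hi.neg
      (fun x hx => neg_pos.2 (mul_neg_of_neg_of_pos (h x hx) (hw x hx))) hcd
    simp only [Pi.neg_apply, intervalIntegral.integral_neg] at this
    linarith

lemma factor (p : Polynomial ℝ) (n : ℕ) (z : ℕ → ℝ) (hz : Set.InjOn z (Finset.range n))
    (hr : ∀ k ∈ Finset.range n, p.eval (z k) = 0) (hd : p.natDegree ≤ n + 1) :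
    ∃ α β : ℝ, ∀ x, p.eval x = (α * x + β) * ∏ k ∈ Finset.range n, (x - z k) := by
  by_cases hp : p = 0
  · exact ⟨0, 0, by simp [hp]⟩
  have hdvd : (∏ k ∈ Finset.range n, (Polynomial.X - Polynomial.C (z k))) ∣ p := by
    apply Finset.prod_dvd_of_coprime
    · intro i hi j hj hij
      apply Polynomial.isCoprime_X_sub_C_of_isUnit_sub
      exact (sub_ne_zero.2 fun h => hij (hz hi hj h)).isUnit
    · intro k hk
      exact Polynomial.dvd_iff_isRoot.2 (hr k hk)
  obtain ⟨L, hL⟩ := hdvd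
  have hL0 : L ≠ 0 := by rintro rfl; simp at hL; exact hp hL
  have hmon : (∏ k ∈ Finset.range n, (Polynomial.X - Polynomial.C (z k))).Monic :=
    Polynomial.monic_prod_of_monic _ _ fun k _ => Polynomial.monic_X_sub_C _
  have hdeg : p.natDegree = n + L.natDegree := by
    rw [hL, hmon.natDegree_mul' hL0, Polynomial.natDegree_prod_of_monic _ _
      (fun k _ => Polynomial.monic_X_sub_C _)]
    simp
  have hL1 : L.natDegree ≤ 1 := by omega
  refine ⟨L.coeff 1, L.coeff 0, fun x => ?_⟩
  have h3 : L.eval x = L.coeff 1 * x + L.coeff 0 := by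
    conv_lhs => rw [Polynomial.eq_X_add_C_of_natDegree_le_one hL1]
    simp
  conv_lhs => rw [hL]
  rw [Polynomial.eval_mul, h3, Polynomial.eval_prod]
  simp only [Polynomial.eval_sub, Polynomial.eval_X, Polynomial.eval_C]
  ring

lemma core (g : ℕ) (hg : 2 ≤ g) (a : ℕ → ℝ) (ham : ∀ i j, i < j → j ≤ 2 * g + 1 → a i < a j)
    (w : ℝ → ℝ) (hw : MeasureTheory.LocallyIntegrable w MeasureTheory.volume)
    (hwpos : ∀ x : ℝ, (∀ i ≤ 2 * g + 1, x ≠ a i) → 0 < w x)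
    (p : Polynomial ℝ) (hp : p.natDegree ≤ g - 1)
    (h1 : ∀ k < g - 2, ∫ x in (a (2 * (k + 1) + 1))..(a (2 * (k + 1) + 2)), p.eval x * w x = 0)
    (h2 : Tendsto (fun M : ℝ => (∫ x in (a (2 * g + 1))..M, p.eval x * w x) +
      (-1 : ℝ) ^ (g + 1) * ∫ x in (-M)..(a 0), p.eval x * w x) atTop (nhds 0)) :
    ∃ (z : ℕ → ℝ) (l : ℝ → ℝ),
      (∀ k < g - 2, z k ∈ Ioo (a (2 * (k + 1) + 1)) (a (2 * (k + 1) + 2))) ∧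
      (∀ x, p.eval x = l x * ∏ k ∈ Finset.range (g - 2), (x - z k)) ∧
      ((∀ x, l x = 0) ∨ (∀ x ∈ Icc (a 0) (a (2 * g + 1)), 0 < l x) ∨
        (∀ x ∈ Icc (a 0) (a (2 * g + 1)), l x < 0)) := by
  have hle : ∀ i j, i ≤ j → j ≤ 2 * g + 1 → a i ≤ a j := by
    intro i j hij hj
    rcases hij.eq_or_lt with rfl | h
    · exact le_rfl
    · exact (ham i j h hj).le
  have hInt : ∀ (c d : ℝ), IntervalIntegrable (fun x => p.eval x * w x) MeasureTheory.volume c d := by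
    intro c d
    exact ((hw.integrableOn_isCompact isCompact_uIcc).intervalIntegrable).continuousOn_mul
      p.continuous.continuousOn
  have hex : ∀ k, ∃ z, k < g - 2 → z ∈ Ioo (a (2 * (k + 1) + 1)) (a (2 * (k + 1) + 2)) ∧
      p.eval z = 0 := by
    intro k
    by_cases hk : k < g - 2
    · obtain ⟨z, hz, hz'⟩ := exists_zero (ham (2 * (k + 1) + 1) (2 * (k + 1) + 2) (by omega) (by omega))
        p.continuous (w := w) (by
          intro x hx
          apply hwpos
          rintro i hi rfl
          rcases Nat.lt_or_ge i (2 * (k + 1) + 2) with h | h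
          · exact absurd (hle i (2 * (k + 1) + 1) (by omega) (by omega)) (not_le.2 hx.1)
          · exact absurd (hle _ i h hi) (not_le.2 hx.2)) (hInt _ _) (h1 k hk)
      exact ⟨z, fun _ => ⟨hz, hz'⟩⟩
    · exact ⟨0, fun h => absurd h hk⟩
  choose z hz using hex
  have hzlt : ∀ i j, i < j → j < g - 2 → z i < z j := by
    intro i j hij hj
    have e1 := (hz i (by omega)).1.2
    have e2 := (hz j hj).1.1
    have e3 := hle (2 * (i + 1) + 2) (2 * (j + 1) + 1) (by omega) (by omega)
    linarith
  obtain ⟨α, β, hαβ⟩ := factor p (g - 2) z (by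
    intro i hi j hj hij
    simp only [Finset.coe_range, mem_Iio] at hi hj
    rcases lt_trichotomy i j with h | h | h
    · exact absurd hij (hzlt i j h hj).ne
    · exact h
    · exact absurd hij (hzlt j i h hi).ne') (fun k hk => (hz k (Finset.mem_range.1 hk)).2) (by omega)
  refine ⟨z, fun x => α * x + β, fun k hk => (hz k hk).1, hαβ, ?_⟩
  by_cases hne : ∀ x ∈ Icc (a 0) (a (2 * g + 1)), α * x + β ≠ 0
  · exact Or.inr (const_sign isPreconnected_Icc (by fun_prop) hne)
  push Not at hne
  obtain ⟨x0, hx0, hx0'⟩ := hne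
  by_cases hα : α = 0
  · left
    intro x
    subst hα
    simpa using hx0'
  exfalso
  have hl : ∀ x, α * x + β = α * (x - x0) := by intro x; linear_combination hx0'
  have hα2 : 0 < α ^ 2 := by positivity
  have hright : ∀ x, a (2 * g + 1) < x → 0 < α * (p.eval x * w x) := by
    intro x hx
    have e1 : 0 < w x := hwpos x (by
      rintro i hi rfl
      exact absurd (hle i _ hi le_rfl) (not_le.2 hx))
    have e2 : 0 < ∏ k ∈ Finset.range (g - 2), (x - z k) := by
      refine Finset.prod_pos fun k hk => sub_pos.2 ?_
      have hk := Finset.mem_range.1 hk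
      have := (hz k hk).1.2
      have := hle (2 * (k + 1) + 2) (2 * g + 1) (by omega) le_rfl
      linarith
    have e3 : 0 < x - x0 := by linarith [hx0.2]
    rw [hαβ, hl]
    have : α * (α * (x - x0) * (∏ k ∈ Finset.range (g - 2), (x - z k)) * w x) =
      α ^ 2 * ((x - x0) * (∏ k ∈ Finset.range (g - 2), (x - z k)) * w x) := by ring
    rw [this]
    positivity
  have hleft : ∀ x, x < a 0 → 0 < α * ((-1 : ℝ) ^ (g + 1) * (p.eval x * w x)) := by
    intro x hx
    have e1 : 0 < w x := hwpos x (by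
      rintro i hi rfl
      exact absurd (hle 0 i (by omega) hi) (not_le.2 hx))
    have e2 := prod_sign z x 0 (g - 2) (by omega) (by omega) (by
      intro k _ hk
      have := (hz k hk).1.1
      have := hle 0 (2 * (k + 1) + 1) (by omega) (by omega)
      linarith)
    have e3 : 0 < x0 - x := by linarith [hx0.1]
    rw [hαβ, hl]
    have e4 : (-1 : ℝ) ^ (g + 1) = - (-1 : ℝ) ^ (g - 2 - 0) := by
      obtain ⟨n, rfl⟩ : ∃ n, g = n + 2 := ⟨g - 2, by omega⟩
      simp only [Nat.add_sub_cancel, Nat.sub_zero]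
      ring
    have : α * ((-1 : ℝ) ^ (g + 1) * (α * (x - x0) * (∏ k ∈ Finset.range (g - 2), (x - z k)) * w x)) =
      α ^ 2 * ((x0 - x) * ((-1 : ℝ) ^ (g - 2 - 0) * ∏ k ∈ Finset.range (g - 2), (x - z k)) * w x) := by
      rw [e4]; ring
    rw [this]
    positivity
  have h3 := h2.const_mul α
  rw [mul_zero] at h3
  set b := a (2 * g + 1) with hb
  have hc := intervalIntegral.intervalIntegral_pos_of_pos_on ((hInt b (b + 1)).const_mul α)
      (fun x hx => hright x hx.1) (by linarith)
  have hge : ∀ᶠ M : ℝ in atTop, (∫ x in b..(b + 1), α * (p.eval x * w x)) ≤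
      α * ((∫ x in b..M, p.eval x * w x) + (-1 : ℝ) ^ (g + 1) * ∫ x in (-M)..(a 0), p.eval x * w x) := by
    filter_upwards [eventually_gt_atTop (b + 1), eventually_gt_atTop (- a 0)] with M hM1 hM2
    have f1 := intervalIntegral.intervalIntegral_pos_of_pos_on ((hInt (b + 1) M).const_mul α)
      (fun x hx => hright x (by linarith [hx.1])) hM1
    have f2 := intervalIntegral.intervalIntegral_pos_of_pos_on
      (((hInt (-M) (a 0)).const_mul ((-1 : ℝ) ^ (g + 1))).const_mul α)
      (fun x hx => hleft x hx.2) (by linarith)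
    have f3 := intervalIntegral.integral_add_adjacent_intervals (hInt b (b + 1)) (hInt (b + 1) M)
    simp only [intervalIntegral.integral_const_mul] at f1 f2 ⊢
    rw [← f3]
    linarith
  have := ge_of_tendsto h3 hge
  linarith

lemma csq_prod (a : ℕ → ℝ) (x : ℝ) (m n : ℕ) (hmn : m ≤ n) (h1 : ∀ k < m, a k < x)
    (h2 : ∀ k, m ≤ k → k < n → x < a k) :
    ∏ k ∈ Finset.range n, csq ((x : ℂ) - (a k : ℂ)) =
      I ^ (n - m) * ((∏ k ∈ Finset.range n, Real.sqrt |x - a k| : ℝ) : ℂ) := by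
  induction n, hmn using Nat.le_induction with
  | base =>
    simp only [Nat.sub_self, pow_zero, one_mul]
    push_cast
    refine Finset.prod_congr rfl fun k hk => ?_
    rw [← ofReal_sub, csq_pos (sub_pos.2 (h1 k (Finset.mem_range.1 hk)))]
  | succ n hmn ih =>
    have h3 := ih (fun k hk hk' => h2 k hk (by omega))
    have h4 := h2 n hmn (by omega)
    rw [Finset.prod_range_succ, h3, Finset.prod_range_succ,
      show n + 1 - m = (n - m) + 1 by omega, pow_succ, ← ofReal_sub, csq_neg (sub_neg.2 h4)]
    push_cast
    ring

lemma poly_split (P : Polynomial ℂ) (d : ℕ) (hP : P.natDegree ≤ d) :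
    ∃ p q : Polynomial ℝ, p.natDegree ≤ d ∧ q.natDegree ≤ d ∧
      ∀ x : ℝ, P.eval (x : ℂ) = ((p.eval x : ℝ) : ℂ) + ((q.eval x : ℝ) : ℂ) * I := by
  refine ⟨∑ i ∈ Finset.range (d + 1), Polynomial.C (P.coeff i).re * Polynomial.X ^ i,
    ∑ i ∈ Finset.range (d + 1), Polynomial.C (P.coeff i).im * Polynomial.X ^ i, ?_, ?_, ?_⟩
  · refine Polynomial.natDegree_sum_le_of_forall_le _ _ fun i hi => ?_
    exact (Polynomial.natDegree_C_mul_X_pow_le _ _).trans (by simp at hi; omega)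
  · refine Polynomial.natDegree_sum_le_of_forall_le _ _ fun i hi => ?_
    exact (Polynomial.natDegree_C_mul_X_pow_le _ _).trans (by simp at hi; omega)
  · intro x
    rw [Polynomial.eval_eq_sum_range' (n := d + 1) (by omega)]
    simp only [Polynomial.eval_finsetSum, Polynomial.eval_mul, Polynomial.eval_C,
      Polynomial.eval_pow, Polynomial.eval_X]
    push_cast
    rw [Finset.sum_mul, ← Finset.sum_add_distrib]
    refine Finset.sum_congr rfl fun i _ => ?_
    conv_lhs => rw [← re_add_im (P.coeff i)]
    ring

lemma decay (g : ℕ) (hg : 2 ≤ g) (R : ℂ → ℂ)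
    (hRinf : Tendsto (fun z : ℂ => R z / z ^ (g + 1)) (cocompact ℂ) (nhds 1))
    (P : Polynomial ℂ) (hPdeg : P.natDegree ≤ g - 1) :
    ∃ C M0 : ℝ, ∀ z : ℂ, M0 ≤ ‖z‖ → ‖P.eval z / R z‖ ≤ C / ‖z‖ ^ 2 := by
  have h1 : ∀ᶠ z in cocompact ℂ, 1 / 2 < ‖R z / z ^ (g + 1)‖ := by
    refine hRinf.norm.eventually_const_lt ?_
    norm_num
  rw [← Metric.cobounded_eq_cocompact, ← comap_norm_atTop, eventually_comap] at h1
  obtain ⟨r, hr⟩ := eventually_atTop.1 h1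
  set D := ∑ i ∈ Finset.range g, ‖P.coeff i‖ with hD
  refine ⟨2 * D, max r 1, fun z hz => ?_⟩
  have hz1 : 1 ≤ ‖z‖ := (le_max_right _ _).trans hz
  have hz0 : 0 < ‖z‖ := by linarith
  have h2 := hr ‖z‖ ((le_max_left _ _).trans hz) z rfl
  rw [norm_div, norm_pow, lt_div_iff₀ (by positivity)] at h2
  have h3 : ‖P.eval z‖ ≤ D * ‖z‖ ^ (g - 1) := by
    rw [Polynomial.eval_eq_sum_range' (n := g) (by omega), hD, Finset.sum_mul]
    refine (norm_sum_le _ _).trans (Finset.sum_le_sum fun i hi => ?_)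
    rw [norm_mul, norm_pow]
    have : i ≤ g - 1 := by simp at hi; omega
    gcongr
  have hDn : 0 ≤ D := Finset.sum_nonneg fun i _ => norm_nonneg _
  have hpow : ‖z‖ ^ (g + 1) = ‖z‖ ^ (g - 1) * ‖z‖ ^ 2 := by
    rw [← pow_add]; congr 1; omega
  rw [norm_div]
  calc ‖P.eval z‖ / ‖R z‖ ≤ (D * ‖z‖ ^ (g - 1)) / (1 / 2 * ‖z‖ ^ (g + 1)) := by gcongr
    _ = 2 * D / ‖z‖ ^ 2 := by rw [hpow]; field_simp

lemma interior_arcs (g : ℕ) (a : ℕ → ℝ) (ham : ∀ i j, i < j → j ≤ 2 * g + 1 → a i < a j)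
    (s : Finset ℕ) (hs : ∀ t ∈ s, t ≤ g) (x : ℝ)
    (hx : x ∈ interior (⋃ t ∈ s, Icc (a (2 * t)) (a (2 * t + 1)))) :
    ∃ t ∈ s, x ∈ Ioo (a (2 * t)) (a (2 * t + 1)) := by
  have hle : ∀ i j, i ≤ j → j ≤ 2 * g + 1 → a i ≤ a j := by
    intro i j hij hj
    rcases hij.eq_or_lt with rfl | h
    · exact le_rfl
    · exact (ham i j h hj).le
  have hmem := mem_interior_iff_mem_nhds.1 hx
  have hx1 := interior_subset hx
  simp only [mem_iUnion] at hx1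
  obtain ⟨t, ht, hxt⟩ := hx1
  have htg := hs t ht
  refine ⟨t, ht, lt_of_le_of_ne hxt.1 ?_, lt_of_le_of_ne hxt.2 ?_⟩
  · rintro rfl
    have e1 : ∀ᶠ y in nhdsWithin (a (2 * t)) (Iio (a (2 * t))),
        y ∈ (⋃ t ∈ s, Icc (a (2 * t)) (a (2 * t + 1))) := nhdsWithin_le_nhds hmem
    have e2 : ∀ᶠ y in nhdsWithin (a (2 * t)) (Iio (a (2 * t))),
        ∀ r ∈ s, a (2 * r + 1) < a (2 * t) → a (2 * r + 1) < y := by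
      rw [Filter.eventually_all_finset]
      intro r _
      by_cases h : a (2 * r + 1) < a (2 * t)
      · filter_upwards [nhdsWithin_le_nhds (lt_mem_nhds h)] with y hy _ using hy
      · exact Eventually.of_forall fun y h' => absurd h' h
    obtain ⟨y, hy1, hy2, hy3⟩ := (e1.and (e2.and self_mem_nhdsWithin)).exists
    simp only [mem_iUnion] at hy1
    obtain ⟨r, hr, hyr⟩ := hy1
    have hy3 : y < a (2 * t) := hy3
    have hrt : r < t := by
      by_contra h
      have := hle (2 * t) (2 * r) (by omega) (by have := hs r hr; omega)
      linarith [hyr.1]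
    have := hy2 r hr (ham _ _ (by omega) (by omega))
    linarith [hyr.2]
  · rintro rfl
    have e1 : ∀ᶠ y in nhdsWithin (a (2 * t + 1)) (Ioi (a (2 * t + 1))),
        y ∈ (⋃ t ∈ s, Icc (a (2 * t)) (a (2 * t + 1))) := nhdsWithin_le_nhds hmem
    have e2 : ∀ᶠ y in nhdsWithin (a (2 * t + 1)) (Ioi (a (2 * t + 1))),
        ∀ r ∈ s, a (2 * t + 1) < a (2 * r) → y < a (2 * r) := by
      rw [Filter.eventually_all_finset]
      intro r _
      by_cases h : a (2 * t + 1) < a (2 * r)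
      · filter_upwards [nhdsWithin_le_nhds (gt_mem_nhds h)] with y hy _ using hy
      · exact Eventually.of_forall fun y h' => absurd h' h
    obtain ⟨y, hy1, hy2, hy3⟩ := (e1.and (e2.and self_mem_nhdsWithin)).exists
    simp only [mem_iUnion] at hy1
    obtain ⟨r, hr, hyr⟩ := hy1
    have hy3 : a (2 * t + 1) < y := hy3
    have hrg := hs r hr
    have hrt : t < r := by
      by_contra h
      have := hle (2 * r + 1) (2 * t + 1) (by omega) (by omega)
      linarith [hyr.2]
    have := hy2 r hr (ham _ _ (by omega) (by omega))
    linarith [hyr.1]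

lemma gap0 (g : ℕ) (hg : 2 ≤ g) (a : ℕ → ℝ) (ham : ∀ i j, i < j → j ≤ 2 * g + 1 → a i < a j)
    (w f l : ℝ → ℝ) (z : ℕ → ℝ)
    (hwpos : ∀ x ∈ Ioo (a 1) (a 2), 0 < w x)
    (hi : IntervalIntegrable (fun x => f x * w x) MeasureTheory.volume (a 1) (a 2))
    (hz : ∀ k < g - 2, z k ∈ Ioo (a (2 * (k + 1) + 1)) (a (2 * (k + 1) + 2)))
    (hf : ∀ x, f x = l x * ∏ k ∈ Finset.range (g - 2), (x - z k))
    (hl : ∀ x ∈ Icc (a 0) (a (2 * g + 1)), 0 < l x) :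
    0 < (-1 : ℝ) ^ g * ∫ x in (a 1)..(a 2), f x * w x := by
  rw [← intervalIntegral.integral_const_mul]
  apply intervalIntegral.intervalIntegral_pos_of_pos_on (hi.const_mul _) _ (ham 1 2 (by omega) (by omega))
  intro x hx
  have h1 := ham 0 1 (by omega) (by omega)
  have h2 := ham 2 (2 * g + 1) (by omega) (by omega)
  have h3 := hl x ⟨by linarith [hx.1], by linarith [hx.2]⟩
  have h4 := prod_sign z x 0 (g - 2) (by omega) (by omega) (by
      intro k _ hk
      have := (hz k hk).1
      have := ham 2 (2 * (k + 1) + 1) (by omega) (by omega)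
      linarith [hx.2])
  have h5 := hwpos x hx
  have e4 : (-1 : ℝ) ^ g = (-1 : ℝ) ^ (g - 2 - 0) := by
    obtain ⟨n, rfl⟩ : ∃ n, g = n + 2 := ⟨g - 2, by omega⟩
    simp only [Nat.add_sub_cancel, Nat.sub_zero]
    ring
  rw [hf, e4]
  have : (-1 : ℝ) ^ (g - 2 - 0) * (l x * (∏ k ∈ Finset.range (g - 2), (x - z k)) * w x) =
    l x * ((-1 : ℝ) ^ (g - 2 - 0) * ∏ k ∈ Finset.range (g - 2), (x - z k)) * w x := by ring
  rw [this]
  positivity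

/-- Sign of `Im ω₁` on the arcs: the boundary value from the upper half-plane of the
first normalized holomorphic differential satisfies `Im ω₁₊ > 0` on the interior of
`I_i` and `Im ω₁₊ < 0` on the interior of `I_e`. -/
theorem sign_of_Im_omega1
    (g : ℕ) (hg : 2 ≤ g)
    (a : ℕ → ℝ) (ha : ∀ i, i < 2 * g + 1 → a i < a (i + 1))
    (arcs : Set ℂ)
    (harcs : arcs = ⋃ t ∈ Finset.range (g + 1),
      Complex.ofReal '' Icc (a (2 * t)) (a (2 * t + 1)))
    (Ie Ii : Set ℝ)
    (hIe : Ie = Icc (a 0) (a 1) ∪ Icc (a (2 * g)) (a (2 * g + 1)))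
    (hIi : Ii = ⋃ k ∈ Finset.Icc 1 (g - 1), Icc (a (2 * k)) (a (2 * k + 1)))
    (R : ℂ → ℂ)
    (hRan : DifferentiableOn ℂ R arcsᶜ)
    (hRsq : ∀ z ∉ arcs, R z ^ 2 = ∏ j ∈ Finset.range (2 * g + 2), (z - (a j : ℂ)))
    (hRinf : Tendsto (fun z : ℂ => R z / z ^ (g + 1)) (cocompact ℂ) (nhds 1))
    (P : Polynomial ℂ) (hPdeg : P.natDegree ≤ g - 1)
    (ω : ℂ → ℂ)
    (hω : ∀ z ∉ arcs, ω z = Polynomial.eval z P / R z)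
    (ωp : ℝ → ℂ)
    (hωp : ∀ x : ℝ, (∀ i ≤ 2 * g + 1, x ≠ a i) →
        Tendsto ω (nhdsWithin (x : ℂ) {z : ℂ | 0 < z.im}) (nhds (ωp x)))
    (hnorm : ∀ k : ℕ, k ≤ g - 1 →
        (if k + 1 ≤ g - 1 then
            2 * ∫ x in (a (2 * k + 1))..(a (2 * k + 2)), ωp x
          else
            2 * ∫ x in (a 0)..(a (2 * g + 1)), ωp x)
          = if k = 0 then 1 else 0) :
    (∀ x ∈ interior Ii, 0 < (ωp x).im) ∧
    (∀ x ∈ interior Ie, (ωp x).im < 0) := by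
  have ham : ∀ i j, i < j → j ≤ 2 * g + 1 → a i < a j := by
    intro i j hij
    induction j, hij using Nat.le_induction with
    | base => intro hj; exact ha i (by omega)
    | succ j hij ih => intro hj; exact (ih (by omega)).trans (ha j (by omega))
  have hle : ∀ i j, i ≤ j → j ≤ 2 * g + 1 → a i ≤ a j := by
    intro i j hij hj
    rcases hij.eq_or_lt with rfl | h
    · exact le_rfl
    · exact (ham i j h hj).le
  have hUarcs : ∀ z : ℂ, 0 < z.im → z ∉ arcs := by
    intro z hz hzm
    rw [harcs] at hzm
    simp only [mem_iUnion] at hzm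
    obtain ⟨t, _, y, _, rfl⟩ := hzm
    simp at hz
  -- the square root in the upper half plane
  have hRS : ∀ z : ℂ, 0 < z.im → R z = ∏ j ∈ Finset.range (2 * g + 2), csq (z - (a j : ℂ)) := by
    intro z hz
    exact R_eq g a R (hRan.continuousOn.mono fun z hz => hUarcs z hz)
      (fun z hz => hRsq z (hUarcs z hz)) hRinf hz
  set T : Set ℝ := a '' Iic (2 * g + 1) with hTdef
  have hT : T.Countable := ((Set.finite_Iic _).image a).countable
  have hTnot : ∀ x : ℝ, x ∉ T → ∀ i ≤ 2 * g + 1, x ≠ a i := by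
    rintro x hx i hi rfl
    exact hx ⟨i, hi, rfl⟩
  set w : ℝ → ℝ := fun x => (∏ j ∈ Finset.range (2 * g + 2), Real.sqrt |x - a j|)⁻¹ with hwdef
  have hw : MeasureTheory.LocallyIntegrable w MeasureTheory.volume := by
    apply locInt_H
    intro i hi j hj hij
    simp only [Finset.coe_range, mem_Iio] at hi hj
    rcases lt_trichotomy i j with h | h | h
    · exact absurd hij (ham i j h (by omega)).ne
    · exact h
    · exact absurd hij (ham j i h (by omega)).ne'
  have hHpos : ∀ x : ℝ, (∀ i ≤ 2 * g + 1, x ≠ a i) →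
      0 < ∏ j ∈ Finset.range (2 * g + 2), Real.sqrt |x - a j| := by
    intro x hx
    refine Finset.prod_pos fun j hj => Real.sqrt_pos.2 (abs_pos.2 (sub_ne_zero.2 (hx j ?_)))
    simp at hj
    omega
  have hwpos : ∀ x : ℝ, (∀ i ≤ 2 * g + 1, x ≠ a i) → 0 < w x := by
    intro x hx
    exact inv_pos.2 (hHpos x hx)
  -- boundary values
  have hval : ∀ x : ℝ, x ∉ T → ωp x =
      Polynomial.eval (x : ℂ) P * (∏ j ∈ Finset.range (2 * g + 2), csq ((x : ℂ) - (a j : ℂ)))⁻¹ := by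
    intro x hx
    have hx' := hTnot x hx
    have hne : (nhdsWithin (x : ℂ) {z : ℂ | 0 < z.im}).NeBot := by
      rw [← mem_closure_iff_nhdsWithin_neBot, Complex.closure_setOfPred_lt_im]
      simp
    refine tendsto_nhds_unique (hωp x hx') ?_
    have h1 : Tendsto (fun z : ℂ => Polynomial.eval z P *
        (∏ j ∈ Finset.range (2 * g + 2), csq (z - (a j : ℂ)))⁻¹)
        (nhdsWithin (x : ℂ) {z : ℂ | 0 < z.im})
        (nhds (Polynomial.eval (x : ℂ) P *
          (∏ j ∈ Finset.range (2 * g + 2), csq ((x : ℂ) - (a j : ℂ)))⁻¹)) := by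
      refine Tendsto.mul ((P.continuous.tendsto _).mono_left nhdsWithin_le_nhds) ?_
      refine Tendsto.inv₀ (tendsto_finsetProd _ fun j hj => ?_) ?_
      · have hxj : x - a j ≠ 0 := sub_ne_zero.2 (hx' j (by simp at hj; omega))
        have h2 := csq_contWithin hxj
        rw [ofReal_sub] at h2
        refine h2.tendsto.comp (tendsto_nhdsWithin_iff.2 ⟨?_, ?_⟩)
        · have : Continuous (fun z : ℂ => z - (a j : ℂ)) := by fun_prop
          exact (this.tendsto _).mono_left nhdsWithin_le_nhds
        · filter_upwards [self_mem_nhdsWithin] with z hz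
          have hz : 0 < z.im := hz
          simpa using hz.le
      · refine Finset.prod_ne_zero_iff.2 fun j hj => csq_ne ?_
        have hxj : x - a j ≠ 0 := sub_ne_zero.2 (hx' j (by simp at hj; omega))
        exact_mod_cast hxj
    refine h1.congr' ?_
    filter_upwards [self_mem_nhdsWithin] with z hz
    rw [hω z (hUarcs z hz), hRS z hz, div_eq_mul_inv]
  -- the contour integral
  have hG : Tendsto (fun M : ℝ => ∫ x in (-M)..M, ωp x) atTop (nhds 0) := by
    obtain ⟨C, M0, hC⟩ := decay g hg R hRinf P hPdeg
    refine contour ω ωp w ?_ hw T hT ?_ C M0 ?_ (fun x hx => hωp x (hTnot x hx))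
    · have hopen : IsOpen {z : ℂ | 0 < z.im} := isOpen_lt continuous_const Complex.continuous_im
      have h1 : DifferentiableOn ℂ (fun z => Polynomial.eval z P / R z) {z : ℂ | 0 < z.im} := by
        refine P.differentiable.differentiableOn.div (hRan.mono fun z hz => hUarcs z hz) ?_
        intro z hz h0
        have h2 := hRsq z (hUarcs z hz)
        rw [h0] at h2
        have h3 : ∏ j ∈ Finset.range (2 * g + 2), (z - (a j : ℂ)) = 0 := by
          rw [← h2]; simp
        obtain ⟨j, _, hj⟩ := Finset.prod_eq_zero_iff.1 h3
        have := congrArg Complex.im hj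
        simp at this
        have hz : 0 < z.im := hz
        exact hz.ne' this
      exact h1.congr fun z hz => hω z (hUarcs z hz)
    · intro M
      have hcomp : IsCompact (Icc (-M) M ×ˢ Icc (0 : ℝ) 1) := isCompact_Icc.prod isCompact_Icc
      have hcont : Continuous (fun y : ℝ × ℝ => P.eval ((y.1 : ℂ) + y.2 * I)) :=
        P.continuous.comp (by fun_prop)
      obtain ⟨K, hK⟩ := hcomp.exists_bound_of_continuousOn hcont.continuousOn
      refine ⟨K, fun x hx hxT ε hε => ?_⟩
      have him : 0 < ((x : ℂ) + ε * I).im := by simpa using hε.1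
      rw [hω _ (hUarcs _ him), hRS _ him, div_eq_mul_inv, norm_mul]
      have h1 := hK (x, ε) ⟨hx, Ioo_subset_Icc_self hε⟩
      have hH := hHpos x (hTnot x hxT)
      have h2 : ‖(∏ j ∈ Finset.range (2 * g + 2), csq ((x : ℂ) + ε * I - (a j : ℂ)))⁻¹‖ ≤ w x := by
        rw [norm_inv, norm_prod]
        refine inv_anti₀ hH (Finset.prod_le_prod (fun _ _ => Real.sqrt_nonneg _) fun j _ => ?_)
        rw [norm_sq']
        apply Real.sqrt_le_sqrt
        have := Complex.abs_re_le_norm ((x : ℂ) + ε * I - (a j : ℂ))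
        simpa using this
      exact mul_le_mul h1 h2 (norm_nonneg _) ((norm_nonneg _).trans h1)
    · intro z hz hz2
      rw [hω z (hUarcs z hz)]
      exact hC z hz2
  -- integrability
  have hInt : ∀ c d : ℝ, IntervalIntegrable ωp MeasureTheory.volume c d := by
    intro c d
    have h1 : IntervalIntegrable (fun x : ℝ => ‖P.eval (x : ℂ)‖ * w x) MeasureTheory.volume c d := by
      refine ((hw.integrableOn_isCompact isCompact_uIcc).intervalIntegrable).continuousOn_mul ?_
      exact (P.continuous.comp continuous_ofReal).norm.continuousOn
    have hae : (fun x : ℝ => Polynomial.eval (x : ℂ) P *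
        (∏ j ∈ Finset.range (2 * g + 2), csq ((x : ℂ) - (a j : ℂ)))⁻¹) =ᵐ[MeasureTheory.volume] ωp := by
      filter_upwards [hT.ae_notMem MeasureTheory.volume] with x hx
      exact (hval x hx).symm
    have hmeas : Measurable (fun x : ℝ => Polynomial.eval (x : ℂ) P *
        (∏ j ∈ Finset.range (2 * g + 2), csq ((x : ℂ) - (a j : ℂ)))⁻¹) := by
      refine ((P.continuous.comp continuous_ofReal).measurable).mul (Measurable.inv ?_)
      refine Finset.measurable_fun_prod _ fun j _ => ?_
      unfold csq
      fun_prop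
    have h2 : IntervalIntegrable (fun x : ℝ => Polynomial.eval (x : ℂ) P *
        (∏ j ∈ Finset.range (2 * g + 2), csq ((x : ℂ) - (a j : ℂ)))⁻¹) MeasureTheory.volume c d := by
      refine h1.mono_fun' hmeas.aestronglyMeasurable (Eventually.of_forall fun x => ?_)
      simp only
      rw [norm_mul, norm_inv, norm_prod]
      apply le_of_eq
      congr 2
      refine Finset.prod_congr rfl fun j _ => ?_
      rw [norm_sq', ← ofReal_sub, Complex.norm_real, Real.norm_eq_abs]
    exact h2.congr_ae (MeasureTheory.ae_restrict_of_ae hae)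
  obtain ⟨p, q, hpd, hqd, hpq⟩ := poly_split P (g - 1) hPdeg
  have hform : ∀ (x : ℝ) (m : ℕ), x ∉ T → m ≤ 2 * g + 2 → (∀ k < m, a k < x) →
      (∀ k, m ≤ k → k < 2 * g + 2 → x < a k) →
      ωp x = (((p.eval x * w x : ℝ) : ℂ) + ((q.eval x * w x : ℝ) : ℂ) * I) *
        (I ^ (2 * g + 2 - m))⁻¹ := by
    intro x m hx hm h1 h2
    rw [hval x hx, csq_prod a x m (2 * g + 2) hm h1 h2, hpq x, hwdef]
    simp only
    push_cast
    rw [mul_inv]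
    ring
  have hintr : ∀ (r : Polynomial ℝ) (c d : ℝ),
      IntervalIntegrable (fun x => r.eval x * w x) MeasureTheory.volume c d := by
    intro r c d
    exact ((hw.integrableOn_isCompact isCompact_uIcc).intervalIntegrable).continuousOn_mul
      r.continuous.continuousOn
  have hofr : ∀ (r : Polynomial ℝ) (c d : ℝ),
      IntervalIntegrable (fun x => ((r.eval x * w x : ℝ) : ℂ)) MeasureTheory.volume c d :=
    fun r c d => ⟨(hintr r c d).1.ofReal, (hintr r c d).2.ofReal⟩
  have hpiece : ∀ (c d : ℝ) (m : ℕ), c ≤ d → m ≤ 2 * g + 2 →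
      (∀ x ∈ Ioc c d, x ∉ T → (∀ k < m, a k < x) ∧ (∀ k, m ≤ k → k < 2 * g + 2 → x < a k)) →
      ∫ x in c..d, ωp x = (((∫ x in c..d, p.eval x * w x : ℝ) : ℂ) +
        ((∫ x in c..d, q.eval x * w x : ℝ) : ℂ) * I) * (I ^ (2 * g + 2 - m))⁻¹ := by
    intro c d m hcd hm hx
    have h1 : ∫ x in c..d, ωp x = ∫ x in c..d, (((p.eval x * w x : ℝ) : ℂ) +
        ((q.eval x * w x : ℝ) : ℂ) * I) * (I ^ (2 * g + 2 - m))⁻¹ := by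
      apply intervalIntegral.integral_congr_ae
      filter_upwards [hT.ae_notMem MeasureTheory.volume] with x hxT hxm
      rw [uIoc_of_le hcd] at hxm
      exact hform x m hxT hm (hx x hxm hxT).1 (hx x hxm hxT).2
    rw [h1, intervalIntegral.integral_mul_const, intervalIntegral.integral_add,
      intervalIntegral.integral_mul_const, intervalIntegral.integral_ofReal,
      intervalIntegral.integral_ofReal]
    · exact hofr p c d
    · exact (hofr q c d).mul_const I
  have hIpow : ∀ n : ℕ, (I ^ (2 * n))⁻¹ = (((-1 : ℝ) ^ n : ℝ) : ℂ) := by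
    intro n
    rw [pow_mul, I_sq]
    push_cast
    rw [← inv_pow]
    norm_num
  have hsub : ∀ x, x ∉ T → ∀ i ≤ 2 * g + 1, ∀ c, x ≤ c → c = a i → x < a i := by
    intro x hx i hi c hc hca
    exact lt_of_le_of_ne (hca ▸ hc) (hTnot x hx i hi)
  -- gaps
  have hgap : ∀ k, k < g - 1 →
      2 * (∫ x in (a (2 * k + 1))..(a (2 * k + 2)), p.eval x * w x) * (-1 : ℝ) ^ (g - k) =
        (if k = 0 then 1 else 0) ∧
      (∫ x in (a (2 * k + 1))..(a (2 * k + 2)), q.eval x * w x) = 0 := by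
    intro k hk
    have h1 := hnorm k (by omega)
    rw [if_pos (by omega), hpiece _ _ (2 * k + 2) (hle _ _ (by omega) (by omega)) (by omega) ?_,
      show 2 * g + 2 - (2 * k + 2) = 2 * (g - k) by omega, hIpow] at h1
    · have hre := congrArg Complex.re h1
      have him := congrArg Complex.im h1
      have e1 : ((if k = 0 then 1 else 0 : ℂ)).re = (if k = 0 then 1 else 0 : ℝ) := by
        split_ifs <;> simp
      have e2 : ((if k = 0 then 1 else 0 : ℂ)).im = 0 := by
        split_ifs <;> simp
      rw [e1] at hre
      rw [e2] at him
      simp only [mul_re, mul_im, add_re, add_im, ofReal_re, ofReal_im, I_re, I_im, re_ofNat,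
        im_ofNat] at hre him
      constructor
      · rw [← hre]; ring
      · have hs : (-1 : ℝ) ^ (g - k) ≠ 0 := pow_ne_zero _ (by norm_num)
        have : 2 * (∫ x in (a (2 * k + 1))..(a (2 * k + 2)), q.eval x * w x) *
            (-1 : ℝ) ^ (g - k) = 0 := by rw [← him]; ring
        simpa [hs] using this
    · intro x hx hxT
      refine ⟨fun i hi => lt_of_le_of_lt (hle i (2 * k + 1) (by omega) (by omega)) hx.1, ?_⟩
      intro i hi hi2
      exact lt_of_lt_of_le (hsub x hxT (2 * k + 2) (by omega) _ hx.2 rfl) (hle _ _ hi (by omega))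
  -- exterior
  have hmid : ∫ x in (a 0)..(a (2 * g + 1)), ωp x = 0 := by
    have h1 := hnorm (g - 1) le_rfl
    rw [if_neg (by omega), if_neg (by omega)] at h1
    simpa using h1
  have hext : Tendsto (fun M : ℝ =>
      ((((∫ x in (a (2 * g + 1))..M, p.eval x * w x) +
        (-1 : ℝ) ^ (g + 1) * ∫ x in (-M)..(a 0), p.eval x * w x : ℝ) : ℂ) +
      (((∫ x in (a (2 * g + 1))..M, q.eval x * w x) +
        (-1 : ℝ) ^ (g + 1) * ∫ x in (-M)..(a 0), q.eval x * w x : ℝ) : ℂ) * I)) atTop (nhds 0) := by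
    refine hG.congr' ?_
    filter_upwards [eventually_ge_atTop (a (2 * g + 1)), eventually_ge_atTop (- a 0)] with M hM1 hM2
    rw [← intervalIntegral.integral_add_adjacent_intervals (hInt (-M) (a 0)) (hInt (a 0) M),
      ← intervalIntegral.integral_add_adjacent_intervals (hInt (a 0) (a (2 * g + 1))) (hInt _ M),
      hmid, hpiece (-M) (a 0) 0 (by linarith) (by omega) ?_,
      hpiece (a (2 * g + 1)) M (2 * g + 2) hM1 le_rfl ?_,
      show 2 * g + 2 - 0 = 2 * (g + 1) by omega, hIpow]
    · simp only [Nat.sub_self, pow_zero, inv_one, mul_one, zero_add]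
      push_cast
      ring
    · intro x hx hxT
      refine ⟨fun i hi => lt_of_le_of_lt (hle i (2 * g + 1) (by omega) (by omega)) hx.1, ?_⟩
      intro i hi hi2
      omega
    · intro x hx hxT
      refine ⟨fun i hi => by omega, ?_⟩
      intro i hi hi2
      exact lt_of_lt_of_le (hsub x hxT 0 (by omega) _ hx.2 rfl) (hle _ _ hi (by omega))
  have hextp := (Complex.continuous_re.tendsto 0).comp hext
  have hextq := (Complex.continuous_im.tendsto 0).comp hext
  simp only [Function.comp_def, add_re, add_im, mul_re, mul_im, ofReal_re, ofReal_im, I_re, I_im,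
    mul_zero, mul_one, zero_mul, sub_zero, add_zero, zero_add, zero_re, zero_im] at hextp hextq
  have hw0 : ∀ x ∈ Ioo (a 1) (a 2), 0 < w x := by
    intro x hx
    apply hwpos
    rintro i hi rfl
    rcases Nat.lt_or_ge i 2 with h | h
    · exact absurd (hle i 1 (by omega) (by omega)) (not_le.2 hx.1)
    · exact absurd (hle _ i h hi) (not_le.2 hx.2)
  have hg0 := hgap 0 (by omega)
  simp only [mul_zero, zero_add, if_true, Nat.sub_zero] at hg0
  -- the imaginary part vanishes
  have hq0 : ∀ x, q.eval x = 0 := by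
    obtain ⟨z, l, hz, hf, hl⟩ := core g hg a ham w hw hwpos q hqd
      (fun k hk => (hgap (k + 1) (by omega)).2) hextq
    rcases hl with hl | hl | hl
    · intro x; rw [hf, hl, zero_mul]
    · have := gap0 g hg a ham w (fun x => q.eval x) l z hw0 (hintr q _ _) hz hf hl
      rw [hg0.2] at this
      simp at this
    · have := gap0 g hg a ham w (fun x => (-q).eval x) (fun x => - l x) z hw0 (hintr (-q) _ _) hz
        (fun x => by simp [hf]) (fun x hx => neg_pos.2 (hl x hx))
      simp only [Polynomial.eval_neg, neg_mul, intervalIntegral.integral_neg, hg0.2] at this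
      simp at this
  obtain ⟨z, l, hz, hf, hl⟩ := core g hg a ham w hw hwpos p hpd
    (fun k hk => by
      have := (hgap (k + 1) (by omega)).1
      rw [if_neg (by omega)] at this
      have hs : (-1 : ℝ) ^ (g - (k + 1)) ≠ 0 := pow_ne_zero _ (by norm_num)
      simpa [hs] using this) hextp
  have hlpos : ∀ x ∈ Icc (a 0) (a (2 * g + 1)), 0 < l x := by
    rcases hl with hl | hl | hl
    · have h1 := hg0.1
      simp only [hf, hl, zero_mul] at h1
      simp at h1
    · exact hl
    · have := gap0 g hg a ham w (fun x => (-p).eval x) (fun x => - l x) z hw0 (hintr (-p) _ _) hz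
        (fun x => by simp [hf]) (fun x hx => neg_pos.2 (hl x hx))
      simp only [Polynomial.eval_neg, neg_mul, intervalIntegral.integral_neg] at this
      linarith [hg0.1]
  -- values on the arcs
  have harc : ∀ t ≤ g, ∀ x ∈ Ioo (a (2 * t)) (a (2 * t + 1)),
      0 < w x ∧ 0 < l x ∧ (ωp x).im =
        - ((-1 : ℝ) ^ (g - t) * (l x * ∏ k ∈ Finset.range (g - 2), (x - z k)) * w x) := by
    intro t ht x hx
    have hxT : x ∉ T := by
      rintro ⟨i, hi, rfl⟩
      have hi : i ≤ 2 * g + 1 := hi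
      rcases Nat.lt_or_ge i (2 * t + 1) with h | h
      · exact absurd (hle i (2 * t) (by omega) (by omega)) (not_le.2 hx.1)
      · exact absurd (hle _ i h hi) (not_le.2 hx.2)
    refine ⟨hwpos x (hTnot x hxT), hlpos x ⟨(hle 0 (2 * t) (by omega) (by omega)).trans hx.1.le,
      hx.2.le.trans (hle _ _ (by omega) le_rfl)⟩, ?_⟩
    rw [hform x (2 * t + 1) hxT (by omega)
      (fun i hi => lt_of_le_of_lt (hle i (2 * t) (by omega) (by omega)) hx.1)
      (fun i hi hi2 => lt_of_lt_of_le hx.2 (hle _ i hi (by omega))), hq0,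
      show 2 * g + 2 - (2 * t + 1) = 2 * (g - t) + 1 by omega, pow_succ, mul_inv, hIpow, ← hf, inv_I]
    simp only [mul_re, mul_im, add_re, add_im, ofReal_re, ofReal_im, I_re, I_im, neg_re, neg_im]
    ring
  constructor
  · intro x hx
    rw [hIi] at hx
    obtain ⟨t, ht, hxt⟩ := interior_arcs g a ham _ (fun t ht => by simp at ht; omega) x hx
    simp only [Finset.mem_Icc] at ht
    obtain ⟨h1, h2, h3⟩ := harc t (by omega) x hxt
    have h4 := prod_sign z x (t - 1) (g - 2) (by omega)
      (fun k hk => by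
        have := (hz k (by omega)).2
        have := hle (2 * (k + 1) + 2) (2 * t) (by omega) (by omega)
        linarith [hxt.1])
      (fun k hk hk2 => by
        have := (hz k (by omega)).1
        have := hle (2 * t + 1) (2 * (k + 1) + 1) (by omega) (by omega)
        linarith [hxt.2])
    rw [h3, show g - t = (g - 2 - (t - 1)) + 1 by omega, pow_succ]
    have : - ((-1 : ℝ) ^ (g - 2 - (t - 1)) * -1 *
        (l x * ∏ k ∈ Finset.range (g - 2), (x - z k)) * w x) =
      l x * ((-1 : ℝ) ^ (g - 2 - (t - 1)) * ∏ k ∈ Finset.range (g - 2), (x - z k)) * w x := by ring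
    rw [this]
    positivity
  · intro x hx
    have hIe' : Ie = ⋃ t ∈ ({0, g} : Finset ℕ), Icc (a (2 * t)) (a (2 * t + 1)) := by
      rw [hIe]; ext y; simp
    rw [hIe'] at hx
    obtain ⟨t, ht, hxt⟩ := interior_arcs g a ham _ (fun t ht => by simp at ht; omega) x hx
    simp only [Finset.mem_insert, Finset.mem_singleton] at ht
    obtain ⟨h1, h2, h3⟩ := harc t (by omega) x hxt
    have h4 : 0 < (-1 : ℝ) ^ (g - t) * ∏ k ∈ Finset.range (g - 2), (x - z k) := by
      rcases ht with rfl | rfl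
      · have h4 := prod_sign z x 0 (g - 2) (by omega) (by omega)
          (fun k hk hk2 => by
            have := (hz k (by omega)).1
            have := hle 1 (2 * (k + 1) + 1) (by omega) (by omega)
            have := hxt.2
            simp only [mul_zero, zero_add] at this
            linarith)
        have e : (-1 : ℝ) ^ (g - 0) = (-1 : ℝ) ^ (g - 2 - 0) := by
          rw [show g - 0 = (g - 2 - 0) + 2 by omega, pow_add]; norm_num
        rw [e]
        exact h4
      · have h4 := prod_sign z x (t - 2) (t - 2) le_rfl
          (fun k hk => by
            have := (hz k (by omega)).2
            have := hle (2 * (k + 1) + 2) (2 * t) (by omega) (by omega)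
            linarith [hxt.1]) (by omega)
        simpa using h4
    rw [h3]
    have : (-1 : ℝ) ^ (g - t) * (l x * ∏ k ∈ Finset.range (g - 2), (x - z k)) * w x =
      l x * ((-1 : ℝ) ^ (g - t) * ∏ k ∈ Finset.range (g - 2), (x - z k)) * w x := by ring
    rw [this]
    have : 0 < l x * ((-1 : ℝ) ^ (g - t) * ∏ k ∈ Finset.range (g - 2), (x - z k)) * w x := by
      positivity
    linarith
end
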